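/- There exists a constant C0 > 0 such that for every even n and every integer d with 3 ≤ d ≤ n^{1/10}, if G is a uniformly random d-regular graph on n vertices (G ~ μ_{d,n}) and Y denotes the number of perfect matchings of G, then P(|Y − E[Y]| ≥ d^{−1.1}·E[Y]) ≤ C0·d^{−1.1}. -/

import Mathlib

open Filter Topology

/-- Degree of a vertex in a graph on `Fin n`. -/
noncomputable def gDeg {n : ℕ} (G : SimpleGraph (Fin n)) (v : Fin n) : ℕ :=
  Nat.card {w : Fin n // G.Adj v w}

/-- `G` is a `d`-regular graph. -/
def IsRegularGraph {n : ℕ} (G : SimpleGraph (Fin n)) (d : ℕ) : Prop :=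
  ∀ v, gDeg G v = d

open scoped Classical in
/-- The uniform probability distribution `μ_{d,n}` on the `d`-regular graphs on `{1,…,n}`. -/
noncomputable def mu (n d : ℕ) : SimpleGraph (Fin n) → ℝ := fun G =>
  if IsRegularGraph G d then
    (Nat.card {H : SimpleGraph (Fin n) // IsRegularGraph H d} : ℝ)⁻¹
  else 0

/-- `p` is a probability distribution on a finite or countable space. -/
def IsProbC {α : Type*} (p : α → ℝ) : Prop :=
  (∀ x, 0 ≤ p x) ∧ ∑' x, p x = 1

/-- Probability of an event `A` under the distribution `p`. -/
noncomputable def probOf {α : Type*} (p : α → ℝ) (A : Set α) : ℝ := ∑' x : A, p x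

/-- Total variation distance. -/
noncomputable def tvDist {α : Type*} (p q : α → ℝ) : ℝ := (1/2) * ∑' x, |p x - q x|

/-- `π` is a coupling of `p` and `q`. -/
def IsCoupling {α β : Type*} (π : α × β → ℝ) (p : α → ℝ) (q : β → ℝ) : Prop :=
  IsProbC π ∧ (∀ a, ∑' b, π (a, b) = p a) ∧ (∀ b, ∑' a, π (a, b) = q b)

/-- Expectation of `f` under the distribution `p`. -/
noncomputable def expec {α : Type*} (p f : α → ℝ) : ℝ := ∑' x, p x * f x

/-- The number of perfect matchings of `G` (1-regular spanning subgraphs). -/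
noncomputable def pmCount {n : ℕ} (G : SimpleGraph (Fin n)) : ℕ :=
  Nat.card {M : SimpleGraph (Fin n) // M ≤ G ∧ IsRegularGraph M 1}

/-- The main exponent of the enumeration formula, in terms of the averages `P` and `R`. -/
noncomputable def lam (P R : ℝ) : ℝ := P / 2 + P ^ 2 / 4 + R

/-- The majorant of `lam` which controls the error terms. -/
noncomputable def lamt (P R : ℝ) : ℝ := P + P ^ 2 + R

/-- The statistics of a random step of the edge exposure process. -/
structure OneStep {ι : Type*} (s g : Finset ι) (w α σ π : ι → ℝ) (D P R r M : ℝ) : Prop where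
  sub : g ⊆ s
  w_nonneg : ∀ i ∈ s, 0 ≤ w i
  sum_w : ∑ i ∈ s, w i = 1
  α_nonneg : ∀ i ∈ s, 0 ≤ α i
  σ_nonneg : ∀ i ∈ s, 0 ≤ σ i
  π_nonneg : ∀ i ∈ s, 0 ≤ π i
  sum_α : ∑ i ∈ s, w i * α i = 2 * P
  sum_σ : ∑ i ∈ s, w i * σ i = 4 * R
  sum_π : ∑ i ∈ s, w i * π i = P ^ 2 + P ^ 2 / (D - 1) - r / (D * (D - 1))
  sum_good : ∑ i ∈ g, w i = 1 - (P + 2 * R) / (D - 1)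
  bound : ∀ i ∈ s, α i * (1 + P) + σ i + π i ≤ M
  r_nonneg : 0 ≤ r
  r_le : r ≤ M * (P * D)
  P_nonneg : 0 ≤ P
  R_nonneg : 0 ≤ R
  lamt_le : lamt P R ≤ M
  one_le : 1 ≤ M
  D_large : 100 ≤ D
  M_le : 30000 * M ≤ D - 2

namespace OneStep

variable {ι : Type*} {s g : Finset ι} {w α σ π : ι → ℝ} {D P R r M : ℝ}

/-- Increment of `lam`. -/
noncomputable def dlam (α σ π : ι → ℝ) (D P R : ℝ) (i : ι) : ℝ :=
  ((P - α i) * (1 + P) + 2 * R - σ i + π i) / (D - 2) + (P - α i) ^ 2 / (D - 2) ^ 2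

/-- Increment of `lamt`. -/
noncomputable def dlamt (α σ π : ι → ℝ) (D P R : ℝ) (i : ι) : ℝ :=
  (2 * (P - α i) * (1 + 2 * P) + 2 * R - σ i + π i) / (D - 2)
    + 4 * ((P - α i) ^ 2 / (D - 2) ^ 2)

/-- Size of a step. -/
noncomputable def xi (α σ π : ι → ℝ) (P R : ℝ) (i : ι) : ℝ :=
  α i * (1 + P) + σ i + π i + lamt P R

lemma lam_next (i : ι) (hD : D - 2 ≠ 0) :
    lam ((P * D - 2 * α i) / (D - 2)) ((R * D - σ i + π i) / (D - 2))
      = lam P R + dlam α σ π D P R i := by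
  unfold lam dlam
  field_simp
  ring

lemma lamt_next (i : ι) (hD : D - 2 ≠ 0) :
    lamt ((P * D - 2 * α i) / (D - 2)) ((R * D - σ i + π i) / (D - 2))
      = lamt P R + dlamt α σ π D P R i := by
  unfold lamt dlamt
  field_simp
  ring

lemma lamt_nonneg (H : OneStep s g w α σ π D P R r M) : 0 ≤ lamt P R := by
  have := H.P_nonneg; have := H.R_nonneg; unfold lamt; positivity

lemma sq_div_le (H : OneStep s g w α σ π D P R r M) {i : ι} (hi : i ∈ s) :
    (P - α i) ^ 2 / (D - 2) ^ 2 ≤ (P ^ 2 + α i) / 100 / (D - 2) := by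
  have hP := H.P_nonneg
  have ha := H.α_nonneg i hi
  have hb := H.bound i hi
  have := H.σ_nonneg i hi
  have := H.π_nonneg i hi
  have hD := H.D_large
  have hM := H.M_le
  have h1 : α i ≤ M := by nlinarith
  have hh : (0:ℝ) < D - 2 := by linarith
  have hM0 := H.one_le
  rw [div_div, div_le_div_iff₀ (by positivity) (by positivity)]
  have h2 : (P - α i) ^ 2 ≤ P ^ 2 + α i ^ 2 := by nlinarith [mul_nonneg hP ha]
  have h3 : α i ^ 2 * 100 ≤ α i * (D - 2) := by nlinarith
  have h4 : P ^ 2 * 100 ≤ P ^ 2 * (D - 2) := by nlinarith [sq_nonneg P]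
  have h4 : (P - α i) ^ 2 * 100 ≤ (P ^ 2 + α i) * (D - 2) := by linarith
  calc _ = ((P - α i) ^ 2 * 100) * (D - 2) := by ring
    _ ≤ ((P ^ 2 + α i) * (D - 2)) * (D - 2) := by gcongr
    _ = _ := by ring

lemma xi_nonneg (H : OneStep s g w α σ π D P R r M) {i : ι} (hi : i ∈ s) :
    0 ≤ xi α σ π P R i := by
  have := H.lamt_nonneg
  have := H.α_nonneg i hi
  have := H.σ_nonneg i hi
  have := H.π_nonneg i hi
  have := H.P_nonneg
  unfold xi; positivity

lemma xi_le (H : OneStep s g w α σ π D P R r M) {i : ι} (hi : i ∈ s) :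
    xi α σ π P R i ≤ 2 * M := by
  have := H.lamt_le
  have := H.bound i hi
  unfold xi; linarith

lemma lamt_le_xi (H : OneStep s g w α σ π D P R r M) {i : ι} (hi : i ∈ s) :
    lamt P R ≤ xi α σ π P R i := by
  have := H.α_nonneg i hi
  have := H.σ_nonneg i hi
  have := H.π_nonneg i hi
  have := H.P_nonneg
  have : 0 ≤ α i * (1 + P) := by positivity
  unfold xi; linarith

lemma abs_dlam_le (H : OneStep s g w α σ π D P R r M) {i : ι} (hi : i ∈ s) :
    |dlam α σ π D P R i| ≤ 5 * xi α σ π P R i / (D - 2) := by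
  have h1 := H.sq_div_le hi
  have hP := H.P_nonneg
  have hR := H.R_nonneg
  have ha := H.α_nonneg i hi
  have := H.σ_nonneg i hi
  have := H.π_nonneg i hi
  have hh : (0:ℝ) < D - 2 := by linarith [H.D_large]
  have h2 : 0 ≤ (P - α i) ^ 2 / (D - 2) ^ 2 := by positivity
  have hPa := mul_nonneg ha hP
  have hP2 := sq_nonneg P
  unfold dlam
  rw [abs_le]
  constructor
  · have : -(5 * xi α σ π P R i / (D - 2)) ≤
      ((P - α i) * (1 + P) + 2 * R - σ i + π i) / (D - 2) := by
      rw [← neg_div]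
      gcongr
      unfold xi lamt; nlinarith
    linarith
  · have : ((P - α i) * (1 + P) + 2 * R - σ i + π i) / (D - 2) + (P ^ 2 + α i) / 100 / (D - 2)
       ≤ 5 * xi α σ π P R i / (D - 2) := by
      rw [← add_div]
      gcongr
      unfold xi lamt; nlinarith
    linarith

lemma abs_dlamt_le (H : OneStep s g w α σ π D P R r M) {i : ι} (hi : i ∈ s) :
    |dlamt α σ π D P R i| ≤ 5 * xi α σ π P R i / (D - 2) := by
  have h1 := H.sq_div_le hi
  have hP := H.P_nonneg
  have hR := H.R_nonneg
  have ha := H.α_nonneg i hi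
  have := H.σ_nonneg i hi
  have := H.π_nonneg i hi
  have hh : (0:ℝ) < D - 2 := by linarith [H.D_large]
  have h2 : 0 ≤ (P - α i) ^ 2 / (D - 2) ^ 2 := by positivity
  have hPa := mul_nonneg ha hP
  have hP2 := sq_nonneg P
  unfold dlamt
  rw [abs_le]
  constructor
  · have : -(5 * xi α σ π P R i / (D - 2)) ≤
      (2 * (P - α i) * (1 + 2 * P) + 2 * R - σ i + π i) / (D - 2) := by
      rw [← neg_div]
      gcongr
      unfold xi lamt; nlinarith
    linarith
  · have : (2 * (P - α i) * (1 + 2 * P) + 2 * R - σ i + π i) / (D - 2)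
        + 4 * ((P ^ 2 + α i) / 100 / (D - 2))
       ≤ 5 * xi α σ π P R i / (D - 2) := by
      rw [← mul_div_assoc, ← add_div]
      gcongr
      unfold xi lamt; nlinarith
    linarith

lemma sum_xi_le (H : OneStep s g w α σ π D P R r M) :
    ∑ i ∈ s, w i * xi α σ π P R i ≤ 6 * lamt P R := by
  have hP := H.P_nonneg
  have hR := H.R_nonneg
  have hD := H.D_large
  have e : ∑ i ∈ s, w i * xi α σ π P R i
      = (∑ i ∈ s, w i * α i) * (1 + P) + ∑ i ∈ s, w i * σ i + ∑ i ∈ s, w i * π i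
        + (∑ i ∈ s, w i) * lamt P R := by
    rw [Finset.sum_mul, Finset.sum_mul, ← Finset.sum_add_distrib, ← Finset.sum_add_distrib,
      ← Finset.sum_add_distrib]
    refine Finset.sum_congr rfl fun i _ => ?_
    unfold xi; ring
  rw [e, H.sum_α, H.sum_σ, H.sum_π, H.sum_w]
  have h1 : P ^ 2 / (D - 1) ≤ P ^ 2 := div_le_self (by positivity) (by linarith)
  have h2 : 0 ≤ r / (D * (D - 1)) :=
    div_nonneg H.r_nonneg (mul_nonneg (by linarith) (by linarith))
  unfold lamt
  nlinarith [sq_nonneg P]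

lemma sum_xi_sq_le (H : OneStep s g w α σ π D P R r M) :
    ∑ i ∈ s, w i * xi α σ π P R i ^ 2 ≤ 12 * (M * lamt P R) := by
  have h1 := H.sum_xi_le
  have hM := H.one_le
  calc ∑ i ∈ s, w i * xi α σ π P R i ^ 2
      ≤ ∑ i ∈ s, (2 * M) * (w i * xi α σ π P R i) := by
        refine Finset.sum_le_sum fun i hi => ?_
        have := H.xi_le hi
        have h3 := H.xi_nonneg hi
        have h4 := mul_nonneg (H.w_nonneg i hi) h3
        nlinarith
    _ = (2 * M) * ∑ i ∈ s, w i * xi α σ π P R i := by rw [Finset.mul_sum]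
    _ ≤ (2 * M) * (6 * lamt P R) := by gcongr
    _ = _ := by ring

lemma sum_sq_bounds (H : OneStep s g w α σ π D P R r M) :
    0 ≤ ∑ i ∈ s, w i * (P - α i) ^ 2 ∧
      ∑ i ∈ s, w i * (P - α i) ^ 2 ≤ P ^ 2 + 2 * (M * P) := by
  refine ⟨Finset.sum_nonneg fun i hi => mul_nonneg (H.w_nonneg i hi) (sq_nonneg _), ?_⟩
  have hP := H.P_nonneg
  calc ∑ i ∈ s, w i * (P - α i) ^ 2
      ≤ ∑ i ∈ s, (P ^ 2 * w i + M * (w i * α i)) := by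
        refine Finset.sum_le_sum fun i hi => ?_
        have ha := H.α_nonneg i hi
        have := H.bound i hi
        have := H.σ_nonneg i hi
        have := H.π_nonneg i hi
        have hw := H.w_nonneg i hi
        have h1 : α i ≤ M := by nlinarith
        have h2 : (P - α i) ^ 2 ≤ P ^ 2 + M * α i := by nlinarith [mul_nonneg hP ha]
        nlinarith
    _ = P ^ 2 + 2 * (M * P) := by
        rw [Finset.sum_add_distrib, ← Finset.mul_sum, ← Finset.mul_sum, H.sum_w, H.sum_α]
        ring

lemma abs_sum_dlam_add_le (H : OneStep s g w α σ π D P R r M) :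
    |∑ i ∈ s, w i * dlam α σ π D P R i + (P + 2 * R) / (D - 1)|
      ≤ 8 * (M * lamt P R) / (D - 2) ^ 2 := by
  have hP := H.P_nonneg
  have hR := H.R_nonneg
  have hD := H.D_large
  have hM := H.one_le
  have hr := H.r_nonneg
  have hrM := H.r_le
  obtain ⟨hs0, hs1⟩ := H.sum_sq_bounds
  set S := ∑ i ∈ s, w i * (P - α i) ^ 2 with hS
  have e : ∑ i ∈ s, w i * dlam α σ π D P R i =
      (((∑ i ∈ s, w i) * P - ∑ i ∈ s, w i * α i) * (1 + P) + 2 * R * (∑ i ∈ s, w i)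
        - ∑ i ∈ s, w i * σ i + ∑ i ∈ s, w i * π i) / (D - 2) + S / (D - 2) ^ 2 := by
    rw [hS, Finset.sum_mul, ← Finset.sum_sub_distrib, Finset.sum_mul, Finset.mul_sum,
      ← Finset.sum_add_distrib, ← Finset.sum_sub_distrib, ← Finset.sum_add_distrib,
      Finset.sum_div, Finset.sum_div, ← Finset.sum_add_distrib]
    refine Finset.sum_congr rfl fun i _ => ?_
    unfold dlam; ring
  have h1 : (0:ℝ) < D - 1 := by linarith
  have h2 : (0:ℝ) < D - 2 := by linarith
  have h0 : (0:ℝ) < D := by linarith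
  rw [e, H.sum_α, H.sum_σ, H.sum_π, H.sum_w]
  have e2 : ((1 * P - 2 * P) * (1 + P) + 2 * R * 1 - 4 * R
        + (P ^ 2 + P ^ 2 / (D - 1) - r / (D * (D - 1)))) / (D - 2) + S / (D - 2) ^ 2
        + (P + 2 * R) / (D - 1)
      = (P ^ 2 - P - 2 * R - r / D) / ((D - 1) * (D - 2)) + S / (D - 2) ^ 2 := by
    field_simp
    ring
  rw [e2]
  have hrD : r / D ≤ M * P := by
    rw [div_le_iff₀ h0]; linarith
  have hrD0 : 0 ≤ r / D := by positivity
  have hL : M * lamt P R = M * P + M * P ^ 2 + M * R := by unfold lamt; ring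
  have m1 : P ^ 2 ≤ M * P ^ 2 := le_mul_of_one_le_left (sq_nonneg P) hM
  have m2 : P ≤ M * P := le_mul_of_one_le_left hP hM
  have m3 : R ≤ M * R := le_mul_of_one_le_left hR hM
  have hmono : ∀ X : ℝ, 0 ≤ X → X / ((D - 1) * (D - 2)) ≤ X / (D - 2) ^ 2 := by
    intro X hX
    apply div_le_div_of_nonneg_left hX (by positivity)
    nlinarith
  have hPM := mul_nonneg (le_trans zero_le_one hM) hP
  have hPM2 := mul_nonneg (le_trans zero_le_one hM) (sq_nonneg P)
  have hRM := mul_nonneg (le_trans zero_le_one hM) hR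
  rw [abs_le]
  constructor
  · have a1 := hmono (P + 2 * R + r / D) (by positivity)
    have a2 : -((P + 2 * R + r / D) / ((D - 1) * (D - 2))) ≤
        (P ^ 2 - P - 2 * R - r / D) / ((D - 1) * (D - 2)) := by
      rw [← neg_div]
      apply div_le_div_of_nonneg_right _ (by positivity)
      nlinarith [sq_nonneg P]
    have a3 : (P + 2 * R + r / D) / (D - 2) ^ 2 ≤ 8 * (M * lamt P R) / (D - 2) ^ 2 := by
      apply div_le_div_of_nonneg_right _ (by positivity)
      rw [hL]; linarith
    have a4 : 0 ≤ S / (D - 2) ^ 2 := by positivity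
    linarith
  · have a1 := hmono (P ^ 2) (by positivity)
    have a2 : (P ^ 2 - P - 2 * R - r / D) / ((D - 1) * (D - 2)) ≤ P ^ 2 / ((D - 1) * (D - 2)) := by
      apply div_le_div_of_nonneg_right _ (by positivity)
      linarith
    have a3 : P ^ 2 / (D - 2) ^ 2 + S / (D - 2) ^ 2 ≤ 8 * (M * lamt P R) / (D - 2) ^ 2 := by
      rw [← add_div]
      apply div_le_div_of_nonneg_right _ (by positivity)
      rw [hL]; linarith
    linarith

lemma sum_dlamt_le (H : OneStep s g w α σ π D P R r M) :
    ∑ i ∈ s, w i * dlamt α σ π D P R i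
      ≤ -(2 * lamt P R) / (D - 2) + 13 * (M * lamt P R) / (D - 2) ^ 2 := by
  have hP := H.P_nonneg
  have hR := H.R_nonneg
  have hD := H.D_large
  have hM := H.one_le
  have hr := H.r_nonneg
  obtain ⟨hs0, hs1⟩ := H.sum_sq_bounds
  set S := ∑ i ∈ s, w i * (P - α i) ^ 2 with hS
  have e : ∑ i ∈ s, w i * dlamt α σ π D P R i =
      (2 * ((∑ i ∈ s, w i) * P - ∑ i ∈ s, w i * α i) * (1 + 2 * P) + 2 * R * (∑ i ∈ s, w i)
        - ∑ i ∈ s, w i * σ i + ∑ i ∈ s, w i * π i) / (D - 2) + 4 * S / (D - 2) ^ 2 := by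
    rw [hS, Finset.sum_mul, ← Finset.sum_sub_distrib, Finset.mul_sum, Finset.sum_mul,
      Finset.mul_sum, Finset.mul_sum,
      ← Finset.sum_add_distrib, ← Finset.sum_sub_distrib, ← Finset.sum_add_distrib,
      Finset.sum_div, Finset.sum_div, ← Finset.sum_add_distrib]
    refine Finset.sum_congr rfl fun i _ => ?_
    unfold dlamt; ring
  have h1 : (0:ℝ) < D - 1 := by linarith
  have h2 : (0:ℝ) < D - 2 := by linarith
  have h0 : (0:ℝ) < D := by linarith
  rw [e, H.sum_α, H.sum_σ, H.sum_π, H.sum_w]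
  have hL : M * lamt P R = M * P + M * P ^ 2 + M * R := by unfold lamt; ring
  have m1 : P ^ 2 ≤ M * P ^ 2 := le_mul_of_one_le_left (sq_nonneg P) hM
  have hPM := mul_nonneg (le_trans zero_le_one hM) hP
  have hRM := mul_nonneg (le_trans zero_le_one hM) hR
  have b0 : 0 ≤ r / (D * (D - 1)) := by positivity
  have b1 : P ^ 2 / (D - 1) ≤ P ^ 2 / (D - 2) :=
    div_le_div_of_nonneg_left (sq_nonneg P) h2 (by linarith)
  have b2 : (2 * (1 * P - 2 * P) * (1 + 2 * P) + 2 * R * 1 - 4 * R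
        + (P ^ 2 + P ^ 2 / (D - 1) - r / (D * (D - 1)))) / (D - 2)
      ≤ (-(2 * lamt P R) + P ^ 2 / (D - 2)) / (D - 2) := by
    apply div_le_div_of_nonneg_right _ h2.le
    unfold lamt; nlinarith [sq_nonneg P]
  have b3 : (-(2 * lamt P R) + P ^ 2 / (D - 2)) / (D - 2)
      = -(2 * lamt P R) / (D - 2) + P ^ 2 / (D - 2) ^ 2 := by
    field_simp
  have b4 : P ^ 2 / (D - 2) ^ 2 + 4 * S / (D - 2) ^ 2 ≤ 13 * (M * lamt P R) / (D - 2) ^ 2 := by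
    rw [← add_div]
    apply div_le_div_of_nonneg_right _ (by positivity)
    rw [hL]; nlinarith [sq_nonneg P]
  linarith

lemma sum_bad_le (H : OneStep s g w α σ π D P R r M) :
    (P + 2 * R) / (D - 1) ≤ 2 * lamt P R / (D - 2) := by
  have hP := H.P_nonneg
  have hR := H.R_nonneg
  have hD := H.D_large
  apply div_le_div₀ (by unfold lamt; positivity) _ (by linarith) (by linarith)
  unfold lamt; nlinarith [sq_nonneg P]

/-- A sum over the good steps differs from the full sum by at most the weight of the bad steps. -/
lemma abs_sum_sub_sum_good_le [DecidableEq ι] (H : OneStep s g w α σ π D P R r M) {f : ι → ℝ}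
    {b : ℝ} (hb : ∀ i ∈ s, |f i| ≤ b) (hb0 : 0 ≤ b) :
    |∑ i ∈ s, w i * f i - ∑ i ∈ g, w i * f i| ≤ 2 * lamt P R / (D - 2) * b := by
  have e1 := Finset.sum_sdiff H.sub (f := fun i => w i * f i)
  have e2 := Finset.sum_sdiff H.sub (f := w)
  rw [H.sum_w, H.sum_good] at e2
  have : ∑ i ∈ s, w i * f i - ∑ i ∈ g, w i * f i = ∑ i ∈ s \ g, w i * f i := by linarith
  rw [this]
  calc |∑ i ∈ s \ g, w i * f i| ≤ ∑ i ∈ s \ g, |w i * f i| := Finset.abs_sum_le_sum_abs _ _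
    _ ≤ ∑ i ∈ s \ g, w i * b := by
        refine Finset.sum_le_sum fun i hi => ?_
        have hi' := (Finset.mem_sdiff.1 hi).1
        rw [abs_mul, abs_of_nonneg (H.w_nonneg i hi')]
        exact mul_le_mul_of_nonneg_left (hb i hi') (H.w_nonneg i hi')
    _ = ((P + 2 * R) / (D - 1)) * b := by
        rw [← Finset.sum_mul]; congr 1; linarith
    _ ≤ _ := mul_le_mul_of_nonneg_right H.sum_bad_le hb0

variable {κ κ' : ℝ}

/-- Linearised increment of the error term. -/
noncomputable def dq (α σ π : ι → ℝ) (D P R κ : ℝ) (i : ι) : ℝ :=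
  κ * (1 + 1.9 / (D - 2)) * dlamt α σ π D P R i + 1.9 * κ * lamt P R / (D - 2)

lemma error_next_le {i : ι}
    (hκ' : κ' ≤ κ * (1 + 1.9 / (D - 2)))
    (hn : 0 ≤ lamt P R + dlamt α σ π D P R i) :
    κ' * (lamt P R + dlamt α σ π D P R i) ≤ κ * lamt P R + dq α σ π D P R κ i := by
  have h := mul_le_mul_of_nonneg_right hκ' hn
  refine h.trans (le_of_eq ?_)
  unfold dq; ring

lemma abs_dq_le (H : OneStep s g w α σ π D P R r M) (hκ : 0 ≤ κ) {i : ι} (hi : i ∈ s) :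
    |dq α σ π D P R κ i| ≤ 7 * κ * xi α σ π P R i / (D - 2) := by
  have hD := H.D_large
  have h2 : (0:ℝ) < D - 2 := by linarith
  have h1 := H.abs_dlamt_le hi
  have h3 := H.lamt_le_xi hi
  have h4 := H.lamt_nonneg
  have h5 := H.xi_nonneg hi
  have h6 : 1.9 / (D - 2) ≤ (0.02 : ℝ) := by
    rw [div_le_iff₀ h2]; linarith
  have h7 : (0:ℝ) ≤ 1.9 / (D - 2) := by positivity
  unfold dq
  calc |κ * (1 + 1.9 / (D - 2)) * dlamt α σ π D P R i + 1.9 * κ * lamt P R / (D - 2)|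
      ≤ κ * (1 + 1.9 / (D - 2)) * |dlamt α σ π D P R i| + 1.9 * κ * lamt P R / (D - 2) := by
        refine (abs_add_le _ _).trans (le_of_eq ?_)
        rw [abs_mul, abs_of_nonneg (a := κ * (1 + 1.9 / (D - 2))) (by positivity),
          abs_of_nonneg (a := 1.9 * κ * lamt P R / (D - 2)) (by positivity)]
    _ ≤ κ * (1 + 0.02) * (5 * xi α σ π P R i / (D - 2))
          + 1.9 * κ * xi α σ π P R i / (D - 2) := by gcongr
    _ = (7 * κ * xi α σ π P R i) / (D - 2) := by ring

lemma sum_dq_le (H : OneStep s g w α σ π D P R r M) (hκ : 0 ≤ κ) :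
    ∑ i ∈ s, w i * dq α σ π D P R κ i
      ≤ -(0.1 * κ * lamt P R) / (D - 2) + 14 * κ * (M * lamt P R) / (D - 2) ^ 2 := by
  have hD := H.D_large
  have hM := H.one_le
  have h2 : (0:ℝ) < D - 2 := by linarith
  have h4 := H.lamt_nonneg
  have h6 : 1.9 / (D - 2) ≤ (0.02 : ℝ) := by
    rw [div_le_iff₀ h2]; linarith
  have h7 : (0:ℝ) ≤ 1.9 / (D - 2) := by positivity
  have e : ∑ i ∈ s, w i * dq α σ π D P R κ i
      = κ * (1 + 1.9 / (D - 2)) * (∑ i ∈ s, w i * dlamt α σ π D P R i)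
        + 1.9 * κ * lamt P R / (D - 2) * ∑ i ∈ s, w i := by
    rw [Finset.mul_sum, Finset.mul_sum, ← Finset.sum_add_distrib]
    refine Finset.sum_congr rfl fun i _ => ?_
    unfold dq; ring
  rw [e, H.sum_w]
  have h8 := mul_le_mul_of_nonneg_left H.sum_dlamt_le
    (show 0 ≤ κ * (1 + 1.9 / (D - 2)) by positivity)
  have h9 : κ * (1 + 1.9 / (D - 2)) *
      (-(2 * lamt P R) / (D - 2) + 13 * (M * lamt P R) / (D - 2) ^ 2)
      ≤ -(2 * κ * lamt P R) / (D - 2) + 14 * κ * (M * lamt P R) / (D - 2) ^ 2 := by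
    have e1 : κ * (1 + 1.9 / (D - 2)) *
      (-(2 * lamt P R) / (D - 2) + 13 * (M * lamt P R) / (D - 2) ^ 2)
      = -(2 * κ * lamt P R) / (D - 2) - (1.9 / (D - 2)) * (2 * κ * lamt P R / (D - 2))
        + κ * (1 + 1.9 / (D - 2)) * (13 * (M * lamt P R) / (D - 2) ^ 2) := by ring
    have e2 : κ * (1 + 1.9 / (D - 2)) * (13 * (M * lamt P R) / (D - 2) ^ 2)
        ≤ κ * (1 + 0.02) * (13 * (M * lamt P R) / (D - 2) ^ 2) := by gcongr
    have e3 : κ * (1 + 0.02) * (13 * (M * lamt P R) / (D - 2) ^ 2)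
        ≤ 14 * κ * (M * lamt P R) / (D - 2) ^ 2 := by
      rw [← mul_div_assoc]
      apply div_le_div_of_nonneg_right _ (by positivity)
      have : 0 ≤ κ * (M * lamt P R) := by positivity
      linarith
    have e4 : 0 ≤ (1.9 / (D - 2)) * (2 * κ * lamt P R / (D - 2)) := by positivity
    linarith
  have e5 : -(2 * κ * lamt P R) / (D - 2) + 1.9 * κ * lamt P R / (D - 2) * 1
      = -(0.1 * κ * lamt P R) / (D - 2) := by ring
  linarith

/-- One step of the upper bound. -/
lemma upper (H : OneStep s g w α σ π D P R r M) (hκ : 0 ≤ κ) (hκ1 : κ ≤ 1)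
    (hκ' : κ' ≤ κ * (1 + 1.9 / (D - 2))) (hMκ : 30000 * M ≤ κ * (D - 2))
    (hn : ∀ i ∈ g, 0 ≤ lamt P R + dlamt α σ π D P R i) :
    ∑ i ∈ g, w i * Real.exp (-(lam P R + dlam α σ π D P R i)
        + κ' * (lamt P R + dlamt α σ π D P R i)) ≤ Real.exp (-lam P R + κ * lamt P R) := by
  classical
  have hD := H.D_large
  have hM := H.one_le
  have hMle := H.M_le
  have h2 : (0:ℝ) < D - 2 := by linarith
  have h4 := H.lamt_nonneg
  set y : ι → ℝ := fun i => -dlam α σ π D P R i + dq α σ π D P R κ i with hy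
  have hyx : ∀ i ∈ s, |y i| ≤ 12 * xi α σ π P R i / (D - 2) := by
    intro i hi
    have a1 := H.abs_dlam_le hi
    have a2 := H.abs_dq_le hκ hi
    have a3 := H.xi_nonneg hi
    have a4 : 7 * κ * xi α σ π P R i / (D - 2) ≤ 7 * 1 * xi α σ π P R i / (D - 2) := by gcongr
    calc |y i| ≤ |dlam α σ π D P R i| + |dq α σ π D P R κ i| := by
          rw [hy]; refine (abs_add_le _ _).trans ?_; rw [abs_neg]
      _ ≤ 5 * xi α σ π P R i / (D - 2) + 7 * 1 * xi α σ π P R i / (D - 2) := by linarith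
      _ = _ := by ring
  have hyM : ∀ i ∈ s, |y i| ≤ 24 * M / (D - 2) := by
    intro i hi
    refine (hyx i hi).trans ?_
    apply div_le_div_of_nonneg_right _ h2.le
    linarith [H.xi_le hi]
  have hy1 : ∀ i ∈ s, |y i| ≤ 1 := by
    intro i hi
    refine (hyM i hi).trans ?_
    rw [div_le_one h2]; linarith
  have key : ∑ i ∈ g, w i * (1 + y i + y i ^ 2) ≤ 1 := by
    have s1 : ∑ i ∈ g, w i * (1 + y i + y i ^ 2)
        = ∑ i ∈ g, w i + ∑ i ∈ g, w i * y i + ∑ i ∈ g, w i * y i ^ 2 := by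
      rw [← Finset.sum_add_distrib, ← Finset.sum_add_distrib]
      refine Finset.sum_congr rfl fun i _ => by ring
    have s2 := H.abs_sum_sub_sum_good_le hyM (by positivity)
    have s3 : ∑ i ∈ g, w i * y i ^ 2 ≤ 1728 * (M * lamt P R) / (D - 2) ^ 2 := by
      calc ∑ i ∈ g, w i * y i ^ 2 ≤ ∑ i ∈ s, w i * y i ^ 2 :=
            Finset.sum_le_sum_of_subset_of_nonneg H.sub fun i hi _ =>
              mul_nonneg (H.w_nonneg i hi) (sq_nonneg _)
        _ ≤ ∑ i ∈ s, 144 / (D - 2) ^ 2 * (w i * xi α σ π P R i ^ 2) := by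
            refine Finset.sum_le_sum fun i hi => ?_
            have := hyx i hi
            have a : y i ^ 2 ≤ (12 * xi α σ π P R i / (D - 2)) ^ 2 := by
              rw [← sq_abs]; gcongr
            calc w i * y i ^ 2 ≤ w i * (12 * xi α σ π P R i / (D - 2)) ^ 2 :=
                  mul_le_mul_of_nonneg_left a (H.w_nonneg i hi)
              _ = _ := by generalize D - 2 = h; ring
        _ = 144 / (D - 2) ^ 2 * ∑ i ∈ s, w i * xi α σ π P R i ^ 2 := by rw [Finset.mul_sum]
        _ ≤ 144 / (D - 2) ^ 2 * (12 * (M * lamt P R)) := by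
            gcongr; exact H.sum_xi_sq_le
        _ = _ := by ring
    have s4 : ∑ i ∈ s, w i * y i = -∑ i ∈ s, w i * dlam α σ π D P R i
        + ∑ i ∈ s, w i * dq α σ π D P R κ i := by
      rw [← Finset.sum_neg_distrib, ← Finset.sum_add_distrib]
      refine Finset.sum_congr rfl fun i _ => by rw [hy]; ring
    have s5 := H.sum_dq_le hκ
    have s6 := (abs_le.1 H.abs_sum_dlam_add_le).1
    have s7 := (abs_le.1 s2).1
    rw [s1, H.sum_good]
    have e : 2 * lamt P R / (D - 2) * (24 * M / (D - 2))
        = 48 * (M * lamt P R) / (D - 2) ^ 2 := by generalize D - 2 = h; ring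
    rw [e] at s7
    have s8 : 14 * κ * (M * lamt P R) / (D - 2) ^ 2 ≤ 14 * 1 * (M * lamt P R) / (D - 2) ^ 2 := by
      gcongr
    have s9 : 1800 * (M * lamt P R) / (D - 2) ^ 2 ≤ (0.1 * κ * lamt P R) / (D - 2) := by
      rw [div_le_div_iff₀ (by positivity) h2]
      have := mul_le_mul_of_nonneg_right hMκ h4
      nlinarith [mul_nonneg h4 h2.le]
    have e3 : 8 * (M * lamt P R) / (D - 2) ^ 2 + 14 * 1 * (M * lamt P R) / (D - 2) ^ 2
      + 48 * (M * lamt P R) / (D - 2) ^ 2 + 1728 * (M * lamt P R) / (D - 2) ^ 2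
       ≤ 1800 * (M * lamt P R) / (D - 2) ^ 2 := by
      rw [← add_div, ← add_div, ← add_div]
      apply div_le_div_of_nonneg_right _ (by positivity)
      have : 0 ≤ M * lamt P R := by positivity
      linarith
    rw [neg_div] at s5
    linarith
  calc ∑ i ∈ g, w i * Real.exp (-(lam P R + dlam α σ π D P R i)
        + κ' * (lamt P R + dlamt α σ π D P R i))
      ≤ ∑ i ∈ g, Real.exp (-lam P R + κ * lamt P R) * (w i * (1 + y i + y i ^ 2)) := by
        refine Finset.sum_le_sum fun i hi => ?_
        have his := H.sub hi
        have a1 := error_next_le hκ' (hn i hi)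
        have a2 : Real.exp (y i) ≤ 1 + y i + y i ^ 2 := by
          have := (abs_le.1 (Real.abs_exp_sub_one_sub_id_le (hy1 i his))).2
          linarith
        have a3 : Real.exp (-(lam P R + dlam α σ π D P R i)
            + κ' * (lamt P R + dlamt α σ π D P R i))
            ≤ Real.exp (-lam P R + κ * lamt P R) * Real.exp (y i) := by
          rw [← Real.exp_add]
          apply Real.exp_le_exp.2
          simp only [hy]; linarith
        calc _ ≤ w i * (Real.exp (-lam P R + κ * lamt P R) * Real.exp (y i)) :=
              mul_le_mul_of_nonneg_left a3 (H.w_nonneg i his)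
          _ ≤ w i * (Real.exp (-lam P R + κ * lamt P R) * (1 + y i + y i ^ 2)) :=
              mul_le_mul_of_nonneg_left (mul_le_mul_of_nonneg_left a2 (Real.exp_pos _).le)
                (H.w_nonneg i his)
          _ = _ := by ring
    _ = Real.exp (-lam P R + κ * lamt P R) * ∑ i ∈ g, w i * (1 + y i + y i ^ 2) := by
        rw [Finset.mul_sum]
    _ ≤ Real.exp (-lam P R + κ * lamt P R) * 1 :=
        mul_le_mul_of_nonneg_left key (Real.exp_pos _).le
    _ = _ := mul_one _

/-- One step of the lower bound. -/
lemma lower (H : OneStep s g w α σ π D P R r M) (hκ : 0 ≤ κ) (hq1 : κ * lamt P R ≤ 1)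
    (hκ' : κ' ≤ κ * (1 + 1.9 / (D - 2))) (hMκ : 1000000 * (1 + κ) * M ≤ κ * (D - 2))
    (hκM : κ * M ≤ 20 * (D - 2))
    (hn : ∀ i ∈ g, 0 ≤ lamt P R + dlamt α σ π D P R i) :
    Real.exp (-lam P R) * (1 - κ * lamt P R) ≤
    ∑ i ∈ g, w i * (Real.exp (-(lam P R + dlam α σ π D P R i))
        * (1 - κ' * (lamt P R + dlamt α σ π D P R i))) := by
  classical
  have hD := H.D_large
  have hM := H.one_le
  have hMle := H.M_le
  have h2 : (0:ℝ) < D - 2 := by linarith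
  have h4 := H.lamt_nonneg
  set q := κ * lamt P R with hq
  have hq0 : 0 ≤ q := by positivity
  set x : ι → ℝ := fun i => dlam α σ π D P R i with hx
  set z : ι → ℝ := fun i => dq α σ π D P R κ i with hz
  have hxx : ∀ i ∈ s, |x i| ≤ 5 * xi α σ π P R i / (D - 2) := fun i hi => H.abs_dlam_le hi
  have hzx : ∀ i ∈ s, |z i| ≤ 7 * κ * xi α σ π P R i / (D - 2) := fun i hi => H.abs_dq_le hκ hi
  have hxM : ∀ i ∈ s, |x i| ≤ 10 * M / (D - 2) := by
    intro i hi
    refine (hxx i hi).trans ?_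
    apply div_le_div_of_nonneg_right _ h2.le
    linarith [H.xi_le hi]
  have hzM : ∀ i ∈ s, |z i| ≤ 14 * κ * M / (D - 2) := by
    intro i hi
    refine (hzx i hi).trans ?_
    apply div_le_div_of_nonneg_right _ h2.le
    have := mul_le_mul_of_nonneg_left (H.xi_le hi) hκ
    linarith
  have hx1 : ∀ i ∈ s, |x i| ≤ 1 := by
    intro i hi
    refine (hxM i hi).trans ?_
    rw [div_le_one h2]; linarith
  have hz1 : ∀ i ∈ s, |z i| ≤ 280 := by
    intro i hi
    refine (hzM i hi).trans ?_
    rw [div_le_iff₀ h2]; linarith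
  have point : ∀ i ∈ g, Real.exp (-lam P R) *
      (w i * ((1 - q) * (1 - x i) - z i) - (7025 + 35 * κ) / (D - 2) ^ 2 * (w i * xi α σ π P R i ^ 2))
      ≤ w i * (Real.exp (-(lam P R + dlam α σ π D P R i))
        * (1 - κ' * (lamt P R + dlamt α σ π D P R i))) := by
    intro i hi
    have his := H.sub hi
    have hw := H.w_nonneg i his
    have a1 := error_next_le hκ' (hn i hi)
    have a0 := H.xi_nonneg his
    have a2 := Real.abs_exp_sub_one_sub_id_le (x := -x i) (by rw [abs_neg]; exact hx1 i his)
    have b1 := hxx i his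
    have b2 := hzx i his
    have b3 := hz1 i his
    have hE : Real.exp (-(lam P R + dlam α σ π D P R i))
        = Real.exp (-lam P R) * Real.exp (-x i) := by
      rw [← Real.exp_add]; congr 1; simp only [hx]; ring
    rw [hE]
    have c1 : x i ^ 2 ≤ 25 * xi α σ π P R i ^ 2 / (D - 2) ^ 2 := by
      rw [← sq_abs]
      calc |x i| ^ 2 ≤ (5 * xi α σ π P R i / (D - 2)) ^ 2 := by gcongr
        _ = _ := by generalize D - 2 = h; ring
    have c2 : |x i * z i| ≤ 35 * κ * xi α σ π P R i ^ 2 / (D - 2) ^ 2 := by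
      rw [abs_mul]
      calc |x i| * |z i| ≤ (5 * xi α σ π P R i / (D - 2)) * (7 * κ * xi α σ π P R i / (D - 2)) := by
            gcongr
        _ = _ := by generalize D - 2 = h; ring
    have c3 : |1 - q - z i| ≤ 281 := by
      rw [abs_le] at b3 ⊢; constructor <;> linarith
    have c4 : |(Real.exp (-x i) - 1 - -x i) * (1 - q - z i)| ≤ x i ^ 2 * 281 := by
      rw [abs_mul]
      rw [neg_sq] at a2
      gcongr
    have c5 : (1 - q) * (1 - x i) - z i
        - (7025 + 35 * κ) / (D - 2) ^ 2 * xi α σ π P R i ^ 2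
        ≤ Real.exp (-x i) * (1 - q - z i) := by
      have d1 := (abs_le.1 c4).1
      have d2 := (abs_le.1 c2).1
      have d3 : (7025 + 35 * κ) / (D - 2) ^ 2 * xi α σ π P R i ^ 2
        = 281 * (25 * xi α σ π P R i ^ 2 / (D - 2) ^ 2)
          + 35 * κ * xi α σ π P R i ^ 2 / (D - 2) ^ 2 := by ring
      rw [d3]
      linear_combination d1 + d2 + 281 * c1
    have c6 : 1 - q - z i ≤ 1 - κ' * (lamt P R + dlamt α σ π D P R i) := by
      simp only [hz]; linarith
    calc _ = Real.exp (-lam P R) * (w i * ((1 - q) * (1 - x i) - z i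
        - (7025 + 35 * κ) / (D - 2) ^ 2 * xi α σ π P R i ^ 2)) := by ring
      _ ≤ Real.exp (-lam P R) * (w i * (Real.exp (-x i) * (1 - q - z i))) := by gcongr
      _ ≤ Real.exp (-lam P R) * (w i * (Real.exp (-x i) *
            (1 - κ' * (lamt P R + dlamt α σ π D P R i)))) := by gcongr
      _ = _ := by ring
  refine le_trans ?_ (Finset.sum_le_sum point)
  rw [← Finset.mul_sum]
  refine mul_le_mul_of_nonneg_left ?_ (Real.exp_pos _).le
  rw [Finset.sum_sub_distrib, ← Finset.mul_sum]
  have t1 : ∑ i ∈ g, w i * xi α σ π P R i ^ 2 ≤ 12 * (M * lamt P R) := by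
    refine le_trans ?_ H.sum_xi_sq_le
    exact Finset.sum_le_sum_of_subset_of_nonneg H.sub fun i hi _ =>
              mul_nonneg (H.w_nonneg i hi) (sq_nonneg _)
  have t2 := mul_le_mul_of_nonneg_left t1
    (show 0 ≤ (7025 + 35 * κ) / (D - 2) ^ 2 by positivity)
  have t3 : ∑ i ∈ g, w i * ((1 - q) * (1 - x i) - z i)
      = (1 - q) * (∑ i ∈ g, w i - ∑ i ∈ g, w i * x i) - ∑ i ∈ g, w i * z i := by
    rw [← Finset.sum_sub_distrib, Finset.mul_sum, ← Finset.sum_sub_distrib]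
    exact Finset.sum_congr rfl fun i _ => by ring
  have s1 := abs_le.1 (H.abs_sum_sub_sum_good_le hxM (by positivity))
  have s2 := abs_le.1 (H.abs_sum_sub_sum_good_le hzM (by positivity))
  have s3 := H.sum_dq_le hκ
  have s4 := abs_le.1 H.abs_sum_dlam_add_le
  have t4 : 1 - 28 * (M * lamt P R) / (D - 2) ^ 2 ≤ ∑ i ∈ g, w i - ∑ i ∈ g, w i * x i := by
    rw [H.sum_good]
    have e : 2 * lamt P R / (D - 2) * (10 * M / (D - 2))
        = 20 * (M * lamt P R) / (D - 2) ^ 2 := by generalize D - 2 = h; ring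
    have e2 : 28 * (M * lamt P R) / (D - 2) ^ 2 = 8 * (M * lamt P R) / (D - 2) ^ 2
      + 20 * (M * lamt P R) / (D - 2) ^ 2 := by ring
    have a1 := s1.1
    have a2 := s4.2
    rw [e] at a1
    rw [e2]
    linarith
  have t5 : ∑ i ∈ g, w i * z i ≤ -(0.1 * κ * lamt P R) / (D - 2)
      + 42 * κ * (M * lamt P R) / (D - 2) ^ 2 := by
    have e : 2 * lamt P R / (D - 2) * (14 * κ * M / (D - 2))
        = 28 * κ * (M * lamt P R) / (D - 2) ^ 2 := by generalize D - 2 = h; ring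
    have e2 : 42 * κ * (M * lamt P R) / (D - 2) ^ 2 = 14 * κ * (M * lamt P R) / (D - 2) ^ 2
      + 28 * κ * (M * lamt P R) / (D - 2) ^ 2 := by ring
    have a1 := s2.1
    rw [e] at a1
    rw [e2]
    linarith
  have t6 := mul_le_mul_of_nonneg_left t4 (show 0 ≤ 1 - q by linarith)
  have t7 : (1 - q) * (1 - 28 * (M * lamt P R) / (D - 2) ^ 2)
      ≥ 1 - q - 28 * (M * lamt P R) / (D - 2) ^ 2 := by
    have : 0 ≤ 28 * (M * lamt P R) / (D - 2) ^ 2 := by positivity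
    nlinarith
  rw [t3]
  have t8 : (84328 + 462 * κ) * (M * lamt P R) / (D - 2) ^ 2 ≤ (0.1 * κ * lamt P R) / (D - 2) := by
    rw [div_le_div_iff₀ (by positivity) h2]
    have u1 : (84328 + 462 * κ) * M ≤ 0.1 * (κ * (D - 2)) := by
      have : 0 ≤ κ * M := by positivity
      nlinarith
    have := mul_le_mul_of_nonneg_right u1 (mul_nonneg h4 h2.le)
    nlinarith
  have t9 : (84328 + 462 * κ) * (M * lamt P R) / (D - 2) ^ 2
      = 28 * (M * lamt P R) / (D - 2) ^ 2 + 42 * κ * (M * lamt P R) / (D - 2) ^ 2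
       + (7025 + 35 * κ) / (D - 2) ^ 2 * (12 * (M * lamt P R)) := by ring
  rw [neg_div] at t5
  linarith

end OneStep

section Enumeration

set_option linter.unusedSectionVars false

variable {V : Type*} [Fintype V] [DecidableEq V]

open scoped Classical in
/-- The degree of a vertex, as the cardinality of a finset. -/
noncomputable def dg (G : SimpleGraph V) (v : V) : ℕ := (Finset.univ.filter (G.Adj v)).card

/-- The number of endpoints of the pair `u, v` equal to `x`. -/
def inc (u v x : V) : ℕ := (if x = u then 1 else 0) + (if x = v then 1 else 0)

/-- The residual degrees after exposing an edge `u v`. -/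
def nxt (δ : V → ℕ) (u v : V) : V → ℕ := fun x => δ x - inc u v x

open scoped Classical in
/-- The graphs with degree sequence `δ` which are edge-disjoint from `F`. -/
noncomputable def gset (δ : V → ℕ) (F : SimpleGraph V) : Finset (SimpleGraph V) :=
  Finset.univ.filter fun G => (∀ v, dg G v = δ v) ∧ ∀ u v, G.Adj u v → ¬ F.Adj u v

lemma mem_gset {δ : V → ℕ} {F G : SimpleGraph V} :
    G ∈ gset δ F ↔ (∀ v, dg G v = δ v) ∧ ∀ u v, G.Adj u v → ¬ F.Adj u v := by
  simp [gset]

open scoped Classical in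
lemma sum_adj_sup_edge {β : Type*} [AddCommMonoid β] {G H : SimpleGraph V} {u v : V} (huv : u ≠ v)
    (h : ¬ G.Adj u v) (hH : H = G ⊔ SimpleGraph.edge u v) (f : V → β) (x : V) :
    (∑ y, if H.Adj x y then f y else 0)
      = (∑ y, if G.Adj x y then f y else 0) + (if x = u then f v else 0)
        + (if x = v then f u else 0) := by
  have e : ∀ y, (if H.Adj x y then f y else 0)
      = (if G.Adj x y then f y else 0) + (if y = v then (if x = u then f v else 0) else 0)
        + (if y = u then (if x = v then f u else 0) else 0) := by
    intro y
    subst hH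
    have h' : ¬ G.Adj v u := fun h2 => h h2.symm
    by_cases h1 : G.Adj x y
    · have h3 : ¬ (x = u ∧ y = v) := by rintro ⟨rfl, rfl⟩; exact h h1
      have h4 : ¬ (x = v ∧ y = u) := by rintro ⟨rfl, rfl⟩; exact h' h1
      have : (G ⊔ SimpleGraph.edge u v).Adj x y := Or.inl h1
      rw [if_pos this, if_pos h1, ← ite_and, ← ite_and, if_neg (by tauto), if_neg (by tauto)]
      simp
    · by_cases h3 : x = u ∧ y = v
      · obtain ⟨rfl, rfl⟩ := h3
        simp [h1, huv, huv.symm, SimpleGraph.edge_adj]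
      · by_cases h4 : x = v ∧ y = u
        · obtain ⟨rfl, rfl⟩ := h4
          simp [h1, huv, huv.symm, SimpleGraph.edge_adj]
        · have : ¬ (G ⊔ SimpleGraph.edge u v).Adj x y := by
            rw [SimpleGraph.sup_adj, SimpleGraph.edge_adj]; tauto
          rw [if_neg this, if_neg h1, ← ite_and, ← ite_and, if_neg (by tauto), if_neg (by tauto)]
          simp
  rw [Finset.sum_congr rfl fun y _ => e y, Finset.sum_add_distrib, Finset.sum_add_distrib]
  simp

open scoped Classical in
lemma dg_eq_sum (G : SimpleGraph V) (x : V) : dg G x = ∑ y, if G.Adj x y then 1 else 0 := by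
  simp [dg]

lemma dg_sup_edge (G : SimpleGraph V) {u v : V} (huv : u ≠ v) (h : ¬ G.Adj u v) (x : V) :
    dg (G ⊔ SimpleGraph.edge u v) x = dg G x + inc u v x := by
  classical
  rw [dg_eq_sum, dg_eq_sum, sum_adj_sup_edge huv h rfl, inc, add_assoc]

lemma dg_pos {G : SimpleGraph V} {u v : V} (h : G.Adj u v) : 1 ≤ dg G u := by
  classical
  exact Finset.card_pos.2 ⟨v, by simpa using h⟩

lemma sdiff_edge_sup {G : SimpleGraph V} {u v : V} (h : G.Adj u v) :
    (G \ SimpleGraph.edge u v) ⊔ SimpleGraph.edge u v = G := by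
  rw [sdiff_sup_self]; exact G.sup_edge_of_adj h

lemma edge_adj_self {u v : V} (huv : u ≠ v) : (SimpleGraph.edge u v).Adj u v := by
  rw [SimpleGraph.edge_adj]; tauto

lemma sup_edge_sdiff {G : SimpleGraph V} {u v : V} (h : ¬ G.Adj u v) :
    (G ⊔ SimpleGraph.edge u v) \ SimpleGraph.edge u v = G := by
  ext x y
  simp only [SimpleGraph.sdiff_adj, SimpleGraph.sup_adj, SimpleGraph.edge_adj]
  constructor
  · tauto
  · intro hxy
    refine ⟨Or.inl hxy, ?_⟩
    rintro ⟨⟨rfl, rfl⟩ | ⟨rfl, rfl⟩, -⟩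
    exacts [h hxy, h hxy.symm]

open scoped Classical in
lemma card_gset_filter_adj {δ : V → ℕ} {F : SimpleGraph V} {u v : V} (huv : u ≠ v)
    (hF : ¬ F.Adj u v) (hu : 1 ≤ δ u) (hv : 1 ≤ δ v) :
    ((gset δ F).filter fun G => G.Adj u v).card
      = (gset (nxt δ u v) (F ⊔ SimpleGraph.edge u v)).card := by
  have hinc : ∀ x, inc u v x ≤ δ x := by
    intro x
    unfold inc
    by_cases h1 : x = u
    · subst h1; simp [huv]; exact hu
    · by_cases h2 : x = v
      · subst h2; simp [h1]; exact hv
      · simp [h1, h2]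
  refine Finset.card_nbij' (fun G => G \ SimpleGraph.edge u v) (fun G => G ⊔ SimpleGraph.edge u v)
    ?_ ?_ ?_ ?_
  · intro G hG
    simp only [Finset.coe_filter, Set.mem_ofPred_eq] at hG
    obtain ⟨hG, hadj⟩ := hG
    rw [mem_gset] at hG
    simp only [Finset.mem_coe, mem_gset]
    have hnot : ¬ (G \ SimpleGraph.edge u v).Adj u v := fun h => h.2 (edge_adj_self huv)
    constructor
    · intro x
      have := dg_sup_edge _ huv hnot x
      rw [sdiff_edge_sup hadj, hG.1] at this
      unfold nxt; omega
    · intro x y hxy hF'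
      rcases hF' with h | h
      · exact hG.2 x y hxy.1 h
      · exact hxy.2 h
  · intro G hG
    simp only [Finset.mem_coe, mem_gset] at hG
    have hnot : ¬ G.Adj u v := fun h => hG.2 u v h (Or.inr (edge_adj_self huv))
    simp only [Finset.coe_filter, Set.mem_ofPred_eq, mem_gset]
    refine ⟨⟨?_, ?_⟩, Or.inr (edge_adj_self huv)⟩
    · intro x
      rw [dg_sup_edge _ huv hnot, hG.1]
      have := hinc x
      unfold nxt; omega
    · rintro x y (h | h) hxy
      · exact hG.2 x y h (Or.inl hxy)
      · rw [SimpleGraph.edge_adj] at h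
        rcases h.1 with ⟨rfl, rfl⟩ | ⟨rfl, rfl⟩
        exacts [hF hxy, hF hxy.symm]
  · intro G hG
    simp only [Finset.coe_filter, Set.mem_ofPred_eq] at hG
    exact sdiff_edge_sup hG.2
  · intro G hG
    simp only [Finset.mem_coe, mem_gset] at hG
    exact sup_edge_sdiff fun h => hG.2 u v h (Or.inr (edge_adj_self huv))

open scoped Classical in
/-- The admissible ordered pairs. -/
noncomputable def goodPairs (δ : V → ℕ) (F : SimpleGraph V) : Finset (V × V) :=
  Finset.univ.filter fun i => (1 ≤ δ i.1 ∧ 1 ≤ δ i.2) ∧ i.1 ≠ i.2 ∧ ¬ F.Adj i.1 i.2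

open scoped Classical in
lemma card_gset_mul (δ : V → ℕ) (F : SimpleGraph V) :
    (gset δ F).card * ∑ v, δ v
      = ∑ i ∈ goodPairs δ F, (gset (nxt δ i.1 i.2) (F ⊔ SimpleGraph.edge i.1 i.2)).card := by
  have h1 : (gset δ F).card * ∑ v, δ v
      = ∑ G ∈ gset δ F, ∑ i : V × V, if G.Adj i.1 i.2 then 1 else 0 := by
    rw [← smul_eq_mul, ← Finset.sum_const]
    refine Finset.sum_congr rfl fun G hG => ?_
    rw [Fintype.sum_prod_type]
    refine Finset.sum_congr rfl fun x _ => ?_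
    rw [← (mem_gset.1 hG).1 x, dg_eq_sum]
  rw [h1, Finset.sum_comm, goodPairs, Finset.sum_filter]
  refine Finset.sum_congr rfl fun i _ => ?_
  split_ifs with h
  · rw [← card_gset_filter_adj h.2.1 h.2.2 h.1.1 h.1.2, Finset.card_filter]
  · refine Finset.sum_eq_zero fun G hG => ?_
    rw [if_neg]
    intro hadj
    rw [mem_gset] at hG
    refine h ⟨⟨?_, ?_⟩, hadj.ne, hG.2 _ _ hadj⟩
    · rw [← hG.1]; exact dg_pos hadj
    · rw [← hG.1]; exact dg_pos hadj.symm

lemma card_gset_zero {δ : V → ℕ} (h : ∀ v, δ v = 0) (F : SimpleGraph V) :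
    (gset δ F).card = 1 := by
  rw [Finset.card_eq_one]
  refine ⟨⊥, ?_⟩
  ext G
  rw [mem_gset, Finset.mem_singleton]
  constructor
  · rintro ⟨h1, -⟩
    rw [eq_bot_iff]
    intro u v huv
    have := dg_pos huv
    rw [h1, h] at this
    omega
  · rintro rfl
    refine ⟨fun v => ?_, fun u v huv => by simp at huv⟩
    rw [h]; simp [dg]

end Enumeration

section EnumerationStats

set_option linter.unusedSectionVars false

variable {V : Type*} [Fintype V] [DecidableEq V]

/-- The sum of the residual degrees. -/
noncomputable def degSum (δ : V → ℕ) : ℝ := ∑ v, (δ v : ℝ)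

/-- The second factorial moment of the residual degrees. -/
noncomputable def degSq (δ : V → ℕ) : ℝ := ∑ v, (δ v : ℝ) * ((δ v : ℝ) - 1)

open scoped Classical in
/-- The sum of the residual degrees over the neighbours of `x` in `F`. -/
noncomputable def nbSum (δ : V → ℕ) (F : SimpleGraph V) (x : V) : ℝ :=
  ∑ y, if F.Adj x y then (δ y : ℝ) else 0

/-- The sum over the edges of `F` of the product of the residual degrees. -/
noncomputable def edgeSum (δ : V → ℕ) (F : SimpleGraph V) : ℝ :=
  (∑ x, (δ x : ℝ) * nbSum δ F x) / 2

/-- The configuration model count. -/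
noncomputable def conf (δ : V → ℕ) : ℝ :=
  (Nat.doubleFactorial (∑ v, δ v - 1) : ℝ) / ∏ v, (Nat.factorial (δ v) : ℝ)

/-- The weight of the ordered pair `u, v` (unnormalised). -/
def pw (δ : V → ℕ) (u v : V) : ℝ := (δ u : ℝ) * ((δ v : ℝ) - if u = v then 1 else 0)

/-- Degree statistic of a step. -/
def stA (δ : V → ℕ) (i : V × V) : ℝ := ((δ i.1 : ℝ) - 1) + ((δ i.2 : ℝ) - 1)

/-- Neighbourhood statistic of a step. -/
noncomputable def stS (δ : V → ℕ) (F : SimpleGraph V) (i : V × V) : ℝ :=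
  nbSum δ F i.1 + nbSum δ F i.2

/-- Product statistic of a step. -/
def stP (δ : V → ℕ) (i : V × V) : ℝ := ((δ i.1 : ℝ) - 1) * ((δ i.2 : ℝ) - 1)

lemma sum_pw_left (δ : V → ℕ) (f : V → ℝ) :
    ∑ i : V × V, pw δ i.1 i.2 * f i.1 = (∑ u, (δ u : ℝ) * f u) * (degSum δ - 1) := by
  rw [Fintype.sum_prod_type, Finset.sum_mul]
  refine Finset.sum_congr rfl fun u _ => ?_
  have : ∑ v, pw δ u v * f u = (δ u : ℝ) * f u * ∑ v, ((δ v : ℝ) - if u = v then 1 else 0) := by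
    rw [Finset.mul_sum]
    exact Finset.sum_congr rfl fun v _ => by unfold pw; ring
  rw [this, Finset.sum_sub_distrib]
  simp [degSum]

lemma pw_comm (δ : V → ℕ) (u v : V) : pw δ u v = pw δ v u := by
  unfold pw
  by_cases h : u = v
  · subst h; rfl
  · rw [if_neg h, if_neg (Ne.symm h)]; ring

lemma sum_pw_right (δ : V → ℕ) (f : V → ℝ) :
    ∑ i : V × V, pw δ i.1 i.2 * f i.2 = (∑ u, (δ u : ℝ) * f u) * (degSum δ - 1) := by
  rw [← sum_pw_left, ← (Equiv.prodComm V V).sum_comp]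
  exact Finset.sum_congr rfl fun i _ => by simp [pw_comm]

lemma sum_pw (δ : V → ℕ) : ∑ i : V × V, pw δ i.1 i.2 = degSum δ * (degSum δ - 1) := by
  have := sum_pw_left δ (fun _ => 1)
  simpa [degSum] using this

lemma sum_pw_stA (δ : V → ℕ) :
    ∑ i : V × V, pw δ i.1 i.2 * stA δ i = 2 * degSq δ * (degSum δ - 1) := by
  have h1 := sum_pw_left δ (fun v => (δ v : ℝ) - 1)
  have h2 := sum_pw_right δ (fun v => (δ v : ℝ) - 1)
  unfold stA
  simp only [mul_add, Finset.sum_add_distrib]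
  rw [h1, h2]; unfold degSq; ring

lemma sum_pw_stS (δ : V → ℕ) (F : SimpleGraph V) :
    ∑ i : V × V, pw δ i.1 i.2 * stS δ F i = 4 * edgeSum δ F * (degSum δ - 1) := by
  have h1 := sum_pw_left δ (nbSum δ F)
  have h2 := sum_pw_right δ (nbSum δ F)
  unfold stS
  simp only [mul_add, Finset.sum_add_distrib]
  rw [h1, h2]; unfold edgeSum; ring

/-- The correction term coming from repeated vertices. -/
noncomputable def degCu (δ : V → ℕ) : ℝ := ∑ v, (δ v : ℝ) * ((δ v : ℝ) - 1) ^ 2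

lemma sum_pw_stP (δ : V → ℕ) :
    ∑ i : V × V, pw δ i.1 i.2 * stP δ i = degSq δ ^ 2 - degCu δ := by
  rw [Fintype.sum_prod_type, sq, degSq, degCu, Finset.sum_mul, ← Finset.sum_sub_distrib]
  refine Finset.sum_congr rfl fun u _ => ?_
  have : ∀ v, pw δ u v * stP δ (u, v) = (δ u : ℝ) * ((δ u : ℝ) - 1) * ((δ v : ℝ) * ((δ v : ℝ) - 1))
      - if u = v then (δ u : ℝ) * ((δ v : ℝ) - 1) ^ 2 else 0 := by
    intro v
    unfold pw stP
    split_ifs with h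
    · subst h; ring
    · simp; ring
  rw [Finset.sum_congr rfl fun v _ => this v, Finset.sum_sub_distrib, ← Finset.mul_sum]
  simp

lemma pw_eq_zero {δ : V → ℕ} {u v : V} (h : ¬ (1 ≤ δ u ∧ 1 ≤ δ v)) : pw δ u v = 0 := by
  unfold pw
  by_cases hu : δ u = 0
  · simp [hu]
  · have hv : δ v = 0 := by omega
    have : u ≠ v := by rintro rfl; exact hu hv
    simp [hv, this]

lemma pw_nonneg (δ : V → ℕ) (u v : V) : 0 ≤ pw δ u v := by
  by_cases h : 1 ≤ δ u ∧ 1 ≤ δ v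
  · unfold pw
    have : (1:ℝ) ≤ δ v := by exact_mod_cast h.2
    apply mul_nonneg (by positivity)
    split_ifs <;> linarith
  · rw [pw_eq_zero h]

open scoped Classical in
/-- The ordered pairs of unsaturated vertices. -/
noncomputable def openPairs (δ : V → ℕ) : Finset (V × V) :=
  Finset.univ.filter fun i => 1 ≤ δ i.1 ∧ 1 ≤ δ i.2

lemma sum_openPairs (δ : V → ℕ) (f : V × V → ℝ) :
    ∑ i ∈ openPairs δ, pw δ i.1 i.2 * f i = ∑ i : V × V, pw δ i.1 i.2 * f i := by
  classical
  unfold openPairs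
  rw [Finset.sum_filter]
  refine Finset.sum_congr rfl fun i _ => ?_
  split_ifs with h
  · rfl
  · rw [pw_eq_zero h, zero_mul]

lemma sum_goodPairs (δ : V → ℕ) (F : SimpleGraph V) :
    ∑ i ∈ goodPairs δ F, pw δ i.1 i.2
      = degSum δ * (degSum δ - 1) - degSq δ - 2 * edgeSum δ F := by
  classical
  have h1 : ∑ i ∈ goodPairs δ F, pw δ i.1 i.2 = ∑ i : V × V, (pw δ i.1 i.2
      - (if i.1 = i.2 then (δ i.1 : ℝ) * ((δ i.2 : ℝ) - 1) else 0)
      - (δ i.1 : ℝ) * (if F.Adj i.1 i.2 then (δ i.2 : ℝ) else 0)) := by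
    unfold goodPairs
    rw [Finset.sum_filter]
    refine Finset.sum_congr rfl fun i _ => ?_
    by_cases h : 1 ≤ δ i.1 ∧ 1 ≤ δ i.2
    · by_cases h2 : i.1 = i.2
      · have h3 : ¬ F.Adj i.1 i.2 := by rw [h2]; exact F.irrefl
        rw [if_neg (by tauto), if_pos h2, if_neg h3]
        simp [pw, h2]
      · by_cases h3 : F.Adj i.1 i.2
        · rw [if_neg (by tauto), if_neg h2, if_pos h3]
          simp [pw, h2]
        · rw [if_pos (by tauto), if_neg h2, if_neg h3]; simp
    · rw [if_neg (by tauto), pw_eq_zero h]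
      have e : (δ i.1 : ℝ) = 0 ∨ (δ i.2 : ℝ) = 0 := by
        rcases Nat.eq_zero_or_pos (δ i.1) with h0 | h0
        · left; exact_mod_cast h0
        · right; have : δ i.2 = 0 := by omega
          exact_mod_cast this
      rcases e with e | e
      · simp [e]
      · by_cases h2 : i.1 = i.2
        · rw [h2, e]; simp
        · simp [e, h2]
  rw [h1, Finset.sum_sub_distrib, Finset.sum_sub_distrib, sum_pw, Fintype.sum_prod_type,
    Fintype.sum_prod_type]
  have h2 : ∑ x, ∑ y, (if x = y then (δ x : ℝ) * ((δ y : ℝ) - 1) else 0) = degSq δ := by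
    unfold degSq
    exact Finset.sum_congr rfl fun x _ => by simp
  have h3 : ∑ x, ∑ y, (δ x : ℝ) * (if F.Adj x y then (δ y : ℝ) else 0) = 2 * edgeSum δ F := by
    unfold edgeSum nbSum
    rw [mul_div_cancel₀ _ two_ne_zero]
    exact Finset.sum_congr rfl fun x _ => by rw [Finset.mul_sum]
  simp only at h2 h3 ⊢
  rw [h2, h3]

lemma goodPairs_subset (δ : V → ℕ) (F : SimpleGraph V) : goodPairs δ F ⊆ openPairs δ := by
  classical
  intro i hi
  simp only [goodPairs, openPairs, Finset.mem_filter] at hi ⊢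
  tauto

lemma nbSum_nonneg (δ : V → ℕ) (F : SimpleGraph V) (x : V) : 0 ≤ nbSum δ F x :=
  Finset.sum_nonneg fun y _ => by split_ifs <;> positivity

lemma edgeSum_nonneg (δ : V → ℕ) (F : SimpleGraph V) : 0 ≤ edgeSum δ F :=
  div_nonneg (Finset.sum_nonneg fun x _ => mul_nonneg (by positivity) (nbSum_nonneg δ F x)) (by simp)

lemma degSq_term_nonneg (δ : V → ℕ) (v : V) : 0 ≤ (δ v : ℝ) * ((δ v : ℝ) - 1) := by
  rcases Nat.eq_zero_or_pos (δ v) with h | h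
  · simp [h]
  · have : (1:ℝ) ≤ δ v := by exact_mod_cast h
    exact mul_nonneg (by positivity) (by linarith)

lemma degSq_nonneg (δ : V → ℕ) : 0 ≤ degSq δ :=
  Finset.sum_nonneg fun v _ => degSq_term_nonneg δ v

lemma degSum_nonneg (δ : V → ℕ) : 0 ≤ degSum δ :=
  Finset.sum_nonneg fun v _ => by positivity

lemma degCu_nonneg (δ : V → ℕ) : 0 ≤ degCu δ :=
  Finset.sum_nonneg fun v _ => mul_nonneg (by positivity) (sq_nonneg _)

lemma oneStep (δ : V → ℕ) (F : SimpleGraph V) {M : ℝ} (hD : 100 ≤ degSum δ)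
    (hb : ∀ i ∈ openPairs δ,
      stA δ i * (1 + degSq δ / degSum δ) + stS δ F i + stP δ i ≤ M)
    (hr : degCu δ ≤ M * degSq δ)
    (hl : lamt (degSq δ / degSum δ) (edgeSum δ F / degSum δ) ≤ M)
    (h1 : 1 ≤ M) (hMD : 30000 * M ≤ degSum δ - 2) :
    OneStep (openPairs δ) (goodPairs δ F)
      (fun i => pw δ i.1 i.2 / (degSum δ * (degSum δ - 1))) (stA δ) (stS δ F) (stP δ)
      (degSum δ) (degSq δ / degSum δ) (edgeSum δ F / degSum δ) (degCu δ) M := by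
  have hD0 : 0 < degSum δ := by linarith
  have hD1 : 0 < degSum δ - 1 := by linarith
  have hopen : ∀ i ∈ openPairs δ, (1:ℝ) ≤ δ i.1 ∧ (1:ℝ) ≤ δ i.2 := by
    intro i hi
    simp only [openPairs, Finset.mem_filter, Finset.mem_univ, true_and] at hi
    exact ⟨by exact_mod_cast hi.1, by exact_mod_cast hi.2⟩
  have hs : ∀ f : V × V → ℝ,
      ∑ i ∈ openPairs δ, pw δ i.1 i.2 / (degSum δ * (degSum δ - 1)) * f i
        = (∑ i : V × V, pw δ i.1 i.2 * f i) / (degSum δ * (degSum δ - 1)) := by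
    intro f
    rw [← sum_openPairs, Finset.sum_div]
    exact Finset.sum_congr rfl fun i _ => by ring
  refine
  { sub := goodPairs_subset δ F
    w_nonneg := fun i _ => div_nonneg (pw_nonneg _ _ _) (by positivity)
    sum_w := ?_
    α_nonneg := fun i hi => by have := hopen i hi; unfold stA; linarith
    σ_nonneg := fun i _ => add_nonneg (nbSum_nonneg _ _ _) (nbSum_nonneg _ _ _)
    π_nonneg := fun i hi => by
      have := hopen i hi; unfold stP; exact mul_nonneg (by linarith) (by linarith)
    sum_α := ?_
    sum_σ := ?_
    sum_π := ?_
    sum_good := ?_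
    bound := hb
    r_nonneg := degCu_nonneg δ
    r_le := by rwa [div_mul_cancel₀ _ hD0.ne']
    P_nonneg := div_nonneg (degSq_nonneg δ) hD0.le
    R_nonneg := div_nonneg (edgeSum_nonneg δ F) hD0.le
    lamt_le := hl
    one_le := h1
    D_large := hD
    M_le := hMD }
  · have := hs (fun _ => 1)
    simp only [mul_one] at this
    rw [this, sum_pw, div_self (by positivity)]
  · rw [hs, sum_pw_stA]; field_simp
  · rw [hs, sum_pw_stS]; field_simp
  · rw [hs, sum_pw_stP]; field_simp; ring
  · rw [← Finset.sum_div, sum_goodPairs]; field_simp; ring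

end EnumerationStats

section EnumerationNext

set_option linter.unusedSectionVars false

variable {V : Type*} [Fintype V] [DecidableEq V]

lemma inc_le {δ : V → ℕ} {u v : V} (huv : u ≠ v) (hu : 1 ≤ δ u) (hv : 1 ≤ δ v) (x : V) :
    inc u v x ≤ δ x := by
  unfold inc
  by_cases h1 : x = u
  · subst h1; simp [huv]; exact hu
  · by_cases h2 : x = v
    · subst h2; simp [h1]; exact hv
    · simp [h1, h2]

lemma mem_goodPairs {δ : V → ℕ} {F : SimpleGraph V} {i : V × V} :
    i ∈ goodPairs δ F ↔ (1 ≤ δ i.1 ∧ 1 ≤ δ i.2) ∧ i.1 ≠ i.2 ∧ ¬ F.Adj i.1 i.2 := by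
  classical
  simp [goodPairs]

lemma nxt_add_inc {δ : V → ℕ} {F : SimpleGraph V} {i : V × V} (hi : i ∈ goodPairs δ F) (x : V) :
    nxt δ i.1 i.2 x + inc i.1 i.2 x = δ x := by
  rw [mem_goodPairs] at hi
  exact Nat.sub_add_cancel (inc_le hi.2.1 hi.1.1 hi.1.2 x)

lemma nxt_cast {δ : V → ℕ} {F : SimpleGraph V} {i : V × V} (hi : i ∈ goodPairs δ F) (x : V) :
    (nxt δ i.1 i.2 x : ℝ) = δ x - (if x = i.1 then 1 else 0) - (if x = i.2 then 1 else 0) := by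
  have := nxt_add_inc hi x
  have h2 : (nxt δ i.1 i.2 x : ℝ) + inc i.1 i.2 x = δ x := by exact_mod_cast this
  rw [← h2]; unfold inc; push_cast; ring

lemma degSum_eq_cast (δ : V → ℕ) : degSum δ = ((∑ v, δ v : ℕ) : ℝ) := by
  unfold degSum; push_cast; rfl

lemma sum_inc (u v : V) : ∑ x, inc u v x = 2 := by
  unfold inc; simp [Finset.sum_add_distrib]

lemma sum_nxt {δ : V → ℕ} {F : SimpleGraph V} {i : V × V} (hi : i ∈ goodPairs δ F) :
    ∑ x, nxt δ i.1 i.2 x + 2 = ∑ x, δ x := by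
  rw [← sum_inc i.1 i.2, ← Finset.sum_add_distrib]
  exact Finset.sum_congr rfl fun x _ => nxt_add_inc hi x

lemma degSum_nxt {δ : V → ℕ} {F : SimpleGraph V} {i : V × V} (hi : i ∈ goodPairs δ F) :
    degSum (nxt δ i.1 i.2) = degSum δ - 2 := by
  rw [degSum_eq_cast, degSum_eq_cast, ← sum_nxt hi]; push_cast; ring

lemma degSq_nxt {δ : V → ℕ} {F : SimpleGraph V} {i : V × V} (hi : i ∈ goodPairs δ F) :
    degSq (nxt δ i.1 i.2) = degSq δ - 2 * stA δ i := by
  have hne := (mem_goodPairs.1 hi).2.1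
  have e : ∀ x, (nxt δ i.1 i.2 x : ℝ) * ((nxt δ i.1 i.2 x : ℝ) - 1)
      = (δ x : ℝ) * ((δ x : ℝ) - 1) - (if x = i.1 then 2 * ((δ i.1 : ℝ) - 1) else 0)
        - (if x = i.2 then 2 * ((δ i.2 : ℝ) - 1) else 0) := by
    intro x
    rw [nxt_cast hi]
    by_cases h1 : x = i.1
    · subst h1; simp [hne]; ring
    · by_cases h2 : x = i.2
      · subst h2; simp [h1]; ring
      · simp [h1, h2]
  unfold degSq
  rw [Finset.sum_congr rfl fun x _ => e x, Finset.sum_sub_distrib, Finset.sum_sub_distrib]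
  simp [stA]; ring

lemma edgeSum_nxt {δ : V → ℕ} {F : SimpleGraph V} {i : V × V} (hi : i ∈ goodPairs δ F) :
    edgeSum (nxt δ i.1 i.2) (F ⊔ SimpleGraph.edge i.1 i.2)
      = edgeSum δ F - stS δ F i + stP δ i := by
  classical
  obtain ⟨-, hne, hF⟩ := mem_goodPairs.1 hi
  have hF' : ¬ F.Adj i.2 i.1 := fun h => hF h.symm
  set δ' := nxt δ i.1 i.2 with hδ'
  have a1 : ∀ x, nbSum δ' (F ⊔ SimpleGraph.edge i.1 i.2) x = nbSum δ' F x
      + (if x = i.1 then (δ' i.2 : ℝ) else 0) + (if x = i.2 then (δ' i.1 : ℝ) else 0) := by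
    intro x
    exact sum_adj_sup_edge hne hF rfl (fun y => (δ' y : ℝ)) x
  have a2 : ∀ x, nbSum δ' F x = nbSum δ F x - (if F.Adj x i.1 then 1 else 0)
      - (if F.Adj x i.2 then 1 else 0) := by
    intro x
    have : ∀ y, (if F.Adj x y then (δ' y : ℝ) else 0) = (if F.Adj x y then (δ y : ℝ) else 0)
        - (if y = i.1 then (if F.Adj x i.1 then 1 else 0) else 0)
        - (if y = i.2 then (if F.Adj x i.2 then 1 else 0) else 0) := by
      intro y
      rw [hδ', nxt_cast hi]
      by_cases h1 : y = i.1
      · subst h1; by_cases h3 : F.Adj x i.1 <;> simp [hne, h3]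
      · by_cases h2 : y = i.2
        · subst h2; by_cases h3 : F.Adj x i.2 <;> simp [h1, h3]
        · simp [h1, h2]
    unfold nbSum
    rw [Finset.sum_congr rfl fun y _ => this y, Finset.sum_sub_distrib, Finset.sum_sub_distrib]
    simp
  have a3 : ∀ z, ∑ x, (δ' x : ℝ) * (if F.Adj x z then 1 else 0) = nbSum δ' F z := by
    intro z
    unfold nbSum
    refine Finset.sum_congr rfl fun x _ => ?_
    simp [F.adj_comm x z]
  have a4 : ∑ x, (δ' x : ℝ) * nbSum δ F x
      = ∑ x, (δ x : ℝ) * nbSum δ F x - nbSum δ F i.1 - nbSum δ F i.2 := by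
    have : ∀ x, (δ' x : ℝ) * nbSum δ F x = (δ x : ℝ) * nbSum δ F x
        - (if x = i.1 then nbSum δ F i.1 else 0) - (if x = i.2 then nbSum δ F i.2 else 0) := by
      intro x
      rw [hδ', nxt_cast hi]
      by_cases h1 : x = i.1
      · subst h1; simp [hne]; ring
      · by_cases h2 : x = i.2
        · subst h2; simp [h1]; ring
        · simp [h1, h2]
    rw [Finset.sum_congr rfl fun y _ => this y, Finset.sum_sub_distrib, Finset.sum_sub_distrib]
    simp
  have a5 : ∑ x, (δ' x : ℝ) * nbSum δ' F x
      = ∑ x, (δ x : ℝ) * nbSum δ F x - 2 * nbSum δ F i.1 - 2 * nbSum δ F i.2 := by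
    rw [Finset.sum_congr rfl fun x _ => by rw [a2 x]]
    simp only [mul_sub, Finset.sum_sub_distrib]
    rw [a3, a3, a2 i.1, a2 i.2, a4]
    simp only [F.irrefl, hF, hF', if_false]
    ring
  have a6 : ∑ x, (δ' x : ℝ) * nbSum δ' (F ⊔ SimpleGraph.edge i.1 i.2) x
      = ∑ x, (δ' x : ℝ) * nbSum δ' F x + 2 * ((δ' i.1 : ℝ) * δ' i.2) := by
    rw [Finset.sum_congr rfl fun x _ => by rw [a1 x]]
    simp only [mul_add, Finset.sum_add_distrib]
    simp
    ring
  unfold edgeSum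
  rw [a6, a5, hδ', nxt_cast hi, nxt_cast hi]
  simp [hne, hne.symm, stS, stP]
  ring

lemma conf_nxt {δ : V → ℕ} {F : SimpleGraph V} {i : V × V} (hi : i ∈ goodPairs δ F) :
    conf (nxt δ i.1 i.2) * (degSum δ - 1) = conf δ * pw δ i.1 i.2 := by
  classical
  obtain ⟨⟨hu, hv⟩, hne, hF⟩ := mem_goodPairs.1 hi
  have hp : pw δ i.1 i.2 = (δ i.1 : ℝ) * δ i.2 := by simp [pw, hne]
  have hprod : ∏ x, ((δ x).factorial : ℝ)
      = (∏ x, ((nxt δ i.1 i.2 x).factorial : ℝ)) * ((δ i.1 : ℝ) * δ i.2) := by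
    have : ∀ x, ((δ x).factorial : ℝ) = ((nxt δ i.1 i.2 x).factorial : ℝ)
        * ((if x = i.1 then (δ i.1 : ℝ) else 1) * (if x = i.2 then (δ i.2 : ℝ) else 1)) := by
      intro x
      by_cases h1 : x = i.1
      · subst h1
        have : nxt δ i.1 i.2 i.1 + 1 = δ i.1 := by
          have := nxt_add_inc hi i.1; simpa [inc, hne] using this
        rw [← this, Nat.factorial_succ]; simp [hne]; ring
      · by_cases h2 : x = i.2
        · subst h2
          have : nxt δ i.1 i.2 i.2 + 1 = δ i.2 := by
            have := nxt_add_inc hi i.2; simpa [inc, hne.symm] using this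
          rw [← this, Nat.factorial_succ]; simp [h1]; ring
        · simp [h1, h2, nxt, inc]
    rw [Finset.prod_congr rfl fun x _ => this x, Finset.prod_mul_distrib, Finset.prod_mul_distrib]
    simp
  have hdf : ((∑ x, δ x - 1).doubleFactorial : ℝ)
      = ((∑ x, nxt δ i.1 i.2 x - 1).doubleFactorial : ℝ) * (degSum δ - 1) := by
    rw [degSum_eq_cast, ← sum_nxt hi]
    rcases Nat.eq_zero_or_pos (∑ x, nxt δ i.1 i.2 x) with h | h
    · rw [h]; norm_num
    · obtain ⟨k, hk⟩ := Nat.exists_eq_add_of_lt h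
      rw [hk]
      have e1 : 0 + k + 1 + 2 - 1 = k + 2 := by omega
      have e2 : 0 + k + 1 - 1 = k := by omega
      rw [e1, e2, Nat.doubleFactorial_add_two]
      push_cast; ring
  unfold conf
  rw [hp, hprod, hdf]
  have h1 : (δ i.1 : ℝ) ≠ 0 := by positivity
  have h2 : (δ i.2 : ℝ) ≠ 0 := by positivity
  have h3 : (∏ x, ((nxt δ i.1 i.2 x).factorial : ℝ)) ≠ 0 :=
    Finset.prod_ne_zero_iff.2 fun x _ => by positivity
  field_simp

lemma conf_pos (δ : V → ℕ) : 0 < conf δ :=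
  div_pos (by exact_mod_cast Nat.doubleFactorial_pos _) (Finset.prod_pos fun x _ => by positivity)

lemma gset_rec (δ : V → ℕ) (F : SimpleGraph V) :
    ((gset δ F).card : ℝ) * degSum δ = ∑ i ∈ goodPairs δ F,
      ((gset (nxt δ i.1 i.2) (F ⊔ SimpleGraph.edge i.1 i.2)).card : ℝ) := by
  rw [degSum_eq_cast]
  exact_mod_cast card_gset_mul δ F

lemma dg_add_nxt {δ : V → ℕ} {F : SimpleGraph V} {i : V × V} (hi : i ∈ goodPairs δ F) (x : V) :
    nxt δ i.1 i.2 x + dg (F ⊔ SimpleGraph.edge i.1 i.2) x = δ x + dg F x := by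
  obtain ⟨-, hne, hF⟩ := mem_goodPairs.1 hi
  rw [dg_sup_edge F hne hF, ← nxt_add_inc hi x]; ring

lemma conf_of_zero {δ : V → ℕ} (h : ∀ v, δ v = 0) : conf δ = 1 := by
  simp [conf, h]

lemma sum_good_pw_le (δ : V → ℕ) (F : SimpleGraph V) :
    ∑ i ∈ goodPairs δ F, pw δ i.1 i.2 ≤ degSum δ * (degSum δ - 1) := by
  rw [← sum_pw]
  exact Finset.sum_le_sum_of_subset_of_nonneg (Finset.subset_univ _)
    fun i _ _ => pw_nonneg _ _ _

/-- The configuration model bound. -/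
lemma card_gset_le_conf (k : ℕ) : ∀ (δ : V → ℕ) (F : SimpleGraph V), ∑ v, δ v = 2 * k →
    ((gset δ F).card : ℝ) ≤ conf δ := by
  induction k with
  | zero =>
    intro δ F h
    have h0 : ∀ v, δ v = 0 := by simpa using h
    rw [card_gset_zero h0, conf_of_zero h0]; simp
  | succ k ih =>
    intro δ F h
    have hD : degSum δ = 2 * (k + 1) := by rw [degSum_eq_cast, h]; push_cast; ring
    have hD0 : 0 < degSum δ := by rw [hD]; positivity
    have hD1 : 0 < degSum δ - 1 := by rw [hD]; have : (0:ℝ) ≤ k := by positivity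
                                      linarith
    have h2 : ((gset δ F).card : ℝ) * degSum δ ≤ conf δ * degSum δ := by
      rw [gset_rec]
      calc _ ≤ ∑ i ∈ goodPairs δ F, conf (nxt δ i.1 i.2) := by
            refine Finset.sum_le_sum fun i hi => ih _ _ ?_
            have := sum_nxt hi
            omega
        _ = ∑ i ∈ goodPairs δ F, conf δ / (degSum δ - 1) * pw δ i.1 i.2 := by
            refine Finset.sum_congr rfl fun i hi => ?_
            have := conf_nxt hi
            field_simp
            linarith
        _ = conf δ / (degSum δ - 1) * ∑ i ∈ goodPairs δ F, pw δ i.1 i.2 := by rw [Finset.mul_sum]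
        _ ≤ conf δ / (degSum δ - 1) * (degSum δ * (degSum δ - 1)) := by
            have := (conf_pos δ).le
            gcongr
            exact sum_good_pw_le δ F
        _ = _ := by field_simp
    exact le_of_mul_le_mul_right h2 hD0

end EnumerationNext

section EnumerationMain

set_option linter.unusedSectionVars false

variable {V : Type*} [Fintype V] [DecidableEq V]

/-- The main exponent of a state. -/
noncomputable def gL (δ : V → ℕ) (F : SimpleGraph V) : ℝ :=
  lam (degSq δ / degSum δ) (edgeSum δ F / degSum δ)

/-- The error exponent of a state. -/
noncomputable def gT (δ : V → ℕ) (F : SimpleGraph V) : ℝ :=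
  lamt (degSq δ / degSum δ) (edgeSum δ F / degSum δ)

/-- The error rate when the residual degree sum is `D`. -/
noncomputable def kap (d D : ℝ) : ℝ := 10 ^ 15 * d ^ 2 * D ^ (-(10 / 11) : ℝ)

lemma kap_nonneg (d : ℝ) {D : ℝ} (hD : 0 ≤ D) : 0 ≤ kap d D := by unfold kap; positivity

lemma kap_mul (d : ℝ) {D : ℝ} (hD : 0 < D) :
    kap d D * D ^ (10 / 11 : ℝ) = 10 ^ 15 * d ^ 2 := by
  unfold kap
  rw [mul_assoc, ← Real.rpow_add hD]; norm_num

lemma rpow_le_self_of_one_le {D : ℝ} (hD : 1 ≤ D) : D ^ (10 / 11 : ℝ) ≤ D := by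
  calc D ^ (10 / 11 : ℝ) ≤ D ^ (1 : ℝ) := Real.rpow_le_rpow_of_exponent_le hD (by norm_num)
    _ = D := Real.rpow_one D

lemma le_kap_mul (d : ℝ) {D : ℝ} (hD : 1 ≤ D) : 10 ^ 15 * d ^ 2 ≤ kap d D * D := by
  rw [← kap_mul d (by linarith : 0 < D)]
  exact mul_le_mul_of_nonneg_left (rpow_le_self_of_one_le hD) (kap_nonneg d (by linarith))

lemma kap_next {d D : ℝ} (hD : 100 ≤ D) : kap d (D - 2) ≤ kap d D * (1 + 1.9 / (D - 2)) := by
  have h2 : 0 < D - 2 := by linarith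
  have h0 : 0 < D := by linarith
  have h1 := rpow_one_add_le_one_add_mul_self (s := 2 / (D - 2))
    (by have : 0 < 2 / (D - 2) := by positivity
        linarith) (p := 10 / 11) (by norm_num) (by norm_num)
  have e : 1 + 2 / (D - 2) = D / (D - 2) := by field_simp; ring
  rw [e, Real.div_rpow h0.le h2.le] at h1
  have h3 : (10 / 11 : ℝ) * (2 / (D - 2)) ≤ 1.9 / (D - 2) := by
    rw [← mul_div_assoc]
    apply div_le_div_of_nonneg_right _ h2.le; norm_num
  have h4 : kap d (D - 2) = kap d D * (D ^ (10 / 11 : ℝ) / (D - 2) ^ (10 / 11 : ℝ)) := by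
    rw [← mul_div_assoc, kap_mul d h0, ← kap_mul d h2, mul_div_assoc, div_self (by positivity),
      mul_one]
  rw [h4]
  exact mul_le_mul_of_nonneg_left (by linarith) (kap_nonneg d h0.le)

lemma gT_nonneg (δ : V → ℕ) (F : SimpleGraph V) : 0 ≤ gT δ F := by
  have := degSq_nonneg δ
  have := degSum_nonneg δ
  have := edgeSum_nonneg δ F
  unfold gT lamt; positivity

lemma gL_le_gT (δ : V → ℕ) (F : SimpleGraph V) : gL δ F ≤ gT δ F := by
  have h1 : 0 ≤ degSq δ / degSum δ := div_nonneg (degSq_nonneg δ) (degSum_nonneg δ)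
  unfold gL gT lam lamt
  nlinarith [sq_nonneg (degSq δ / degSum δ)]

lemma gL_nonneg (δ : V → ℕ) (F : SimpleGraph V) : 0 ≤ gL δ F := by
  have h1 : 0 ≤ degSq δ / degSum δ := div_nonneg (degSq_nonneg δ) (degSum_nonneg δ)
  have h2 : 0 ≤ edgeSum δ F / degSum δ := div_nonneg (edgeSum_nonneg δ F) (degSum_nonneg δ)
  unfold gL lam
  positivity

lemma gL_nxt {δ : V → ℕ} {F : SimpleGraph V} {i : V × V} (hi : i ∈ goodPairs δ F)
    (hD : 2 < degSum δ) :
    gL (nxt δ i.1 i.2) (F ⊔ SimpleGraph.edge i.1 i.2) = gL δ F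
      + OneStep.dlam (stA δ) (stS δ F) (stP δ) (degSum δ) (degSq δ / degSum δ)
        (edgeSum δ F / degSum δ) i := by
  unfold gL
  rw [← OneStep.lam_next i (by linarith : degSum δ - 2 ≠ 0), degSq_nxt hi, degSum_nxt hi,
    edgeSum_nxt hi, div_mul_cancel₀ _ (by linarith : degSum δ ≠ 0),
    div_mul_cancel₀ _ (by linarith : degSum δ ≠ 0)]

lemma gT_nxt {δ : V → ℕ} {F : SimpleGraph V} {i : V × V} (hi : i ∈ goodPairs δ F)
    (hD : 2 < degSum δ) :
    gT (nxt δ i.1 i.2) (F ⊔ SimpleGraph.edge i.1 i.2) = gT δ F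
      + OneStep.dlamt (stA δ) (stS δ F) (stP δ) (degSum δ) (degSq δ / degSum δ)
        (edgeSum δ F / degSum δ) i := by
  unfold gT
  rw [← OneStep.lamt_next i (by linarith : degSum δ - 2 ≠ 0), degSq_nxt hi, degSum_nxt hi,
    edgeSum_nxt hi, div_mul_cancel₀ _ (by linarith : degSum δ ≠ 0),
    div_mul_cancel₀ _ (by linarith : degSum δ ≠ 0)]

lemma mem_openPairs {δ : V → ℕ} {i : V × V} : i ∈ openPairs δ ↔ 1 ≤ δ i.1 ∧ 1 ≤ δ i.2 := by
  classical
  simp [openPairs]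

lemma degSq_le {δ : V → ℕ} {d : ℕ} (hd : ∀ v, δ v ≤ d) : degSq δ ≤ d * degSum δ := by
  unfold degSq degSum
  rw [Finset.mul_sum]
  refine Finset.sum_le_sum fun v _ => ?_
  have : (δ v : ℝ) ≤ d := by exact_mod_cast hd v
  have h0 : (0:ℝ) ≤ δ v := by positivity
  nlinarith

lemma nbSum_le {δ : V → ℕ} {F : SimpleGraph V} {d : ℕ} (hd : ∀ v, δ v + dg F v ≤ d) (x : V) :
    nbSum δ F x ≤ (d : ℝ) ^ 2 := by
  classical
  calc nbSum δ F x ≤ ∑ y, if F.Adj x y then (d : ℝ) else 0 := by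
        refine Finset.sum_le_sum fun y _ => ?_
        split_ifs
        · have := hd y
          exact_mod_cast (by omega : δ y ≤ d)
        · rfl
    _ = d * dg F x := by
        rw [dg_eq_sum]; push_cast; rw [Finset.mul_sum]
        exact Finset.sum_congr rfl fun y _ => by simp
    _ ≤ d * d := by
        have := hd x
        have : dg F x ≤ d := by omega
        gcongr
    _ = _ := (sq _).symm

lemma edgeSum_le {δ : V → ℕ} {F : SimpleGraph V} {d : ℕ} (hd : ∀ v, δ v + dg F v ≤ d) :
    edgeSum δ F ≤ (d : ℝ) ^ 2 / 2 * degSum δ := by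
  unfold edgeSum degSum
  rw [div_mul_eq_mul_div, Finset.mul_sum]
  apply div_le_div_of_nonneg_right _ (by norm_num)
  refine Finset.sum_le_sum fun v _ => ?_
  have := nbSum_le hd v
  have h0 : (0:ℝ) ≤ δ v := by positivity
  nlinarith

lemma oneStep_degree {δ : V → ℕ} {F : SimpleGraph V} {d : ℕ} (hd : ∀ v, δ v + dg F v ≤ d)
    (hd1 : 1 ≤ d) (hD : 100 ≤ degSum δ) (hM : 30000 * (10 * (d : ℝ) ^ 2) ≤ degSum δ - 2) :
    OneStep (openPairs δ) (goodPairs δ F)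
      (fun i => pw δ i.1 i.2 / (degSum δ * (degSum δ - 1))) (stA δ) (stS δ F) (stP δ)
      (degSum δ) (degSq δ / degSum δ) (edgeSum δ F / degSum δ) (degCu δ) (10 * (d : ℝ) ^ 2) := by
  have hD0 : 0 < degSum δ := by linarith
  have hd1' : (1:ℝ) ≤ d := by exact_mod_cast hd1
  have hdd : (d:ℝ) ≤ (d:ℝ) ^ 2 := by nlinarith
  have hδ : ∀ v, (δ v : ℝ) ≤ d := fun v => by
    have := hd v
    exact_mod_cast (by omega : δ v ≤ d)
  have hP : degSq δ / degSum δ ≤ d := by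
    rw [div_le_iff₀ hD0]; exact degSq_le fun v => by have := hd v; omega
  have hP0 : 0 ≤ degSq δ / degSum δ := div_nonneg (degSq_nonneg δ) hD0.le
  have hR : edgeSum δ F / degSum δ ≤ (d:ℝ) ^ 2 / 2 := by
    rw [div_le_iff₀ hD0]; exact edgeSum_le hd
  refine oneStep δ F hD ?_ ?_ ?_ (by linarith) hM
  · intro i hi
    rw [mem_openPairs] at hi
    have a1 : (1:ℝ) ≤ δ i.1 := by exact_mod_cast hi.1
    have a2 : (1:ℝ) ≤ δ i.2 := by exact_mod_cast hi.2
    have b1 := hδ i.1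
    have b2 := hδ i.2
    have c1 := nbSum_le hd i.1
    have c2 := nbSum_le hd i.2
    have e1 : stA δ i * (1 + degSq δ / degSum δ) ≤ (2 * d) * (1 + d) := by
      unfold stA
      apply mul_le_mul (by linarith) (by linarith) (by linarith) (by linarith)
    have e2 : stP δ i ≤ (d:ℝ) * d := by
      unfold stP
      apply mul_le_mul (by linarith) (by linarith) (by linarith) (by linarith)
    unfold stS
    nlinarith
  · unfold degCu degSq
    rw [Finset.mul_sum]
    refine Finset.sum_le_sum fun v _ => ?_
    have h1 := degSq_term_nonneg δ v
    have h2 := hδ v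
    calc (δ v : ℝ) * ((δ v : ℝ) - 1) ^ 2 = ((δ v : ℝ) * ((δ v : ℝ) - 1)) * ((δ v : ℝ) - 1) := by ring
      _ ≤ ((δ v : ℝ) * ((δ v : ℝ) - 1)) * (10 * (d : ℝ) ^ 2) := by
          apply mul_le_mul_of_nonneg_left _ h1; linarith
      _ = _ := by ring
  · unfold lamt
    nlinarith

lemma oneStep_self {δ : V → ℕ} {F : SimpleGraph V} (hD : 100 ≤ degSum δ)
    (hT : 1 ≤ 5 * degSum δ * gT δ F)
    (hM : 30000 * (5 * degSum δ * gT δ F) ≤ degSum δ - 2) :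
    OneStep (openPairs δ) (goodPairs δ F)
      (fun i => pw δ i.1 i.2 / (degSum δ * (degSum δ - 1))) (stA δ) (stS δ F) (stP δ)
      (degSum δ) (degSq δ / degSum δ) (edgeSum δ F / degSum δ) (degCu δ)
      (5 * degSum δ * gT δ F) := by
  have hD0 : 0 < degSum δ := by linarith
  have hp0 := degSq_nonneg δ
  have hQ0 := edgeSum_nonneg δ F
  have hP0 : 0 ≤ degSq δ / degSum δ := div_nonneg (degSq_nonneg δ) hD0.le
  have hMe : 5 * degSum δ * gT δ F
      = 5 * (degSq δ + degSq δ * (degSq δ / degSum δ) + edgeSum δ F) := by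
    unfold gT lamt; field_simp
  have hpp : 0 ≤ degSq δ * (degSq δ / degSum δ) := mul_nonneg hp0 hP0
  have hv : ∀ v, 1 ≤ δ v → (δ v : ℝ) - 1 ≤ degSq δ ∧ ((δ v : ℝ) - 1) ^ 2 ≤ degSq δ := by
    intro v hv
    have a1 : (1:ℝ) ≤ δ v := by exact_mod_cast hv
    have h1 : (δ v : ℝ) * ((δ v : ℝ) - 1) ≤ degSq δ :=
      Finset.single_le_sum (f := fun v => (δ v : ℝ) * ((δ v : ℝ) - 1))
        (fun v _ => degSq_term_nonneg δ v) (Finset.mem_univ v)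
    constructor <;> nlinarith
  have hnb : ∀ v, 1 ≤ δ v → nbSum δ F v ≤ 2 * edgeSum δ F := by
    intro v hv
    have a1 : (1:ℝ) ≤ δ v := by exact_mod_cast hv
    have h1 : (δ v : ℝ) * nbSum δ F v ≤ 2 * edgeSum δ F := by
      unfold edgeSum
      rw [mul_div_cancel₀ _ two_ne_zero]
      exact Finset.single_le_sum (f := fun v => (δ v : ℝ) * nbSum δ F v)
        (fun v _ => mul_nonneg (by positivity) (nbSum_nonneg δ F v)) (Finset.mem_univ v)
    nlinarith [nbSum_nonneg δ F v]
  refine oneStep δ F hD ?_ ?_ ?_ hT hM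
  · intro i hi
    rw [mem_openPairs] at hi
    obtain ⟨a1, a2⟩ := hv _ hi.1
    obtain ⟨b1, b2⟩ := hv _ hi.2
    have c1 := hnb _ hi.1
    have c2 := hnb _ hi.2
    have e1 : stA δ i * (1 + degSq δ / degSum δ) ≤ (2 * degSq δ) * (1 + degSq δ / degSum δ) := by
      apply mul_le_mul_of_nonneg_right _ (by linarith)
      unfold stA; linarith
    have e2 : stP δ i ≤ degSq δ := by
      unfold stP
      nlinarith [sq_nonneg ((δ i.1 : ℝ) - 1 - ((δ i.2 : ℝ) - 1))]
    rw [hMe]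
    unfold stS
    linarith
  · have key : ∀ M' : ℝ, degSq δ ≤ M' → degCu δ ≤ M' * degSq δ := by
      intro M' hM'
      unfold degCu
      calc ∑ v, (δ v : ℝ) * ((δ v : ℝ) - 1) ^ 2
          ≤ ∑ v, M' * ((δ v : ℝ) * ((δ v : ℝ) - 1)) := by
            refine Finset.sum_le_sum fun v _ => ?_
            have h1 := degSq_term_nonneg δ v
            rcases Nat.eq_zero_or_pos (δ v) with h | h
            · simp [h]
            · have h2 := (hv v h).1
              nlinarith
        _ = M' * degSq δ := by rw [← Finset.mul_sum]; rfl
    refine key _ ?_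
    rw [hMe]; linarith
  · have := gT_nonneg δ F
    change gT δ F ≤ _
    nlinarith

lemma one_le_degSum_mul_gT {δ : V → ℕ} {F : SimpleGraph V} (hD : 0 < degSum δ)
    (hT : gT δ F ≠ 0) : 1 ≤ 2 * degSum δ * gT δ F := by
  classical
  have hp0 := degSq_nonneg δ
  have hQ0 := edgeSum_nonneg δ F
  have hMe : degSum δ * gT δ F
      = degSq δ + degSq δ * (degSq δ / degSum δ) + edgeSum δ F := by
    unfold gT lamt; field_simp
  have hpp : 0 ≤ degSq δ * (degSq δ / degSum δ) := mul_nonneg hp0 (div_nonneg hp0 hD.le)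
  have h1 : ∃ a : ℕ, degSq δ = a := by
    refine ⟨∑ v, δ v * (δ v - 1), ?_⟩
    unfold degSq
    push_cast
    refine Finset.sum_congr rfl fun v _ => ?_
    rcases Nat.eq_zero_or_pos (δ v) with h | h
    · simp [h]
    · rw [Nat.cast_sub h]; simp
  have h2 : ∃ b : ℕ, 2 * edgeSum δ F = b := by
    refine ⟨∑ x, δ x * ∑ y, if F.Adj x y then δ y else 0, ?_⟩
    unfold edgeSum nbSum
    rw [mul_div_cancel₀ _ two_ne_zero]
    push_cast
    rfl
  obtain ⟨a, ha⟩ := h1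
  obtain ⟨b, hb⟩ := h2
  by_contra hcon
  push Not at hcon
  have ha0 : a = 0 := by
    by_contra h
    have : (1:ℝ) ≤ a := by exact_mod_cast Nat.one_le_iff_ne_zero.2 h
    linarith
  have hb0 : b = 0 := by
    by_contra h
    have : (1:ℝ) ≤ b := by exact_mod_cast Nat.one_le_iff_ne_zero.2 h
    linarith
  apply hT
  have e1 : degSq δ = 0 := by rw [ha, ha0]; simp
  have e2 : edgeSum δ F = 0 := by rw [hb0] at hb; simp at hb; exact hb
  unfold gT lamt
  simp [e1, e2]

end EnumerationMain

section EnumerationTheorem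

set_option linter.unusedSectionVars false

variable {V : Type*} [Fintype V] [DecidableEq V]

lemma conf_nxt_eq {δ : V → ℕ} {F : SimpleGraph V} {i : V × V} (hi : i ∈ goodPairs δ F)
    (hD : 1 < degSum δ) :
    conf (nxt δ i.1 i.2) = conf δ * degSum δ * (pw δ i.1 i.2 / (degSum δ * (degSum δ - 1))) := by
  have h1 : 0 < degSum δ - 1 := by linarith
  have h0 : 0 < degSum δ := by linarith
  have := conf_nxt hi
  field_simp
  linarith

lemma degSq_eq_zero_of_gT {δ : V → ℕ} {F : SimpleGraph V} (hD : 0 < degSum δ)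
    (hT : gT δ F = 0) : degSq δ = 0 ∧ edgeSum δ F = 0 := by
  have h1 : 0 ≤ degSq δ / degSum δ := div_nonneg (degSq_nonneg δ) (degSum_nonneg δ)
  have h2 : 0 ≤ edgeSum δ F / degSum δ := div_nonneg (edgeSum_nonneg δ F) (degSum_nonneg δ)
  unfold gT lamt at hT
  have h3 : degSq δ / degSum δ = 0 := by nlinarith
  have h4 : edgeSum δ F / degSum δ = 0 := by nlinarith
  rw [div_eq_zero_iff] at h3 h4
  exact ⟨h3.resolve_right hD.ne', h4.resolve_right hD.ne'⟩

lemma gT_nxt_of_zero {δ : V → ℕ} {F : SimpleGraph V} {i : V × V} (hi : i ∈ goodPairs δ F)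
    (h1 : degSq δ = 0) (h2 : edgeSum δ F = 0) :
    gT (nxt δ i.1 i.2) (F ⊔ SimpleGraph.edge i.1 i.2) = 0 := by
  have hg := (mem_goodPairs.1 hi).1
  have a1 : (1:ℝ) ≤ δ i.1 := by exact_mod_cast hg.1
  have a2 : (1:ℝ) ≤ δ i.2 := by exact_mod_cast hg.2
  have hz := (Finset.sum_eq_zero_iff_of_nonneg (fun v _ => degSq_term_nonneg δ v)).1 h1
  have b1 := hz i.1 (Finset.mem_univ _)
  have e1 : (δ i.1 : ℝ) - 1 = 0 := by nlinarith
  have b2 := hz i.2 (Finset.mem_univ _)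
  have e2 : (δ i.2 : ℝ) - 1 = 0 := by nlinarith
  have e3 : degSq (nxt δ i.1 i.2) = 0 := by
    rw [degSq_nxt hi, h1, stA, e1, e2]; simp
  have e4 : edgeSum (nxt δ i.1 i.2) (F ⊔ SimpleGraph.edge i.1 i.2) = 0 := by
    have h3 := edgeSum_nxt hi
    have h4 := edgeSum_nonneg (nxt δ i.1 i.2) (F ⊔ SimpleGraph.edge i.1 i.2)
    have h5 := nbSum_nonneg δ F i.1
    have h6 := nbSum_nonneg δ F i.2
    rw [h2, stS, stP, e1, e2] at h3
    linarith
  unfold gT lamt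
  simp [e3, e4]

lemma card_gset_upper_step {δ : V → ℕ} {F : SimpleGraph V} {d : ℕ}
    (hd : ∀ v, δ v + dg F v ≤ d) (hd1 : 1 ≤ d) (hD : 2 ≤ degSum δ)
    (hκ : kap d (degSum δ) < 1)
    (ih : ∀ i ∈ goodPairs δ F,
      ((gset (nxt δ i.1 i.2) (F ⊔ SimpleGraph.edge i.1 i.2)).card : ℝ)
        ≤ conf (nxt δ i.1 i.2) * Real.exp (-gL (nxt δ i.1 i.2) (F ⊔ SimpleGraph.edge i.1 i.2)
          + kap d (degSum δ - 2) * gT (nxt δ i.1 i.2) (F ⊔ SimpleGraph.edge i.1 i.2))) :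
    ((gset δ F).card : ℝ)
      ≤ conf δ * Real.exp (-gL δ F + kap d (degSum δ) * gT δ F) := by
  have hd1' : (1:ℝ) ≤ (d:ℝ) ^ 2 := by
    have : (1:ℝ) ≤ d := by exact_mod_cast hd1
    nlinarith
  have hkD := le_kap_mul (d : ℝ) (D := degSum δ) (by linarith)
  have hκ0 := kap_nonneg (d : ℝ) (D := degSum δ) (by linarith)
  have hDbig : 10 ^ 15 * (d:ℝ) ^ 2 ≤ degSum δ := by nlinarith
  have hD0 : 0 < degSum δ := by linarith
  have hD100 : 100 ≤ degSum δ := by linarith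
  have H := oneStep_degree hd hd1 hD100 (by linarith)
  have key := H.upper hκ0 hκ.le (kap_next hD100) (by linarith) (fun i hi => by
    have := gT_nxt hi (by linarith : 2 < degSum δ)
    unfold gT at this
    rw [← this]; exact gT_nonneg _ _)
  have h2 : ((gset δ F).card : ℝ) * degSum δ
      ≤ conf δ * Real.exp (-gL δ F + kap d (degSum δ) * gT δ F) * degSum δ := by
    rw [gset_rec]
    calc _ ≤ ∑ i ∈ goodPairs δ F, conf δ * degSum δ
          * ((pw δ i.1 i.2 / (degSum δ * (degSum δ - 1)))
            * Real.exp (-gL (nxt δ i.1 i.2) (F ⊔ SimpleGraph.edge i.1 i.2)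
          + kap d (degSum δ - 2) * gT (nxt δ i.1 i.2) (F ⊔ SimpleGraph.edge i.1 i.2))) := by
          refine Finset.sum_le_sum fun i hi => (ih i hi).trans ?_
          rw [conf_nxt_eq hi (by linarith), mul_assoc]
      _ ≤ conf δ * degSum δ * Real.exp (-gL δ F + kap d (degSum δ) * gT δ F) := by
          rw [← Finset.mul_sum]
          refine mul_le_mul_of_nonneg_left ?_ (mul_nonneg (conf_pos δ).le hD0.le)
          refine le_trans (le_of_eq ?_) key
          refine Finset.sum_congr rfl fun i hi => ?_
          rw [gL_nxt hi (by linarith), gT_nxt hi (by linarith)]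
          rfl
      _ = _ := by ring
  exact le_of_mul_le_mul_right h2 hD0

lemma card_gset_lower_step {δ : V → ℕ} {F : SimpleGraph V} {d : ℕ}
    (hd : ∀ v, δ v + dg F v ≤ d) (hd1 : 1 ≤ d) (hD : 2 ≤ degSum δ)
    (hq : kap d (degSum δ) * gT δ F < 1)
    (ih : ∀ i ∈ goodPairs δ F, conf (nxt δ i.1 i.2)
        * (Real.exp (-gL (nxt δ i.1 i.2) (F ⊔ SimpleGraph.edge i.1 i.2))
        * (1 - kap d (degSum δ - 2) * gT (nxt δ i.1 i.2) (F ⊔ SimpleGraph.edge i.1 i.2)))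
        ≤ ((gset (nxt δ i.1 i.2) (F ⊔ SimpleGraph.edge i.1 i.2)).card : ℝ)) :
    conf δ * (Real.exp (-gL δ F) * (1 - kap d (degSum δ) * gT δ F)) ≤ ((gset δ F).card : ℝ) := by
  have hd1' : (1:ℝ) ≤ (d:ℝ) ^ 2 := by
    have : (1:ℝ) ≤ d := by exact_mod_cast hd1
    nlinarith
  have hkD := le_kap_mul (d : ℝ) (D := degSum δ) (by linarith)
  have hκ0 := kap_nonneg (d : ℝ) (D := degSum δ) (by linarith)
  have hD0 : 0 < degSum δ := by linarith
  have hcD := mul_nonneg (conf_pos δ).le hD0.le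
  have h2 : conf δ * degSum δ * (Real.exp (-gL δ F) * (1 - kap d (degSum δ) * gT δ F))
      ≤ ((gset δ F).card : ℝ) * degSum δ := by
    have hsum : conf δ * degSum δ * ∑ i ∈ goodPairs δ F,
        (pw δ i.1 i.2 / (degSum δ * (degSum δ - 1)))
          * (Real.exp (-gL (nxt δ i.1 i.2) (F ⊔ SimpleGraph.edge i.1 i.2))
        * (1 - kap d (degSum δ - 2) * gT (nxt δ i.1 i.2) (F ⊔ SimpleGraph.edge i.1 i.2)))
        ≤ ((gset δ F).card : ℝ) * degSum δ := by
      rw [gset_rec, Finset.mul_sum]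
      refine Finset.sum_le_sum fun i hi => le_trans (le_of_eq ?_) (ih i hi)
      rw [conf_nxt_eq hi (by linarith), mul_assoc (conf δ * degSum δ)]
    refine le_trans (mul_le_mul_of_nonneg_left ?_ hcD) hsum
    by_cases hT : gT δ F = 0
    · obtain ⟨h1, h3⟩ := degSq_eq_zero_of_gT hD0 hT
      have hL : gL δ F = 0 := le_antisymm (hT ▸ gL_le_gT δ F) (gL_nonneg δ F)
      have e1 : ∑ i ∈ goodPairs δ F, pw δ i.1 i.2 / (degSum δ * (degSum δ - 1)) = 1 := by
        rw [← Finset.sum_div, sum_goodPairs, h1, h3]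
        have : 0 < degSum δ - 1 := by linarith
        field_simp
        ring
      rw [hL, hT, neg_zero, Real.exp_zero, mul_zero, sub_zero, one_mul]
      refine e1.symm.le.trans ?_
      refine Finset.sum_le_sum fun i hi => le_of_eq ?_
      have h4 := gT_nxt_of_zero hi h1 h3
      have h5 : gL (nxt δ i.1 i.2) (F ⊔ SimpleGraph.edge i.1 i.2) = 0 :=
        le_antisymm (h4 ▸ gL_le_gT _ _) (gL_nonneg _ _)
      rw [h4, h5]; simp
    · have hDT := one_le_degSum_mul_gT hD0 hT
      have hT0 := gT_nonneg δ F
      have hκD : kap d (degSum δ) ≤ 2 * degSum δ := by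
        have h6 := mul_le_mul_of_nonneg_left hDT hκ0
        nlinarith
      have hD100 : 100 ≤ degSum δ := by nlinarith
      have hnn : ∀ i ∈ goodPairs δ F, 0 ≤ lamt (degSq δ / degSum δ) (edgeSum δ F / degSum δ)
          + OneStep.dlamt (stA δ) (stS δ F) (stP δ) (degSum δ) (degSq δ / degSum δ)
            (edgeSum δ F / degSum δ) i := fun i hi => by
        have := gT_nxt hi (by linarith : 2 < degSum δ)
        unfold gT at this
        rw [← this]; exact gT_nonneg _ _
      have key : ∀ {M : ℝ}, OneStep (openPairs δ) (goodPairs δ F)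
          (fun i => pw δ i.1 i.2 / (degSum δ * (degSum δ - 1))) (stA δ) (stS δ F) (stP δ)
          (degSum δ) (degSq δ / degSum δ) (edgeSum δ F / degSum δ) (degCu δ) M →
          1000000 * (1 + kap d (degSum δ)) * M ≤ kap d (degSum δ) * (degSum δ - 2) →
          kap d (degSum δ) * M ≤ 20 * (degSum δ - 2) →
          Real.exp (-gL δ F) * (1 - kap d (degSum δ) * gT δ F) ≤ ∑ i ∈ goodPairs δ F,
        (pw δ i.1 i.2 / (degSum δ * (degSum δ - 1)))
          * (Real.exp (-gL (nxt δ i.1 i.2) (F ⊔ SimpleGraph.edge i.1 i.2))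
        * (1 - kap d (degSum δ - 2)
          * gT (nxt δ i.1 i.2) (F ⊔ SimpleGraph.edge i.1 i.2))) := by
        intro M H h6 h7
        refine le_trans (H.lower hκ0 hq.le (kap_next hD100) h6 h7 hnn) (le_of_eq ?_)
        refine Finset.sum_congr rfl fun i hi => ?_
        rw [gL_nxt hi (by linarith), gT_nxt hi (by linarith)]
        rfl
      generalize hκe : kap d (degSum δ) = κ at *
      generalize hTe : gT δ F = T at *
      rcases le_or_gt (20000000 : ℝ) κ with hκ | hκ
      · have hTs : 20000000 * T ≤ 1 := by nlinarith
        have hTD : 20000000 * (degSum δ * T) ≤ degSum δ := by nlinarith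
        have hκDT : κ * (degSum δ * T) ≤ degSum δ := by nlinarith
        have H := oneStep_self (δ := δ) (F := F) hD100 (by rw [hTe]; linarith)
          (by rw [hTe]; linarith)
        refine key H ?_ ?_
        · rw [hTe]; nlinarith
        · rw [hTe]; nlinarith
      · have hDd : 50000000 * (d:ℝ) ^ 2 ≤ degSum δ := by nlinarith
        have H := oneStep_degree hd hd1 hD100 (by linarith)
        refine key H ?_ ?_
        · have : κ * (50000000 * (d:ℝ) ^ 2) ≤ κ * degSum δ := by gcongr
          nlinarith
        · nlinarith
  have h3 : conf δ * (Real.exp (-gL δ F) * (1 - kap d (degSum δ) * gT δ F)) * degSum δ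
      ≤ ((gset δ F).card : ℝ) * degSum δ := le_trans (le_of_eq (by ring)) h2
  exact le_of_mul_le_mul_right h3 hD0

theorem card_gset_bounds {d : ℕ} (hd1 : 1 ≤ d) (k : ℕ) : ∀ (δ : V → ℕ) (F : SimpleGraph V),
    ∑ v, δ v = 2 * k → (∀ v, δ v + dg F v ≤ d) →
    conf δ * (Real.exp (-gL δ F) * (1 - kap d (degSum δ) * gT δ F)) ≤ ((gset δ F).card : ℝ) ∧
    ((gset δ F).card : ℝ) ≤ conf δ * Real.exp (-gL δ F + kap d (degSum δ) * gT δ F) := by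
  induction k with
  | zero =>
    intro δ F h hd
    have h0 : ∀ v, δ v = 0 := by simpa using h
    have hD : degSum δ = 0 := by rw [degSum_eq_cast, h]; simp
    rw [card_gset_zero h0, conf_of_zero h0]
    simp [gL, gT, hD, lam, lamt]
  | succ k ih =>
    intro δ F h hd
    have hD : degSum δ = 2 * (k + 1) := by rw [degSum_eq_cast, h]; push_cast; ring
    have hD2 : 2 ≤ degSum δ := by
      have : (0:ℝ) ≤ k := by positivity
      linarith
    have ih' := fun i (hi : i ∈ goodPairs δ F) =>
      ih (nxt δ i.1 i.2) (F ⊔ SimpleGraph.edge i.1 i.2) (by have := sum_nxt hi; omega)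
        (fun v => by rw [dg_add_nxt hi]; exact hd v)
    constructor
    · rcases lt_or_ge (kap d (degSum δ) * gT δ F) 1 with hq | hq
      · refine card_gset_lower_step hd hd1 hD2 hq fun i hi => ?_
        have := (ih' i hi).1
        rwa [degSum_nxt hi] at this
      · refine le_trans ?_ (Nat.cast_nonneg _)
        refine mul_nonpos_of_nonneg_of_nonpos (conf_pos δ).le ?_
        exact mul_nonpos_of_nonneg_of_nonpos (Real.exp_pos _).le (by linarith)
    · rcases lt_or_ge (kap d (degSum δ)) 1 with hκ | hκ
      · refine card_gset_upper_step hd hd1 hD2 hκ fun i hi => ?_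
        have := (ih' i hi).2
        rwa [degSum_nxt hi] at this
      · refine (card_gset_le_conf (k + 1) δ F h).trans ?_
        refine le_mul_of_one_le_right (conf_pos δ).le (Real.one_le_exp ?_)
        have := gL_le_gT δ F
        have := gT_nonneg δ F
        nlinarith

end EnumerationTheorem

section Extensions

set_option linter.unusedSectionVars false

variable {V : Type*} [Fintype V] [DecidableEq V]

lemma dg_mono {G H : SimpleGraph V} (h : H ≤ G) (v : V) : dg H v ≤ dg G v := by
  classical
  refine Finset.card_le_card fun w hw => ?_
  simp only [Finset.mem_filter, Finset.mem_univ, true_and] at hw ⊢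
  exact h hw

lemma dg_bot (v : V) : dg (⊥ : SimpleGraph V) v = 0 := by
  classical
  simp [dg]

lemma dg_sup_of_disjoint {G H : SimpleGraph V} (h : ∀ u v, G.Adj u v → ¬ H.Adj u v) (v : V) :
    dg (G ⊔ H) v = dg G v + dg H v := by
  classical
  unfold dg
  rw [← Finset.card_union_of_disjoint]
  · congr 1
    ext w; simp
  · rw [Finset.disjoint_left]
    intro w hw hx
    simp only [Finset.mem_filter, Finset.mem_univ, true_and] at hw hx
    exact h _ _ hw hx

/-- The `d`-regular graphs. -/
noncomputable def regs (V : Type*) [Fintype V] [DecidableEq V] (d : ℕ) :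
    Finset (SimpleGraph V) := gset (fun _ => d) ⊥

lemma mem_regs {d : ℕ} {G : SimpleGraph V} : G ∈ regs V d ↔ ∀ v, dg G v = d := by
  simp [regs, mem_gset]

open scoped Classical in
/-- The number of `d`-regular graphs containing `H`. -/
noncomputable def extc (d : ℕ) (H : SimpleGraph V) : ℕ := ((regs V d).filter fun G => H ≤ G).card

/-- The residual degrees of `H` inside a `d`-regular graph. -/
noncomputable def resid (d : ℕ) (H : SimpleGraph V) : V → ℕ := fun v => d - dg H v

lemma extc_eq {d : ℕ} {H : SimpleGraph V} (h : ∀ v, dg H v ≤ d) :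
    extc d H = (gset (resid d H) H).card := by
  classical
  unfold extc
  refine Finset.card_bij' (fun G _ => G \ H) (fun G _ => G ⊔ H) ?_ ?_ ?_ ?_
  · intro G hG
    rw [Finset.mem_filter, mem_regs] at hG
    rw [mem_gset]
    have hd : ∀ u v, (G \ H).Adj u v → ¬ H.Adj u v := fun u v huv => by
      rw [SimpleGraph.sdiff_adj] at huv; exact huv.2
    refine ⟨fun v => ?_, hd⟩
    have h1 := dg_sup_of_disjoint hd v
    rw [sdiff_sup_cancel hG.2, hG.1 v] at h1
    unfold resid; omega
  · intro G hG
    rw [mem_gset] at hG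
    rw [Finset.mem_filter, mem_regs]
    refine ⟨fun v => ?_, le_sup_right⟩
    rw [dg_sup_of_disjoint hG.2, hG.1 v]
    exact Nat.sub_add_cancel (h v)
  · intro G hG
    rw [Finset.mem_filter] at hG
    exact sdiff_sup_cancel hG.2
  · intro G hG
    rw [mem_gset] at hG
    ext u v
    simp only [SimpleGraph.sdiff_adj, SimpleGraph.sup_adj]
    have := hG.2 u v
    tauto

lemma extc_eq_zero {d : ℕ} {H : SimpleGraph V} {v : V} (h : d < dg H v) : extc d H = 0 := by
  classical
  unfold extc
  rw [Finset.card_eq_zero, Finset.filter_eq_empty_iff]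
  intro G hG hH
  have := dg_mono hH v
  rw [mem_regs.1 hG v] at this
  omega

/-- The relative error of the enumeration. -/
noncomputable def qe (d : ℕ) : ℝ := 12 * 10 ^ 15 / (d : ℝ) ^ 6

lemma qe_nonneg (d : ℕ) : 0 ≤ qe d := by unfold qe; positivity

lemma qe_small {d : ℕ} (hd : 10000 ≤ d) : qe d ≤ 1 / 1000 := by
  have : (10000:ℝ) ≤ d := by exact_mod_cast hd
  have h2 : (10000:ℝ) ^ 6 ≤ (d:ℝ) ^ 6 := by gcongr
  unfold qe
  rw [div_le_iff₀ (by positivity)]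
  linarith

lemma gT_le {δ : V → ℕ} {F : SimpleGraph V} {d : ℕ} (hd : ∀ v, δ v + dg F v ≤ d)
    (hd1 : 1 ≤ d) (hD : 0 < degSum δ) : gT δ F ≤ 3 * (d:ℝ) ^ 2 := by
  have hd1' : (1:ℝ) ≤ d := by exact_mod_cast hd1
  have hP : degSq δ / degSum δ ≤ d := by
    rw [div_le_iff₀ hD]; exact degSq_le fun v => by have := hd v; omega
  have hP0 : 0 ≤ degSq δ / degSum δ := div_nonneg (degSq_nonneg δ) hD.le
  have hR : edgeSum δ F / degSum δ ≤ (d:ℝ) ^ 2 / 2 := by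
    rw [div_le_iff₀ hD]; exact edgeSum_le hd
  unfold gT lamt
  nlinarith

lemma kap_le {d : ℕ} (hd : 1 ≤ d) {D : ℝ} (hD : (d:ℝ) ^ 11 / 4 ≤ D) :
    kap d D ≤ 4 * 10 ^ 15 / (d:ℝ) ^ 8 := by
  have hd1' : (1:ℝ) ≤ d := by exact_mod_cast hd
  have h0 : 0 < (d:ℝ) ^ 11 / 4 := by positivity
  have h1 : (d:ℝ) ^ 10 / 4 ≤ D ^ (10 / 11 : ℝ) := by
    calc (d:ℝ) ^ 10 / 4 ≤ ((d:ℝ) ^ 11 / 4) ^ (10 / 11 : ℝ) := by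
          rw [Real.div_rpow (by positivity) (by norm_num), ← Real.rpow_natCast, ← Real.rpow_natCast,
            ← Real.rpow_mul (by positivity)]
          have e : ((11:ℕ):ℝ) * (10/11) = ((10:ℕ):ℝ) := by norm_num
          rw [e]
          have : (4:ℝ) ^ (10/11:ℝ) ≤ 4 := by
            have := rpow_le_self_of_one_le (D := 4) (by norm_num)
            linarith
          gcongr
      _ ≤ _ := Real.rpow_le_rpow h0.le hD (by norm_num)
  have h2 := kap_mul (d:ℝ) (lt_of_lt_of_le h0 hD)
  have h3 := kap_nonneg (d:ℝ) (h0.le.trans hD)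
  have h4 := mul_le_mul_of_nonneg_left h1 h3
  rw [h2] at h4
  rw [le_div_iff₀ (by positivity)]
  have h5 : kap d D * (d:ℝ) ^ 8 * (d:ℝ) ^ 2 ≤ 4 * 10 ^ 15 * (d:ℝ) ^ 2 := by nlinarith
  exact le_of_mul_le_mul_right h5 (by positivity)

lemma card_gset_regime {δ : V → ℕ} {F : SimpleGraph V} {d k : ℕ} (hs : ∑ v, δ v = 2 * k)
    (hd : ∀ v, δ v + dg F v ≤ d) (hd1 : 1 ≤ d) (hD : (d:ℝ) ^ 11 / 4 ≤ degSum δ) :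
    conf δ * (Real.exp (-gL δ F) * (1 - qe d)) ≤ ((gset δ F).card : ℝ) ∧
    ((gset δ F).card : ℝ) ≤ conf δ * (Real.exp (-gL δ F) * Real.exp (qe d)) := by
  have hd1' : (1:ℝ) ≤ d := by exact_mod_cast hd1
  have hD0 : 0 < degSum δ := lt_of_lt_of_le (by positivity) hD
  have hq : kap d (degSum δ) * gT δ F ≤ qe d := by
    calc kap d (degSum δ) * gT δ F ≤ 4 * 10 ^ 15 / (d:ℝ) ^ 8 * (3 * (d:ℝ) ^ 2) :=
          mul_le_mul (kap_le hd1 hD) (gT_le hd hd1 hD0) (gT_nonneg δ F) (by positivity)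
      _ = qe d := by unfold qe; field_simp; norm_num
  obtain ⟨h1, h2⟩ := card_gset_bounds hd1 k δ F hs hd
  have hc := (conf_pos δ).le
  constructor
  · refine le_trans ?_ h1
    gcongr
  · refine h2.trans ?_
    rw [← Real.exp_add]
    gcongr

end Extensions

section EdgeRatio

set_option linter.unusedSectionVars false

variable {V : Type*} [Fintype V] [DecidableEq V]

lemma resid_add {d : ℕ} {H : SimpleGraph V} (h : ∀ v, dg H v ≤ d) (v : V) :
    resid d H v + dg H v = d := by
  have := h v
  unfold resid; omega

lemma gL_nxt_sub {δ : V → ℕ} {F : SimpleGraph V} {d : ℕ} {i : V × V} (hi : i ∈ goodPairs δ F)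
    (hd : ∀ v, δ v + dg F v ≤ d) (hd1 : 10000 ≤ d) (hD : (d:ℝ) ^ 11 / 4 ≤ degSum δ) :
    |gL (nxt δ i.1 i.2) (F ⊔ SimpleGraph.edge i.1 i.2) - gL δ F| ≤ qe d := by
  have hd1' : (10000:ℝ) ≤ d := by exact_mod_cast hd1
  have hbig : (d:ℝ) ^ 2 * 10 ^ 30 ≤ (d:ℝ) ^ 11 := by
    calc (d:ℝ) ^ 2 * 10 ^ 30 ≤ (d:ℝ) ^ 2 * (10000:ℝ) ^ 9 := by gcongr; norm_num
      _ ≤ (d:ℝ) ^ 2 * (d:ℝ) ^ 9 := by gcongr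
      _ = _ := by ring
  have hd2 : (10000:ℝ) ≤ (d:ℝ) ^ 2 := by nlinarith
  have hD1 : 300002 * (d:ℝ) ^ 2 ≤ degSum δ := by linarith
  have H := oneStep_degree hd (by omega) (by linarith) (by linarith)
  have hi' : i ∈ openPairs δ := mem_openPairs.2 (mem_goodPairs.1 hi).1
  rw [gL_nxt hi (by linarith), add_sub_cancel_left]
  refine (H.abs_dlam_le hi').trans ?_
  have h1 := H.xi_le hi'
  rw [div_le_iff₀ (by linarith)]
  unfold qe
  rw [div_mul_eq_mul_div, le_div_iff₀ (by positivity)]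
  have h3 : 5 * OneStep.xi (stA δ) (stS δ F) (stP δ) (degSq δ / degSum δ)
      (edgeSum δ F / degSum δ) i * (d:ℝ) ^ 6 ≤ 100 * (d:ℝ) ^ 2 * (d:ℝ) ^ 6 := by
    exact mul_le_mul_of_nonneg_right (by linarith) (by positivity)
  have h4 : (d:ℝ) ^ 8 ≤ (d:ℝ) ^ 11 := by gcongr <;> linarith
  nlinarith

lemma dg_eq_degree (G : SimpleGraph V) (v : V) [Fintype (G.neighborSet v)] :
    dg G v = G.degree v := by
  classical
  rw [← SimpleGraph.card_neighborFinset_eq_degree]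
  unfold dg
  congr 1
  ext w; simp

lemma even_sum_dg (G : SimpleGraph V) : Even (∑ v, dg G v) := by
  classical
  rw [Finset.sum_congr rfl fun v _ => dg_eq_degree G v, G.sum_degrees_eq_twice_card_edges]
  exact even_two_mul _

lemma sum_resid {d : ℕ} {H : SimpleGraph V} (h : ∀ v, dg H v ≤ d) :
    ∑ v, resid d H v + ∑ v, dg H v = Fintype.card V * d := by
  rw [← Finset.sum_add_distrib, Finset.sum_congr rfl fun v _ => resid_add h v]
  simp

lemma sum_resid_even {d : ℕ} {H : SimpleGraph V} (h : ∀ v, dg H v ≤ d)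
    (hV : Even (Fintype.card V)) : ∃ k, ∑ v, resid d H v = 2 * k := by
  have h1 := sum_resid h
  have h2 : Even (∑ v, resid d H v) := by
    have h3 : Even (∑ v, resid d H v + ∑ v, dg H v) := h1 ▸ hV.mul_right d
    exact (Nat.even_add.1 h3).2 (even_sum_dg H)
  obtain ⟨k, hk⟩ := h2
  exact ⟨k, by omega⟩

lemma degSum_resid {d : ℕ} {H : SimpleGraph V} (h : ∀ v, dg H v ≤ d) :
    degSum (resid d H) = Fintype.card V * d - ∑ v, (dg H v : ℝ) := by
  have h1 := sum_resid h
  rw [degSum_eq_cast, eq_sub_iff_add_eq]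
  exact_mod_cast h1

lemma extc_bounds {d : ℕ} {H : SimpleGraph V} (h : ∀ v, dg H v ≤ d) (hd : 10000 ≤ d)
    (hV : Even (Fintype.card V)) (hD : (d:ℝ) ^ 11 / 4 ≤ degSum (resid d H)) :
    conf (resid d H) * (Real.exp (-gL (resid d H) H) * (1 - qe d)) ≤ (extc d H : ℝ) ∧
    (extc d H : ℝ) ≤ conf (resid d H) * (Real.exp (-gL (resid d H) H) * Real.exp (qe d)) := by
  obtain ⟨k, hk⟩ := sum_resid_even h hV
  rw [extc_eq h]
  exact card_gset_regime hk (fun v => (resid_add h v).le) (by omega) hD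

/-- The relative error of the edge ratio. -/
noncomputable def ee (d : ℕ) : ℝ := 10 ^ 17 / (d : ℝ) ^ 6

lemma ee_nonneg (d : ℕ) : 0 ≤ ee d := by unfold ee; positivity

lemma five_qe_le (d : ℕ) : 5 * qe d ≤ ee d := by
  unfold qe ee
  rw [← mul_div_assoc]
  gcongr; norm_num

lemma ee_small {d : ℕ} (hd : 10000 ≤ d) : ee d ≤ 1 / 1000000 := by
  have : (10000:ℝ) ≤ d := by exact_mod_cast hd
  have h2 : (10000:ℝ) ^ 6 ≤ (d:ℝ) ^ 6 := by gcongr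
  unfold ee
  rw [div_le_iff₀ (by positivity)]
  linarith

lemma exp_le_aux {q : ℝ} (h0 : 0 ≤ q) (h1 : q ≤ 1 / 1000) :
    Real.exp (2 * q) ≤ (1 + 5 * q) * (1 - q) := by
  have h := Real.abs_exp_sub_one_sub_id_le (x := 2 * q) (by rw [abs_of_nonneg] <;> linarith)
  have := (abs_le.1 h).2
  nlinarith

lemma exp_ge_aux {q : ℝ} (h0 : 0 ≤ q) (h1 : q ≤ 1 / 1000) :
    (1 - 5 * q) * Real.exp q ≤ Real.exp (-q) * (1 - q) := by
  have h := Real.add_one_le_exp (-q)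
  have h2 := Real.abs_exp_sub_one_sub_id_le (x := q) (by rw [abs_of_nonneg] <;> linarith)
  have := (abs_le.1 h2).2
  nlinarith

lemma resid_sup_edge {d : ℕ} {H : SimpleGraph V} {u v : V} (huv : u ≠ v) (h : ¬ H.Adj u v) :
    resid d (H ⊔ SimpleGraph.edge u v) = nxt (resid d H) u v := by
  funext x
  change d - dg (H ⊔ SimpleGraph.edge u v) x = d - dg H x - inc u v x
  rw [dg_sup_edge H huv h]
  omega

lemma edge_ratio_aux {p L L' c c' D1 q e N N' : ℝ} (hp0 : 0 ≤ p) (hcp : 0 < c) (hD1 : 0 ≤ D1)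
    (hN : 0 ≤ N) (q0 : 0 ≤ q) (q1 : q ≤ 1 / 1000) (q5 : 5 * q ≤ e)
    (b1 : c * (Real.exp (-L) * (1 - q)) ≤ N) (b2 : N ≤ c * (Real.exp (-L) * Real.exp q))
    (c1 : c' * (Real.exp (-L') * (1 - q)) ≤ N') (c2 : N' ≤ c' * (Real.exp (-L') * Real.exp q))
    (hc : c' * D1 = c * p) (hlam : |L' - L| ≤ q) :
    (1 - e) * (p * N) ≤ N' * D1 ∧ N' * D1 ≤ (1 + e) * (p * N) := by
  have hL1 : Real.exp (-L') ≤ Real.exp (-L) * Real.exp q := by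
    rw [← Real.exp_add]
    apply Real.exp_le_exp.2
    linarith [(abs_le.1 hlam).1]
  have hL2 : Real.exp (-L) * Real.exp (-q) ≤ Real.exp (-L') := by
    rw [← Real.exp_add]
    apply Real.exp_le_exp.2
    linarith [(abs_le.1 hlam).2]
  have e2 : Real.exp (2 * q) = Real.exp q * Real.exp q := by rw [← Real.exp_add]; ring_nf
  have x0 := (Real.exp_pos (-L)).le
  have x1 := (Real.exp_pos q).le
  have x2 := (Real.exp_pos (-q)).le
  have hcp0 : 0 ≤ c * p := mul_nonneg hcp.le hp0
  have hA0 : 0 ≤ p * N := by positivity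
  constructor
  · calc (1 - e) * (p * N) ≤ (1 - 5 * q) * (p * N) := by gcongr
      _ ≤ (1 - 5 * q) * (p * (c * (Real.exp (-L) * Real.exp q))) := by
          have : 0 ≤ 1 - 5 * q := by linarith
          gcongr
      _ = (c * p) * Real.exp (-L) * ((1 - 5 * q) * Real.exp q) := by ring
      _ ≤ (c * p) * Real.exp (-L) * (Real.exp (-q) * (1 - q)) := by
          gcongr ?_ * ?_
          exact exp_ge_aux q0 q1
      _ = (c * p) * (Real.exp (-L) * Real.exp (-q)) * (1 - q) := by ring
      _ ≤ (c * p) * Real.exp (-L') * (1 - q) := by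
          have : 0 ≤ 1 - q := by linarith
          gcongr
      _ = (c' * (Real.exp (-L') * (1 - q))) * D1 := by rw [← hc]; ring
      _ ≤ _ := by gcongr
  · calc N' * D1
        ≤ (c' * (Real.exp (-L') * Real.exp q)) * D1 := by gcongr
      _ = (c * p) * Real.exp (-L') * Real.exp q := by rw [← hc]; ring
      _ ≤ (c * p) * (Real.exp (-L) * Real.exp q) * Real.exp q := by gcongr
      _ = (c * p) * Real.exp (-L) * Real.exp (2 * q) := by rw [e2]; ring
      _ ≤ (c * p) * Real.exp (-L) * ((1 + 5 * q) * (1 - q)) := by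
          gcongr ?_ * ?_
          exact exp_le_aux q0 q1
      _ = (1 + 5 * q) * (p * (c * (Real.exp (-L) * (1 - q)))) := by ring
      _ ≤ (1 + 5 * q) * (p * N) := by gcongr
      _ ≤ _ := by gcongr

lemma extc_sup_edge {d : ℕ} {H : SimpleGraph V} {u v : V} (huv : u ≠ v) (hH : ¬ H.Adj u v)
    (h : ∀ v, dg H v ≤ d) (hd : 10000 ≤ d)
    (hV : Even (Fintype.card V)) (hD : (d:ℝ) ^ 11 / 4 + 2 ≤ degSum (resid d H)) :
    (1 - ee d) * ((resid d H u : ℝ) * resid d H v * extc d H)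
      ≤ extc d (H ⊔ SimpleGraph.edge u v) * (degSum (resid d H) - 1) ∧
    extc d (H ⊔ SimpleGraph.edge u v) * (degSum (resid d H) - 1)
      ≤ (1 + ee d) * ((resid d H u : ℝ) * resid d H v * extc d H) := by
  have hd11 : (0:ℝ) ≤ (d:ℝ) ^ 11 / 4 := by positivity
  by_cases hz : resid d H u = 0 ∨ resid d H v = 0
  · have h1 : extc d (H ⊔ SimpleGraph.edge u v) = 0 := by
      rcases hz with hz | hz
      · clear hD hd11 hd
        refine extc_eq_zero (v := u) ?_
        rw [dg_sup_edge H huv hH]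
        have := h u
        unfold resid at hz
        simp [inc, huv]; omega
      · clear hD hd11 hd
        refine extc_eq_zero (v := v) ?_
        rw [dg_sup_edge H huv hH]
        have := h v
        unfold resid at hz
        simp [inc, huv.symm]; omega
    rcases hz with hz | hz <;> simp [h1, hz]
  · push Not at hz
    have hi : ((u, v) : V × V) ∈ goodPairs (resid d H) H := by
      rw [mem_goodPairs]
      exact ⟨⟨Nat.one_le_iff_ne_zero.2 hz.1, Nat.one_le_iff_ne_zero.2 hz.2⟩, huv, hH⟩
    have he := resid_sup_edge (d := d) huv hH
    have hlam := gL_nxt_sub hi (fun v => (resid_add h v).le) hd (by linarith)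
    have h' : ∀ x, dg (H ⊔ SimpleGraph.edge u v) x ≤ d := fun x => by
      have h1 := dg_add_nxt hi x
      have h2 := resid_add h x
      simp only at h1
      clear hD hd11 hd
      omega
    have hDn : degSum (resid d (H ⊔ SimpleGraph.edge u v)) = degSum (resid d H) - 2 := by
      have h1 := degSum_nxt hi
      rw [he]; exact h1
    obtain ⟨b1, b2⟩ := extc_bounds h hd hV (by linarith)
    obtain ⟨c1, c2⟩ := extc_bounds h' hd hV (by linarith)
    have hc := conf_nxt hi
    simp only at hc hlam
    rw [← he] at hc hlam
    have hpw : pw (resid d H) u v = (resid d H u : ℝ) * resid d H v := by simp [pw, huv]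
    rw [hpw] at hc
    have hp0 : (0:ℝ) ≤ (resid d H u : ℝ) * resid d H v := by positivity
    have hcp := conf_pos (resid d H)
    have hD1 : 0 ≤ degSum (resid d H) - 1 := by linarith
    have q0 := qe_nonneg d
    have q1 := qe_small hd
    have q5 := five_qe_le d
    exact edge_ratio_aux hp0 hcp hD1 (by positivity) q0 q1 (five_qe_le d) b1 b2 c1 c2 hc hlam

end EdgeRatio

section CliqueExtensions

set_option linter.unusedSectionVars false

variable {V : Type*} [Fintype V] [DecidableEq V]

/-- The range of parameters. -/
structure Regime (V : Type*) [Fintype V] (d : ℕ) : Prop where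
  large : 10000 ≤ d
  even : Even (Fintype.card V)
  pow_le : d ^ 10 ≤ Fintype.card V

namespace Regime

variable {d : ℕ}

lemma large' (R : Regime V d) : (10000:ℝ) ≤ d := by exact_mod_cast R.large

lemma pow_le' (R : Regime V d) : (d:ℝ) ^ 10 ≤ Fintype.card V := by exact_mod_cast R.pow_le

lemma card_large (R : Regime V d) : (10:ℝ) ^ 40 ≤ Fintype.card V := by
  refine le_trans ?_ R.pow_le'
  calc (10:ℝ) ^ 40 = 10000 ^ 10 := by norm_num
    _ ≤ (d:ℝ) ^ 10 := by have := R.large'; gcongr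

lemma pow_succ_le (R : Regime V d) : (d:ℝ) ^ 11 ≤ Fintype.card V * d := by
  calc (d:ℝ) ^ 11 = (d:ℝ) ^ 10 * d := by ring
    _ ≤ _ := by have := R.pow_le'; gcongr

lemma small_deg (R : Regime V d) {H : SimpleGraph V} (hH : ∑ v, dg H v ≤ 100) (v : V) :
    dg H v ≤ d := by
  have := Finset.single_le_sum (f := dg H) (fun _ _ => Nat.zero_le _) (Finset.mem_univ v)
  have := R.large
  omega

lemma small_degSum (R : Regime V d) {H : SimpleGraph V} {b : ℕ} (hb : b ≤ 100)
    (hH : ∑ v, dg H v ≤ b) : Fintype.card V * d - b ≤ degSum (resid d H) := by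
  rw [degSum_resid (R.small_deg (hH.trans hb))]
  have : ((∑ v, dg H v : ℕ) : ℝ) ≤ b := by exact_mod_cast hH
  push_cast at this
  linarith

lemma small_large (R : Regime V d) {H : SimpleGraph V} (hH : ∑ v, dg H v ≤ 100) :
    (d:ℝ) ^ 11 / 4 + 2 ≤ degSum (resid d H) := by
  have h1 := R.small_degSum le_rfl hH
  have h2 := R.pow_succ_le
  have h3 : (10:ℝ) ^ 40 ≤ (d:ℝ) ^ 11 := by
    calc (10:ℝ) ^ 40 ≤ 10000 ^ 11 := by norm_num
    _ ≤ (d:ℝ) ^ 11 := by have := R.large'; gcongr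
  push_cast at h1
  linarith

end Regime

lemma extc_anti {d : ℕ} {H H' : SimpleGraph V} (h : H ≤ H') : extc d H' ≤ extc d H := by
  classical
  unfold extc
  refine Finset.card_le_card fun G hG => ?_
  rw [Finset.mem_filter] at hG ⊢
  exact ⟨hG.1, h.trans hG.2⟩

lemma resid_le {d : ℕ} (H : SimpleGraph V) (v : V) : (resid d H v : ℝ) ≤ d := by
  exact_mod_cast Nat.sub_le _ _

lemma extc_edge_le {d : ℕ} (R : Regime V d) {H : SimpleGraph V} (hH : ∑ v, dg H v ≤ 100) {u v : V}
    (huv : u ≠ v) (h : ¬ H.Adj u v) :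
    (extc d (H ⊔ SimpleGraph.edge u v) : ℝ) ≤ 3 * d / Fintype.card V * extc d H := by
  have h1 := (extc_sup_edge huv h (R.small_deg hH) R.large R.even (R.small_large hH)).2
  have h2 := R.small_degSum le_rfl hH
  have h3 := R.card_large
  have h4 := R.large'
  have h5 := ee_small R.large
  have hN : (0:ℝ) ≤ extc d H := Nat.cast_nonneg _
  have hN' : (0:ℝ) ≤ extc d (H ⊔ SimpleGraph.edge u v) := Nat.cast_nonneg _
  have ha := resid_le (d := d) H u
  have hb := resid_le (d := d) H v
  have hD : (Fintype.card V : ℝ) * d / 2 ≤ degSum (resid d H) - 1 := by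
    push_cast at h2; nlinarith
  have h6 : (extc d (H ⊔ SimpleGraph.edge u v) : ℝ) * (Fintype.card V * d / 2)
      ≤ (3 / 2) * (d * d * extc d H) := by
    calc _ ≤ (extc d (H ⊔ SimpleGraph.edge u v) : ℝ) * (degSum (resid d H) - 1) := by gcongr
      _ ≤ _ := h1
      _ ≤ _ := by gcongr; linarith
  have hn : (0:ℝ) < Fintype.card V := by linarith
  rw [div_mul_eq_mul_div, le_div_iff₀ hn]
  have h7 : ((extc d (H ⊔ SimpleGraph.edge u v) : ℝ) * Fintype.card V) * d
      ≤ (3 * d * extc d H) * d := by nlinarith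
  exact le_of_mul_le_mul_right h7 (by linarith)

lemma sum_dg_sup_edge {H : SimpleGraph V} {u v : V} (huv : u ≠ v) (h : ¬ H.Adj u v) :
    ∑ x, dg (H ⊔ SimpleGraph.edge u v) x = ∑ x, dg H x + 2 := by
  rw [Finset.sum_congr rfl fun x _ => dg_sup_edge H huv h x, Finset.sum_add_distrib, sum_inc]

lemma not_adj_sup_edge {H : SimpleGraph V} {x y u v : V} (h : ¬ H.Adj x y)
    (h1 : ¬ ((x = u ∧ y = v) ∨ (x = v ∧ y = u))) : ¬ (H ⊔ SimpleGraph.edge u v).Adj x y := by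
  rw [SimpleGraph.sup_adj, SimpleGraph.edge_adj]
  tauto

lemma extc_two_edges_le {d : ℕ} (R : Regime V d) {H H' : SimpleGraph V}
    (hH : ∑ v, dg H v ≤ 98) {x y z : V} (hxy : x ≠ y) (hxz : x ≠ z) (hyz : y ≠ z)
    (h1 : ¬ H.Adj x z) (h2 : ¬ H.Adj y z) (hs : H ≤ H') (hx : H'.Adj x z) (hy : H'.Adj y z) :
    (extc d H' : ℝ) ≤ (3 * d / Fintype.card V) ^ 2 * extc d H := by
  have h3 : ¬ (H ⊔ SimpleGraph.edge x z).Adj y z :=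
    not_adj_sup_edge h2 (by rintro (⟨h, -⟩ | ⟨h, -⟩) <;> [exact hxy h.symm; exact hyz h])
  have h4 : H ⊔ SimpleGraph.edge x z ⊔ SimpleGraph.edge y z ≤ H' :=
    sup_le (sup_le hs ((H'.edge_le_iff).2 (Or.inr hx)))
      ((H'.edge_le_iff).2 (Or.inr hy))
  have h5 := extc_edge_le R (hH.trans (by norm_num)) hxz h1
  have h6 := extc_edge_le R (H := H ⊔ SimpleGraph.edge x z)
    (by rw [sum_dg_sup_edge hxz h1]; omega) hyz h3
  calc (extc d H' : ℝ) ≤ extc d (H ⊔ SimpleGraph.edge x z ⊔ SimpleGraph.edge y z) := by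
        exact_mod_cast extc_anti h4
    _ ≤ _ := h6
    _ ≤ 3 * d / Fintype.card V * (3 * d / Fintype.card V * extc d H) := by gcongr
    _ = _ := by ring

/-- The triangle on three vertices. -/
def tri (x y z : V) : SimpleGraph V :=
  SimpleGraph.edge x y ⊔ SimpleGraph.edge x z ⊔ SimpleGraph.edge y z

lemma resid_sup_edge_apply {d : ℕ} {H : SimpleGraph V} {u v : V} (huv : u ≠ v)
    (h : ¬ H.Adj u v) (x : V) :
    resid d (H ⊔ SimpleGraph.edge u v) x = resid d H x - inc u v x := by
  rw [resid_sup_edge huv h]; rfl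

lemma degSum_sup_edge {d : ℕ} {H : SimpleGraph V} {u v : V} (huv : u ≠ v) (h : ¬ H.Adj u v)
    (hd : ∀ x, dg (H ⊔ SimpleGraph.edge u v) x ≤ d) :
    degSum (resid d (H ⊔ SimpleGraph.edge u v)) = degSum (resid d H) - 2 := by
  have hd' : ∀ x, dg H x ≤ d := fun x => (dg_mono le_sup_left x).trans (hd x)
  rw [degSum_resid hd, degSum_resid hd']
  have : (∑ x, (dg (H ⊔ SimpleGraph.edge u v) x : ℝ)) = ∑ x, (dg H x : ℝ) + 2 := by
    exact_mod_cast sum_dg_sup_edge huv h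
  rw [this]; ring

lemma extc_tri {d : ℕ} (hd1 : 10000 ≤ d) (hV : Even (Fintype.card V)) {H : SimpleGraph V}
    {x y z : V} {a b c : ℕ} (hxy : x ≠ y) (hxz : x ≠ z) (hyz : y ≠ z)
    (h1 : ¬ H.Adj x y) (h2 : ¬ H.Adj x z) (h3 : ¬ H.Adj y z)
    (hd : ∀ v, dg H v + 2 ≤ d)
    (ha : resid d H x = a) (hb : resid d H y = b) (hc : resid d H z = c)
    (hD : (d:ℝ) ^ 11 / 4 + 6 ≤ degSum (resid d H)) :
    (1 - ee d) ^ 3 * ((a * (a - 1 : ℕ)) * (b * (b - 1 : ℕ)) * (c * (c - 1 : ℕ)) * extc d H)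
      ≤ extc d (H ⊔ tri x y z) * ((degSum (resid d H) - 1) * (degSum (resid d H) - 3)
        * (degSum (resid d H) - 5)) ∧
    extc d (H ⊔ tri x y z) * ((degSum (resid d H) - 1) * (degSum (resid d H) - 3)
        * (degSum (resid d H) - 5))
      ≤ (1 + ee d) ^ 3
        * ((a * (a - 1 : ℕ)) * (b * (b - 1 : ℕ)) * (c * (c - 1 : ℕ)) * extc d H) := by
  have hd11 : (0:ℝ) ≤ (d:ℝ) ^ 11 / 4 := by positivity
  have e : H ⊔ tri x y z
      = H ⊔ SimpleGraph.edge x y ⊔ SimpleGraph.edge x z ⊔ SimpleGraph.edge y z := by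
    unfold tri; simp only [sup_assoc]
  have h2' : ¬ (H ⊔ SimpleGraph.edge x y).Adj x z :=
    not_adj_sup_edge h2 (by
      rintro (⟨-, h⟩ | ⟨h, -⟩) <;> [exact hyz h.symm; exact hxy h])
  have h3' : ¬ (H ⊔ SimpleGraph.edge x y).Adj y z :=
    not_adj_sup_edge h3 (by
      rintro (⟨h, -⟩ | ⟨-, h⟩) <;> [exact hxy h.symm; exact hxz h.symm])
  have h3'' : ¬ (H ⊔ SimpleGraph.edge x y ⊔ SimpleGraph.edge x z).Adj y z :=
    not_adj_sup_edge h3' (by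
      rintro (⟨h, -⟩ | ⟨h, -⟩) <;> [exact hxy h.symm; exact hyz h])
  have hinc : ∀ u v w : V, u ≠ v → inc u v w ≤ 1 := by
    intro u v w huv
    unfold inc
    by_cases h : w = u
    · subst h; simp [huv]
    · simp only [h, if_false]; split_ifs <;> omega
  have g0 : ∀ v, dg H v ≤ d := fun v => by have := hd v; omega
  have g1 : ∀ v, dg (H ⊔ SimpleGraph.edge x y) v ≤ d := fun v => by
    rw [dg_sup_edge H hxy h1]
    have := hd v
    have := hinc x y v hxy
    omega
  have g2 : ∀ v, dg (H ⊔ SimpleGraph.edge x y ⊔ SimpleGraph.edge x z) v ≤ d := fun v => by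
    rw [dg_sup_edge _ hxz h2', dg_sup_edge H hxy h1]
    have := hd v
    have := hinc x y v hxy
    have := hinc x z v hxz
    omega
  have D1 := degSum_sup_edge hxy h1 g1
  have D2 := degSum_sup_edge hxz h2' g2
  rw [D1] at D2
  obtain ⟨l1, u1⟩ := extc_sup_edge hxy h1 g0 hd1 hV (by linarith)
  obtain ⟨l2, u2⟩ := extc_sup_edge hxz h2' g1 hd1 hV (by linarith)
  obtain ⟨l3, u3⟩ := extc_sup_edge hyz h3'' g2 hd1 hV (by linarith)
  rw [D1, resid_sup_edge_apply hxy h1, resid_sup_edge_apply hxy h1, ha, hc,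
    show inc x y x = 1 by simp [inc, hxy], show inc x y z = 0 by simp [inc, hxz.symm, hyz.symm],
    Nat.sub_zero] at l2 u2
  rw [D2, resid_sup_edge_apply hxz h2', resid_sup_edge_apply hxz h2',
    resid_sup_edge_apply hxy h1, resid_sup_edge_apply hxy h1, hb, hc,
    show inc x z y = 0 by simp [inc, hxy.symm, hyz], show inc x z z = 1 by simp [inc, hxz.symm],
    show inc x y y = 1 by simp [inc, hxy.symm], show inc x y z = 0 by simp [inc, hxz.symm, hyz.symm],
    Nat.sub_zero, Nat.sub_zero] at l3 u3
  rw [ha, hb] at l1 u1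
  rw [e]
  have q0 := ee_nonneg d
  have q1 := ee_small hd1
  have hN0 : (0:ℝ) ≤ extc d H := Nat.cast_nonneg _
  have hN1 : (0:ℝ) ≤ extc d (H ⊔ SimpleGraph.edge x y) := Nat.cast_nonneg _
  have hN2 : (0:ℝ) ≤ extc d (H ⊔ SimpleGraph.edge x y ⊔ SimpleGraph.edge x z) := Nat.cast_nonneg _
  have hN3 : (0:ℝ) ≤ extc d (H ⊔ SimpleGraph.edge x y ⊔ SimpleGraph.edge x z
    ⊔ SimpleGraph.edge y z) := Nat.cast_nonneg _
  generalize (extc d (H ⊔ SimpleGraph.edge x y ⊔ SimpleGraph.edge x z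
    ⊔ SimpleGraph.edge y z) : ℝ) = N3 at *
  generalize (extc d (H ⊔ SimpleGraph.edge x y ⊔ SimpleGraph.edge x z) : ℝ) = N2 at *
  generalize (extc d (H ⊔ SimpleGraph.edge x y) : ℝ) = N1 at *
  generalize (extc d H : ℝ) = N0 at *
  generalize degSum (resid d H) = D at *
  generalize ee d = q at *
  have hDp1 : 0 ≤ D - 1 := by linarith
  have hDp3 : 0 ≤ D - 2 - 1 := by linarith
  have f1 : 0 ≤ 1 - q := by linarith
  have p1 : (0:ℝ) ≤ (a - 1 : ℕ) := Nat.cast_nonneg _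
  have p2 : (0:ℝ) ≤ (b - 1 : ℕ) := Nat.cast_nonneg _
  have p3 : (0:ℝ) ≤ (c - 1 : ℕ) := Nat.cast_nonneg _
  generalize ((a - 1 : ℕ) : ℝ) = a1 at *
  generalize ((b - 1 : ℕ) : ℝ) = b1 at *
  generalize ((c - 1 : ℕ) : ℝ) = c1 at *
  constructor
  · calc (1 - q) ^ 3 * (a * a1 * (b * b1) * (c * c1) * N0)
        = (1 - q) * (b1 * c1 * ((1 - q) * (a1 * c * ((1 - q) * (a * b * N0))))) := by ring
      _ ≤ (1 - q) * (b1 * c1 * ((1 - q) * (a1 * c * (N1 * (D - 1))))) := by gcongr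
      _ = (1 - q) * (b1 * c1 * ((1 - q) * (a1 * c * N1) * (D - 1))) := by ring
      _ ≤ (1 - q) * (b1 * c1 * (N2 * (D - 2 - 1) * (D - 1))) := by gcongr
      _ = (1 - q) * (b1 * c1 * N2) * ((D - 2 - 1) * (D - 1)) := by ring
      _ ≤ N3 * (D - 2 - 2 - 1) * ((D - 2 - 1) * (D - 1)) := by gcongr
      _ = _ := by ring
  · calc _ = N3 * (D - 2 - 2 - 1) * ((D - 2 - 1) * (D - 1)) := by ring
      _ ≤ (1 + q) * (b1 * c1 * N2) * ((D - 2 - 1) * (D - 1)) := by gcongr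
      _ = (1 + q) * (b1 * c1 * (N2 * (D - 2 - 1) * (D - 1))) := by ring
      _ ≤ (1 + q) * (b1 * c1 * ((1 + q) * (a1 * c * N1) * (D - 1))) := by gcongr
      _ = (1 + q) * (b1 * c1 * ((1 + q) * (a1 * c * (N1 * (D - 1))))) := by ring
      _ ≤ (1 + q) * (b1 * c1 * ((1 + q) * (a1 * c * ((1 + q) * (a * b * N0))))) := by gcongr
      _ = _ := by ring

end CliqueExtensions

section TriangleCounts

set_option linter.unusedSectionVars false

variable {V : Type*} [Fintype V] [DecidableEq V]

/-- The union of the cliques on the members of `s`. -/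
def clq (s : Finset (Finset V)) : SimpleGraph V where
  Adj u v := u ≠ v ∧ ∃ τ ∈ s, u ∈ τ ∧ v ∈ τ
  symm := ⟨fun _ _ h => ⟨h.1.symm, h.2.imp fun _ h => ⟨h.1, h.2.2, h.2.1⟩⟩⟩
  loopless := ⟨fun _ h => h.1 rfl⟩

lemma clq_adj {s : Finset (Finset V)} {u v : V} :
    (clq s).Adj u v ↔ u ≠ v ∧ ∃ τ ∈ s, u ∈ τ ∧ v ∈ τ := Iff.rfl

lemma clq_empty : clq (∅ : Finset (Finset V)) = ⊥ := by
  ext u v; simp [clq_adj]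

lemma clq_insert (s : Finset (Finset V)) (τ : Finset V) : clq (insert τ s) = clq s ⊔ clq {τ} := by
  ext u v
  simp only [SimpleGraph.sup_adj, clq_adj, Finset.mem_insert, Finset.mem_singleton]
  constructor
  · rintro ⟨h, ρ, rfl | h1, h2⟩
    · exact Or.inr ⟨h, _, rfl, h2⟩
    · exact Or.inl ⟨h, _, h1, h2⟩
  · rintro (⟨h, ρ, h1, h2⟩ | ⟨h, ρ, rfl, h2⟩)
    · exact ⟨h, ρ, Or.inr h1, h2⟩
    · exact ⟨h, _, Or.inl rfl, h2⟩

lemma clq_triple {x y z : V} (hxy : x ≠ y) (hxz : x ≠ z) (hyz : y ≠ z) :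
    clq {({x, y, z} : Finset V)} = tri x y z := by
  ext u v
  simp only [clq_adj, Finset.mem_singleton, exists_eq_left, Finset.mem_insert, tri,
    SimpleGraph.sup_adj, SimpleGraph.edge_adj]
  constructor
  · rintro ⟨h, rfl | rfl | rfl, rfl | rfl | rfl⟩ <;> simp_all
  · rintro ((⟨⟨rfl, rfl⟩ | ⟨rfl, rfl⟩, h⟩ | ⟨⟨rfl, rfl⟩ | ⟨rfl, rfl⟩, h⟩)
      | ⟨⟨rfl, rfl⟩ | ⟨rfl, rfl⟩, h⟩) <;> simp_all

lemma clq_le_iff {s : Finset (Finset V)} {G : SimpleGraph V} :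
    clq s ≤ G ↔ ∀ τ ∈ s, clq {τ} ≤ G := by
  constructor
  · intro h τ hτ u v huv
    apply h
    rw [clq_adj] at huv ⊢
    exact ⟨huv.1, τ, hτ, by simpa using huv.2⟩
  · intro h u v huv
    rw [clq_adj] at huv
    obtain ⟨hne, τ, hτ, h1⟩ := huv
    exact h τ hτ (clq_adj.2 ⟨hne, τ, Finset.mem_singleton_self _, h1⟩)

/-- The triples of vertices. -/
def triples (V : Type*) [Fintype V] : Finset (Finset V) := Finset.powersetCard 3 Finset.univ

lemma mem_triples {τ : Finset V} : τ ∈ triples V ↔ τ.card = 3 := by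
  simp [triples, Finset.mem_powersetCard]

lemma dg_clq_le {s : Finset (Finset V)} (hs : s ⊆ triples V) (v : V) :
    dg (clq s) v ≤ ∑ τ ∈ s, if v ∈ τ then 2 else 0 := by
  classical
  have h1 : Finset.univ.filter ((clq s).Adj v)
      ⊆ s.biUnion fun τ => if v ∈ τ then τ.erase v else ∅ := by
    intro w hw
    simp only [Finset.mem_filter, Finset.mem_univ, true_and, clq_adj] at hw
    obtain ⟨hne, τ, hτ, h1, h2⟩ := hw
    rw [Finset.mem_biUnion]
    exact ⟨τ, hτ, by simp [h1, h2, hne.symm]⟩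
  refine (Finset.card_le_card h1).trans (Finset.card_biUnion_le.trans ?_)
  refine Finset.sum_le_sum fun τ hτ => ?_
  split_ifs with h
  · rw [Finset.card_erase_of_mem h, mem_triples.1 (hs hτ)]
  · simp

lemma sum_dg_clq_le {s : Finset (Finset V)} (hs : s ⊆ triples V) :
    ∑ v, dg (clq s) v ≤ 6 * s.card := by
  calc ∑ v, dg (clq s) v ≤ ∑ v, ∑ τ ∈ s, (if v ∈ τ then 2 else 0) :=
        Finset.sum_le_sum fun v _ => dg_clq_le hs v
    _ = ∑ τ ∈ s, 6 := by
        rw [Finset.sum_comm]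
        refine Finset.sum_congr rfl fun τ hτ => ?_
        rw [← Finset.sum_filter]
        simp [mem_triples.1 (hs hτ)]
    _ = _ := by simp [mul_comm]

/-- The vertices covered by `s`. -/
def cover (s : Finset (Finset V)) : Finset V := s.biUnion id

lemma mem_cover {s : Finset (Finset V)} {v : V} : v ∈ cover s ↔ ∃ τ ∈ s, v ∈ τ := by
  simp [cover]

lemma card_cover_le {s : Finset (Finset V)} (hs : s ⊆ triples V) :
    (cover s).card ≤ 3 * s.card := by
  refine Finset.card_biUnion_le.trans ?_
  simp only [id]
  rw [Finset.sum_congr rfl fun τ hτ => mem_triples.1 (hs hτ)]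
  simp [mul_comm]

lemma not_clq_adj_left {s : Finset (Finset V)} {u v : V} (h : u ∉ cover s) :
    ¬ (clq s).Adj u v := fun hadj => by
  obtain ⟨-, τ, hτ, h1, -⟩ := clq_adj.1 hadj
  exact h (mem_cover.2 ⟨τ, hτ, h1⟩)

lemma not_clq_adj_right {s : Finset (Finset V)} {u v : V} (h : v ∉ cover s) :
    ¬ (clq s).Adj u v := fun hadj => not_clq_adj_left h hadj.symm

lemma dg_clq_eq_zero {s : Finset (Finset V)} {v : V} (h : v ∉ cover s) : dg (clq s) v = 0 := by
  classical
  unfold dg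
  rw [Finset.card_eq_zero, Finset.filter_eq_empty_iff]
  exact fun w _ => not_clq_adj_left h

/-- Triples meeting `W` in at least `k` vertices. -/
def meet (W : Finset V) (k : ℕ) : Finset (Finset V) :=
  (triples V).filter fun τ => k ≤ (τ ∩ W).card

lemma card_meet_one (W : Finset V) : (meet W 1).card ≤ W.card * Fintype.card V ^ 2 := by
  classical
  have : meet W 1 ⊆ (W ×ˢ (Finset.univ : Finset (V × V))).image
      fun i => ({i.1, i.2.1, i.2.2} : Finset V) := by
    intro τ hτ
    simp only [meet, Finset.mem_filter, mem_triples] at hτ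
    obtain ⟨w, hw⟩ := Finset.card_pos.1 hτ.2
    rw [Finset.mem_inter] at hw
    have h2 : (τ.erase w).card = 2 := by rw [Finset.card_erase_of_mem hw.1, hτ.1]
    obtain ⟨y, z, -, hyz⟩ := Finset.card_eq_two.1 h2
    rw [Finset.mem_image]
    refine ⟨(w, y, z), by simp [hw.2], ?_⟩
    simp only
    rw [← Finset.insert_erase hw.1, hyz]
  refine (Finset.card_le_card this).trans (Finset.card_image_le.trans ?_)
  simp [sq]

lemma card_meet_two (W : Finset V) : (meet W 2).card ≤ W.card ^ 2 * Fintype.card V := by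
  classical
  have : meet W 2 ⊆ ((W ×ˢ W) ×ˢ (Finset.univ : Finset V)).image
      fun i => ({i.1.1, i.1.2, i.2} : Finset V) := by
    intro τ hτ
    simp only [meet, Finset.mem_filter, mem_triples] at hτ
    obtain ⟨w, hw, v, hv, hwv⟩ := Finset.one_lt_card.1 hτ.2
    rw [Finset.mem_inter] at hw hv
    have hv' : v ∈ τ.erase w := Finset.mem_erase.2 ⟨hwv.symm, hv.1⟩
    have h2 : ((τ.erase w).erase v).card = 1 := by
      rw [Finset.card_erase_of_mem hv', Finset.card_erase_of_mem hw.1, hτ.1]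
    obtain ⟨z, hz⟩ := Finset.card_eq_one.1 h2
    rw [Finset.mem_image]
    refine ⟨((w, v), z), by simp [hw.2, hv.2], ?_⟩
    simp only
    rw [← Finset.insert_erase hw.1, ← Finset.insert_erase hv', hz]
  refine (Finset.card_le_card this).trans (Finset.card_image_le.trans ?_)
  simp [sq]

lemma card_meet_three (W : Finset V) : (meet W 3).card ≤ W.card ^ 3 := by
  classical
  have : meet W 3 ⊆ Finset.powersetCard 3 W := by
    intro τ hτ
    simp only [meet, Finset.mem_filter, mem_triples] at hτ
    rw [Finset.mem_powersetCard]
    have h1 : τ ∩ W = τ := Finset.eq_of_subset_of_card_le Finset.inter_subset_left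
      (by rw [hτ.1]; exact hτ.2)
    exact ⟨Finset.inter_eq_left.1 h1, hτ.1⟩
  refine (Finset.card_le_card this).trans ?_
  rw [Finset.card_powersetCard]
  exact Nat.choose_le_pow _ _

lemma card_triples_le : ((triples V).card : ℝ) ≤ (Fintype.card V : ℝ) ^ 3 / 6 := by
  rw [triples, Finset.card_powersetCard, Finset.card_univ]
  have := Nat.choose_le_pow_div (α := ℝ) 3 (Fintype.card V)
  simpa [Nat.factorial] using this

end TriangleCounts

section TriangleSums

set_option linter.unusedSectionVars false

variable {V : Type*} [Fintype V] [DecidableEq V]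

lemma extc_three_edges_le {d : ℕ} (R : Regime V d) {H : SimpleGraph V}
    (hH : ∑ v, dg H v ≤ 96) {x y z : V} (hxy : x ≠ y) (hxz : x ≠ z) (hyz : y ≠ z)
    (h1 : ¬ H.Adj x y) (h2 : ¬ H.Adj x z) (h3 : ¬ H.Adj y z) :
    (extc d (H ⊔ tri x y z) : ℝ) ≤ (3 * d / Fintype.card V) ^ 3 * extc d H := by
  have h4 := extc_edge_le R (by omega) hxy h1
  have e : H ⊔ tri x y z
      = H ⊔ SimpleGraph.edge x y ⊔ SimpleGraph.edge x z ⊔ SimpleGraph.edge y z := by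
    unfold tri; simp only [sup_assoc]
  have h2' : ¬ (H ⊔ SimpleGraph.edge x y).Adj x z :=
    not_adj_sup_edge h2 (by
      rintro (⟨-, h⟩ | ⟨h, -⟩) <;> [exact hyz h.symm; exact hxy h])
  have h3' : ¬ (H ⊔ SimpleGraph.edge x y).Adj y z :=
    not_adj_sup_edge h3 (by
      rintro (⟨h, -⟩ | ⟨-, h⟩) <;> [exact hxy h.symm; exact hxz h.symm])
  have h5 := extc_two_edges_le (H' := H ⊔ tri x y z) R
    (by rw [sum_dg_sup_edge hxy h1]; omega) hxy hxz hyz h2' h3'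
    (by rw [e, sup_assoc (H ⊔ SimpleGraph.edge x y)]; exact le_sup_left)
    (by rw [e]; simp [SimpleGraph.sup_adj, SimpleGraph.edge_adj, hxz])
    (by rw [e]; simp [SimpleGraph.sup_adj, SimpleGraph.edge_adj, hyz])
  calc (extc d (H ⊔ tri x y z) : ℝ)
      ≤ (3 * d / Fintype.card V) ^ 2 * extc d (H ⊔ SimpleGraph.edge x y) := h5
    _ ≤ (3 * d / Fintype.card V) ^ 2 * (3 * d / Fintype.card V * extc d H) := by gcongr
    _ = _ := by ring

lemma clq_insert_triple (s : Finset (Finset V)) {x y z : V} (hxy : x ≠ y) (hxz : x ≠ z)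
    (hyz : y ≠ z) : clq (insert {x, y, z} s) = clq s ⊔ tri x y z := by
  rw [clq_insert, clq_triple hxy hxz hyz]

lemma clq_mono_insert (s : Finset (Finset V)) (τ : Finset V) : clq s ≤ clq (insert τ s) := by
  rw [clq_insert]; exact le_sup_left

lemma extc_insert_le_of_inter_le_one {d : ℕ} (R : Regime V d) {s : Finset (Finset V)}
    (hs : s ⊆ triples V) (hs3 : s.card ≤ 3) {τ : Finset V} (hτ : τ ∈ triples V)
    (h : (τ ∩ cover s).card ≤ 1) :
    (extc d (clq (insert τ s)) : ℝ) ≤ (3 * d / Fintype.card V) ^ 3 * extc d (clq s) := by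
  have hno : ∀ u ∈ τ, ∀ v ∈ τ, u ≠ v → ¬ (clq s).Adj u v := by
    intro u hu v hv huv hadj
    have h1 : u ∈ cover s := by
      by_contra h1; exact not_clq_adj_left h1 hadj
    have h2 : v ∈ cover s := by
      by_contra h1; exact not_clq_adj_right h1 hadj
    have := Finset.one_lt_card.2 ⟨u, Finset.mem_inter.2 ⟨hu, h1⟩, v, Finset.mem_inter.2 ⟨hv, h2⟩, huv⟩
    omega
  obtain ⟨x, y, z, hxy, hxz, hyz, rfl⟩ := Finset.card_eq_three.1 (mem_triples.1 hτ)
  rw [clq_insert_triple s hxy hxz hyz]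
  have := sum_dg_clq_le hs
  exact extc_three_edges_le R (by omega) hxy hxz hyz (hno _ (by simp) _ (by simp) hxy)
    (hno _ (by simp) _ (by simp) hxz) (hno _ (by simp) _ (by simp) hyz)

lemma extc_insert_le_of_pair {d : ℕ} (R : Regime V d) {s : Finset (Finset V)}
    (hs : s ⊆ triples V) (hs3 : s.card ≤ 3) {x y z : V} (hxy : x ≠ y) (hxz : x ≠ z) (hyz : y ≠ z)
    (h1 : ¬ (clq s).Adj x z) (h2 : ¬ (clq s).Adj y z) :
    (extc d (clq (insert {x, y, z} s)) : ℝ)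
      ≤ (3 * d / Fintype.card V) ^ 2 * extc d (clq s) := by
  have := sum_dg_clq_le hs
  refine extc_two_edges_le R (by omega) hxy hxz hyz h1 h2 (clq_mono_insert _ _) ?_ ?_
  · exact clq_adj.2 ⟨hxz, _, Finset.mem_insert_self _ _, by simp, by simp⟩
  · exact clq_adj.2 ⟨hyz, _, Finset.mem_insert_self _ _, by simp, by simp⟩

lemma exists_triple_of_mem {τ : Finset V} (hτ : τ ∈ triples V) {z : V} (hz : z ∈ τ) :
    ∃ x y, x ≠ y ∧ x ≠ z ∧ y ≠ z ∧ τ = {x, y, z} := by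
  have h2 : (τ.erase z).card = 2 := by rw [Finset.card_erase_of_mem hz, mem_triples.1 hτ]
  obtain ⟨x, y, hxy, h⟩ := Finset.card_eq_two.1 h2
  have hx : x ∈ τ.erase z := by rw [h]; simp
  have hy : y ∈ τ.erase z := by rw [h]; simp
  refine ⟨x, y, hxy, Finset.ne_of_mem_erase hx, Finset.ne_of_mem_erase hy, ?_⟩
  rw [← Finset.insert_erase hz, h]
  ext; simp; tauto

lemma extc_insert_le_of_inter_le_two {d : ℕ} (R : Regime V d) {s : Finset (Finset V)}
    (hs : s ⊆ triples V) (hs3 : s.card ≤ 3) {τ : Finset V} (hτ : τ ∈ triples V)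
    (h : (τ ∩ cover s).card ≤ 2) :
    (extc d (clq (insert τ s)) : ℝ) ≤ (3 * d / Fintype.card V) ^ 2 * extc d (clq s) := by
  obtain ⟨z, hz, hz'⟩ : ∃ z ∈ τ, z ∉ cover s := by
    by_contra! hcon
    rw [Finset.inter_eq_left.2 hcon, mem_triples.1 hτ] at h
    omega
  obtain ⟨x, y, hxy, hxz, hyz, rfl⟩ := exists_triple_of_mem hτ hz
  exact extc_insert_le_of_pair R hs hs3 hxy hxz hyz (not_clq_adj_right hz')
    (not_clq_adj_right hz')

/-- The members of `s` are pairwise disjoint. -/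
def PwDisj (s : Finset (Finset V)) : Prop := ∀ ρ ∈ s, ∀ σ ∈ s, ρ ≠ σ → Disjoint ρ σ

lemma PwDisj.eq {s : Finset (Finset V)} (h : PwDisj s) {ρ σ : Finset V} (hρ : ρ ∈ s) (hσ : σ ∈ s)
    {x : V} (h1 : x ∈ ρ) (h2 : x ∈ σ) : ρ = σ := by
  by_contra hne
  exact Finset.disjoint_left.1 (h ρ hρ σ hσ hne) h1 h2

lemma PwDisj.insert {s : Finset (Finset V)} (h : PwDisj s) {τ : Finset V}
    (hτ : Disjoint τ (cover s)) : PwDisj (insert τ s) := by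
  have h1 : ∀ ρ ∈ s, Disjoint τ ρ := fun ρ hρ => by
    rw [Finset.disjoint_left] at hτ ⊢
    exact fun x hx hx' => hτ hx (mem_cover.2 ⟨ρ, hρ, hx'⟩)
  intro ρ hρ σ hσ hne
  rw [Finset.mem_insert] at hρ hσ
  rcases hρ with rfl | hρ <;> rcases hσ with rfl | hσ
  · exact absurd rfl hne
  · exact h1 _ hσ
  · exact (h1 _ hρ).symm
  · exact h _ hρ _ hσ hne

lemma extc_insert_le_of_pwDisj {d : ℕ} (R : Regime V d) {s : Finset (Finset V)}
    (hs : s ⊆ triples V) (hs3 : s.card ≤ 3) (hp : PwDisj s) {τ : Finset V} (hτ : τ ∈ triples V)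
    (hτs : τ ∉ s) :
    (extc d (clq (insert τ s)) : ℝ) ≤ (3 * d / Fintype.card V) ^ 2 * extc d (clq s) := by
  have key : ∀ x y z : V, x ≠ y → x ≠ z → y ≠ z → τ = {x, y, z} → (clq s).Adj x y →
      ¬ (clq s).Adj x z := by
    rintro x y z hxy hxz hyz rfl h1 h2
    obtain ⟨-, ρ, hρ, hx, hy⟩ := clq_adj.1 h1
    obtain ⟨-, σ, hσ, hx', hz⟩ := clq_adj.1 h2
    have := hp.eq hρ hσ hx hx'
    subst this
    have h3 : ({x, y, z} : Finset V) = ρ := by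
      refine Finset.eq_of_subset_of_card_le ?_ ?_
      · intro u hu
        simp only [Finset.mem_insert, Finset.mem_singleton] at hu
        rcases hu with rfl | rfl | rfl <;> assumption
      · rw [mem_triples.1 (hs hρ), mem_triples.1 hτ]
    exact hτs (h3 ▸ hρ)
  obtain ⟨x, y, z, hxy, hxz, hyz, he⟩ := Finset.card_eq_three.1 (mem_triples.1 hτ)
  have p1 : ({x, y, z} : Finset V) = {y, x, z} := by ext; simp; tauto
  have p2 : ({x, y, z} : Finset V) = {x, z, y} := by ext; simp; tauto
  by_cases c1 : (clq s).Adj x y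
  · rw [he]
    exact extc_insert_le_of_pair R hs hs3 hxy hxz hyz (key x y z hxy hxz hyz he c1)
      (key y x z hxy.symm hyz hxz (he.trans p1) c1.symm)
  · by_cases c2 : (clq s).Adj x z
    · rw [he, p2]
      refine extc_insert_le_of_pair R hs hs3 hxz hxy hyz.symm c1 fun c3 => ?_
      exact key z x y hxz.symm hyz.symm hxy (he.trans (by ext; simp; tauto)) c2.symm c3
    · by_cases c3 : (clq s).Adj y z
      · have p3 : ({x, y, z} : Finset V) = {y, z, x} := by ext; simp; tauto
        rw [he, p3]
        exact extc_insert_le_of_pair R hs hs3 hyz hxy.symm hxz.symm (fun h => c1 h.symm)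
          (fun h => c2 h.symm)
      · rw [he]
        exact extc_insert_le_of_pair R hs hs3 hxy hxz hyz c2 c3

lemma sum_extc_insert_le {d : ℕ} (R : Regime V d) {s : Finset (Finset V)}
    (hs : s ⊆ triples V) (hs3 : s.card ≤ 3) :
    ∑ τ ∈ triples V \ s, (extc d (clq (insert τ s)) : ℝ) ≤ 10 * (d:ℝ) ^ 3 * extc d (clq s) := by
  set e : ℝ := ((extc d (clq s) : ℕ) : ℝ) with he
  set n : ℝ := (Fintype.card V : ℝ) with hn
  have he0 : 0 ≤ e := Nat.cast_nonneg _
  have hn1 := R.card_large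
  rw [← hn] at hn1
  have hn0 : 0 < n := by linarith
  have hW : (cover s).card ≤ 9 := (card_cover_le hs).trans (by omega)
  have h1 : ∀ τ ∈ triples V \ s, (extc d (clq (insert τ s)) : ℝ) ≤ (3 * d / n) ^ 3 * e
      + (if 2 ≤ (τ ∩ cover s).card then (3 * d / n) ^ 2 * e else 0)
      + (if 3 ≤ (τ ∩ cover s).card then e else 0) := by
    intro τ hτ
    rw [Finset.mem_sdiff] at hτ
    have q1 : 0 ≤ (3 * d / n) ^ 3 * e := by positivity
    have q2 : 0 ≤ (3 * d / n) ^ 2 * e := by positivity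
    by_cases c1 : 3 ≤ (τ ∩ cover s).card
    · have : (extc d (clq (insert τ s)) : ℝ) ≤ e := by
        rw [he]; exact_mod_cast extc_anti (clq_mono_insert s τ)
      rw [if_pos c1]
      split_ifs <;> linarith
    · by_cases c2 : 2 ≤ (τ ∩ cover s).card
      · have := extc_insert_le_of_inter_le_two R hs hs3 hτ.1 (by omega)
        rw [if_neg c1, if_pos c2]; linarith
      · have := extc_insert_le_of_inter_le_one R hs hs3 hτ.1 (by omega)
        rw [if_neg c1, if_neg c2]; linarith
  have h2 : ∑ τ ∈ triples V \ s, (extc d (clq (insert τ s)) : ℝ)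
      ≤ ∑ τ ∈ triples V, ((3 * d / n) ^ 3 * e
      + (if 2 ≤ (τ ∩ cover s).card then (3 * d / n) ^ 2 * e else 0)
      + (if 3 ≤ (τ ∩ cover s).card then e else 0)) := by
    refine (Finset.sum_le_sum h1).trans
      (Finset.sum_le_sum_of_subset_of_nonneg Finset.sdiff_subset fun τ _ _ => ?_)
    split_ifs <;> positivity
  have c2 : ((meet (cover s) 2).card : ℝ) ≤ 81 * n := by
    have := card_meet_two (cover s)
    have h3 : (meet (cover s) 2).card ≤ 81 * Fintype.card V := this.trans
      (Nat.mul_le_mul_right _ (by nlinarith))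
    rw [hn]; exact_mod_cast h3
  have c3 : ((meet (cover s) 3).card : ℝ) ≤ 729 := by
    have := card_meet_three (cover s)
    have h3 : (meet (cover s) 3).card ≤ 729 := this.trans
      ((Nat.pow_le_pow_left hW 3).trans (by norm_num))
    exact_mod_cast h3
  rw [Finset.sum_add_distrib, Finset.sum_add_distrib, ← Finset.sum_filter, ← Finset.sum_filter,
    Finset.sum_const, Finset.sum_const, Finset.sum_const, nsmul_eq_mul, nsmul_eq_mul,
    nsmul_eq_mul] at h2
  refine h2.trans ?_
  change ((triples V).card : ℝ) * _ + ((meet (cover s) 2).card : ℝ) * _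
    + ((meet (cover s) 3).card : ℝ) * _ ≤ _
  have hd := R.large'
  have hdn : (d:ℝ) ^ 2 ≤ n := by
    refine le_trans ?_ R.pow_le'
    exact pow_le_pow_right₀ (by linarith) (by norm_num)
  have t1 : ((triples V).card : ℝ) * ((3 * d / n) ^ 3 * e) ≤ n ^ 3 / 6 * ((3 * d / n) ^ 3 * e) :=
    mul_le_mul_of_nonneg_right card_triples_le (by positivity)
  have t2 : ((meet (cover s) 2).card : ℝ) * ((3 * d / n) ^ 2 * e)
      ≤ 81 * n * ((3 * d / n) ^ 2 * e) := mul_le_mul_of_nonneg_right c2 (by positivity)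
  have t3 : ((meet (cover s) 3).card : ℝ) * e ≤ 729 * e := mul_le_mul_of_nonneg_right c3 he0
  have e1 : n ^ 3 / 6 * ((3 * d / n) ^ 3 * e) = 9 / 2 * d ^ 3 * e := by field_simp; ring
  have e2 : 81 * n * ((3 * d / n) ^ 2 * e) = 729 * (d ^ 2 / n) * e := by field_simp; ring
  have h4 : (d:ℝ) ^ 2 / n ≤ 1 := (div_le_one hn0).2 hdn
  have h5 : (10000:ℝ) ^ 3 ≤ d ^ 3 := by gcongr
  rw [e1] at t1
  rw [e2] at t2
  have h6 : 729 * ((d:ℝ) ^ 2 / n) * e ≤ 729 * 1 * e := by gcongr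
  have h7 : 1458 * e ≤ d ^ 3 * e := by gcongr; linarith
  nlinarith

/-- The triples disjoint from the cover of `s`. -/
noncomputable def freeTriples (s : Finset (Finset V)) : Finset (Finset V) :=
  Finset.powersetCard 3 (cover s)ᶜ

lemma mem_freeTriples {s : Finset (Finset V)} {τ : Finset V} :
    τ ∈ freeTriples s ↔ τ ∈ triples V ∧ Disjoint τ (cover s) := by
  rw [freeTriples, Finset.mem_powersetCard, mem_triples, and_comm, Finset.subset_compl_iff_disjoint_right]

lemma freeTriples_subset {s : Finset (Finset V)} :
    freeTriples s ⊆ triples V \ s := by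
  intro τ hτ
  rw [mem_freeTriples] at hτ
  rw [Finset.mem_sdiff]
  refine ⟨hτ.1, fun h => ?_⟩
  obtain ⟨x, hx⟩ := Finset.card_pos.1 (by rw [mem_triples.1 hτ.1]; norm_num : 0 < τ.card)
  exact Finset.disjoint_left.1 hτ.2 hx (mem_cover.2 ⟨τ, h, hx⟩)

lemma sum_extc_insert_touching_le {d : ℕ} (R : Regime V d) {s : Finset (Finset V)}
    (hs : s ⊆ triples V) (hs3 : s.card ≤ 3) (hp : PwDisj s) :
    ∑ τ ∈ (triples V \ s) \ freeTriples s, (extc d (clq (insert τ s)) : ℝ)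
      ≤ 400 * (d:ℝ) ^ 3 / Fintype.card V * extc d (clq s) := by
  set e : ℝ := ((extc d (clq s) : ℕ) : ℝ) with he
  set n : ℝ := (Fintype.card V : ℝ) with hn
  have he0 : 0 ≤ e := Nat.cast_nonneg _
  have hn1 := R.card_large
  rw [← hn] at hn1
  have hn0 : 0 < n := by linarith
  have hW : (cover s).card ≤ 9 := (card_cover_le hs).trans (by omega)
  have h1 : ∀ τ ∈ (triples V \ s) \ freeTriples s, (extc d (clq (insert τ s)) : ℝ)
      ≤ (if 1 ≤ (τ ∩ cover s).card then (3 * d / n) ^ 3 * e else 0)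
      + (if 2 ≤ (τ ∩ cover s).card then (3 * d / n) ^ 2 * e else 0) := by
    intro τ hτ
    rw [Finset.mem_sdiff, Finset.mem_sdiff, mem_freeTriples] at hτ
    have q1 : 0 ≤ (3 * d / n) ^ 3 * e := by positivity
    have c0 : 1 ≤ (τ ∩ cover s).card := by
      rw [Nat.one_le_iff_ne_zero, Ne, Finset.card_eq_zero, ← Finset.disjoint_iff_inter_eq_empty]
      tauto
    rw [if_pos c0]
    by_cases c2 : 2 ≤ (τ ∩ cover s).card
    · have := extc_insert_le_of_pwDisj R hs hs3 hp hτ.1.1 hτ.1.2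
      rw [if_pos c2]; linarith
    · have := extc_insert_le_of_inter_le_one R hs hs3 hτ.1.1 (by omega)
      rw [if_neg c2]; linarith
  have h2 : ∑ τ ∈ (triples V \ s) \ freeTriples s, (extc d (clq (insert τ s)) : ℝ)
      ≤ ∑ τ ∈ triples V, ((if 1 ≤ (τ ∩ cover s).card then (3 * d / n) ^ 3 * e else 0)
      + (if 2 ≤ (τ ∩ cover s).card then (3 * d / n) ^ 2 * e else 0)) := by
    refine (Finset.sum_le_sum h1).trans
      (Finset.sum_le_sum_of_subset_of_nonneg (Finset.sdiff_subset.trans Finset.sdiff_subset)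
        fun τ _ _ => ?_)
    split_ifs <;> positivity
  have c1 : ((meet (cover s) 1).card : ℝ) ≤ 9 * n ^ 2 := by
    have h3 : (meet (cover s) 1).card ≤ 9 * Fintype.card V ^ 2 := (card_meet_one (cover s)).trans
      (Nat.mul_le_mul_right _ hW)
    rw [hn]; exact_mod_cast h3
  have c2 : ((meet (cover s) 2).card : ℝ) ≤ 81 * n := by
    have h3 : (meet (cover s) 2).card ≤ 81 * Fintype.card V := (card_meet_two (cover s)).trans
      (Nat.mul_le_mul_right _ (by nlinarith))
    rw [hn]; exact_mod_cast h3
  rw [Finset.sum_add_distrib, ← Finset.sum_filter, ← Finset.sum_filter,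
    Finset.sum_const, Finset.sum_const, nsmul_eq_mul, nsmul_eq_mul] at h2
  refine h2.trans ?_
  change ((meet (cover s) 1).card : ℝ) * _ + ((meet (cover s) 2).card : ℝ) * _ ≤ _
  have hd := R.large'
  have t1 : ((meet (cover s) 1).card : ℝ) * ((3 * d / n) ^ 3 * e)
      ≤ 9 * n ^ 2 * ((3 * d / n) ^ 3 * e) := mul_le_mul_of_nonneg_right c1 (by positivity)
  have t2 : ((meet (cover s) 2).card : ℝ) * ((3 * d / n) ^ 2 * e)
      ≤ 81 * n * ((3 * d / n) ^ 2 * e) := mul_le_mul_of_nonneg_right c2 (by positivity)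
  have e1 : 9 * n ^ 2 * ((3 * d / n) ^ 3 * e) = 243 * (d ^ 3 / n * e) := by field_simp; ring
  have e2 : 81 * n * ((3 * d / n) ^ 2 * e) = 729 * (d ^ 2 / n * e) := by field_simp; ring
  have e3 : 400 * (d:ℝ) ^ 3 / n * e = 400 * (d ^ 3 / n * e) := by ring
  have h5 : 10 * ((d:ℝ) ^ 2 / n * e) ≤ d ^ 3 / n * e := by
    have : 10 * ((d:ℝ) ^ 2 / n * e) = 10 * d ^ 2 / n * e := by ring
    rw [this]
    gcongr
    nlinarith [sq_nonneg (d:ℝ)]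
  rw [e1] at t1
  rw [e2] at t2
  rw [e3]
  have h8 : 0 ≤ (d:ℝ) ^ 2 / n * e := by positivity
  linarith

end TriangleSums

section TriangleMoments

set_option linter.unusedSectionVars false

variable {V : Type*} [Fintype V] [DecidableEq V]

/-- The asymptotic mean number of triangles. -/
noncomputable def triMean (d : ℕ) : ℝ := ((d : ℝ) - 1) ^ 3 / 6

lemma Regime.ee_mul_card {d : ℕ} (R : Regime V d) : (10:ℝ) ^ 17 * d ^ 4 ≤ ee d * Fintype.card V := by
  have h1 := R.pow_le'
  have h2 := R.large'
  unfold ee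
  rw [div_mul_eq_mul_div, le_div_iff₀ (by positivity)]
  calc (10:ℝ) ^ 17 * d ^ 4 * d ^ 6 = 10 ^ 17 * d ^ 10 := by ring
    _ ≤ _ := by gcongr

lemma free_upper_aux {q N : ℝ} (hq0 : 0 ≤ q) (hq1 : q ≤ 1 / 1000000) (hN : 10 ^ 10 ≤ q * N)
    (hN0 : 0 < N) : N ^ 3 * (1 + q) ^ 3 ≤ (1 + 4 * q) * (N - 23) ^ 3 := by
  have h1 : N * (1 - q / 1000) ≤ N - 23 := by nlinarith
  have h2 : (0:ℝ) ≤ 1 - q / 1000 := by linarith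
  have h3 : (1 + q) ^ 3 ≤ (1 + 4 * q) * (1 - q / 1000) ^ 3 := by
    have e1 : 1 - 3 * (q / 1000) ≤ (1 - q / 1000) ^ 3 := by
      nlinarith [mul_nonneg hq0 hq0, mul_nonneg (mul_nonneg hq0 hq0) h2]
    have e2 : (1 + q) ^ 3 ≤ (1 + 4 * q) * (1 - 3 * (q / 1000)) := by
      nlinarith [mul_nonneg hq0 hq0, mul_nonneg (mul_nonneg hq0 hq0) hq0,
        mul_le_mul_of_nonneg_left hq1 hq0, mul_le_mul_of_nonneg_left hq1 (mul_nonneg hq0 hq0)]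
    refine e2.trans ?_
    gcongr
  calc N ^ 3 * (1 + q) ^ 3 ≤ N ^ 3 * ((1 + 4 * q) * (1 - q / 1000) ^ 3) := by gcongr
    _ = (1 + 4 * q) * (N * (1 - q / 1000)) ^ 3 := by ring
    _ ≤ _ := by gcongr

lemma prod_three_le {a b c a' b' c' : ℝ} (ha : 0 ≤ a) (hb : 0 ≤ b) (hc : 0 ≤ c) (ha' : a ≤ a')
    (hb' : b ≤ b') (hc' : c ≤ c') : a * b * c ≤ a' * b' * c' := by
  exact mul_le_mul (mul_le_mul ha' hb' hb (ha.trans ha')) hc' hc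
    (mul_nonneg (ha.trans ha') (hb.trans hb'))

lemma extc_insert_free {d : ℕ} (R : Regime V d) {s : Finset (Finset V)}
    (hs : s ⊆ triples V) (hs3 : s.card ≤ 3) {τ : Finset V} (hτ : τ ∈ freeTriples s) :
    (1 - 3 * ee d) * ((((d:ℝ) - 1) / Fintype.card V) ^ 3 * extc d (clq s))
      ≤ extc d (clq (insert τ s)) ∧
    (extc d (clq (insert τ s)) : ℝ)
      ≤ (1 + 4 * ee d) * ((((d:ℝ) - 1) / Fintype.card V) ^ 3 * extc d (clq s)) := by
  rw [mem_freeTriples] at hτ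
  obtain ⟨hτ, hfree⟩ := hτ
  rw [Finset.disjoint_left] at hfree
  obtain ⟨x, y, z, hxy, hxz, hyz, rfl⟩ := Finset.card_eq_three.1 (mem_triples.1 hτ)
  have hx : x ∉ cover s := hfree (by simp)
  have hy : y ∉ cover s := hfree (by simp)
  have hz : z ∉ cover s := hfree (by simp)
  have hsum := sum_dg_clq_le hs
  have hsum' : ∑ v, dg (clq s) v ≤ 18 := by omega
  have hlarge := R.large
  have hres : ∀ v, v ∉ cover s → resid d (clq s) v = d := fun v hv => by
    unfold resid; rw [dg_clq_eq_zero hv, Nat.sub_zero]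
  have hdg : ∀ v, dg (clq s) v + 2 ≤ d := fun v => by
    have := Finset.single_le_sum (f := dg (clq s)) (fun _ _ => Nat.zero_le _) (Finset.mem_univ v)
    omega
  have hDl := R.small_degSum (b := 18) (by norm_num) hsum'
  have hDu : degSum (resid d (clq s)) ≤ Fintype.card V * d := by
    rw [degSum_resid (fun v => by have := hdg v; omega)]
    have : (0:ℝ) ≤ ∑ v, (dg (clq s) v : ℝ) := Finset.sum_nonneg fun _ _ => Nat.cast_nonneg _
    linarith
  have hd := R.large'
  have h11 : (10:ℝ) ^ 40 ≤ (d:ℝ) ^ 11 := by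
    calc (10:ℝ) ^ 40 ≤ 10000 ^ 11 := by norm_num
    _ ≤ (d:ℝ) ^ 11 := by gcongr
  have hN1 := R.pow_succ_le
  push_cast at hDl
  obtain ⟨l, u⟩ := extc_tri R.large R.even hxy hxz hyz (not_clq_adj_left hx) (not_clq_adj_left hx)
    (not_clq_adj_left hy) hdg (hres x hx) (hres y hy) (hres z hz) (by linarith)
  rw [← clq_insert_triple s hxy hxz hyz, Nat.cast_sub (by omega : 1 ≤ d)] at l u
  push_cast at l u
  have hq0 := ee_nonneg d
  have hq1 := ee_small R.large
  have hqn := R.ee_mul_card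
  have hn : (0:ℝ) < Fintype.card V := by have := R.card_large; linarith
  have hE : (0:ℝ) ≤ extc d (clq (insert {x, y, z} s)) := Nat.cast_nonneg _
  have he : (0:ℝ) ≤ extc d (clq s) := Nat.cast_nonneg _
  clear hres hdg hfree hτ hsum hsum'
  generalize (extc d (clq (insert {x, y, z} s)) : ℝ) = E at *
  generalize (extc d (clq s) : ℝ) = e at *
  generalize degSum (resid d (clq s)) = D at *
  generalize (Fintype.card V : ℝ) = n at *
  generalize ee d = q at *
  have hd' : (10000:ℝ) ≤ d := hd
  generalize (d:ℝ) = r at *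
  have hnr : (10:ℝ) ^ 40 ≤ n * r := h11.trans hN1
  have hr : 0 < r := by linarith
  have hr1 : 0 < r - 1 := by linarith
  have hq3 : 1 - 3 * q ≤ (1 - q) ^ 3 := by
    nlinarith [mul_nonneg hq0 hq0, mul_nonneg (mul_nonneg hq0 hq0) hq0,
        mul_le_mul_of_nonneg_left hq1 hq0, mul_le_mul_of_nonneg_left hq1 (mul_nonneg hq0 hq0)]
  have e1 : ∀ c : ℝ, c * ((r * (r - 1)) * (r * (r - 1)) * (r * (r - 1)) * e)
      = c * (((r - 1) / n) ^ 3 * e) * (n * r) ^ 3 := by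
    intro c; field_simp
  have hnr3 : 0 < (n * r) ^ 3 := by positivity
  have p1 : 0 ≤ D - 1 := by linarith
  have p3 : 0 ≤ D - 3 := by linarith
  have p5 : 0 ≤ D - 5 := by linarith
  constructor
  · refine le_of_mul_le_mul_right ?_ hnr3
    calc (1 - 3 * q) * (((r - 1) / n) ^ 3 * e) * (n * r) ^ 3
        ≤ (1 - q) ^ 3 * (((r - 1) / n) ^ 3 * e) * (n * r) ^ 3 := by gcongr
      _ ≤ E * ((D - 1) * (D - 3) * (D - 5)) := by rw [← e1]; exact l
      _ ≤ E * (n * r * (n * r) * (n * r)) := by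
          refine mul_le_mul_of_nonneg_left (prod_three_le p1 p3 p5 ?_ ?_ ?_) hE <;> linarith
      _ = _ := by ring
  · have hqN : 10 ^ 10 ≤ q * (n * r) := by
      have : (1:ℝ) ≤ r ^ 4 := one_le_pow₀ (by linarith)
      have h1 : 10 ^ 17 ≤ q * n := by nlinarith
      nlinarith
    have hf := free_upper_aux hq0 hq1 hqN (by positivity)
    have h23 : 0 < n * r - 23 := by linarith
    have hp : 0 < (n * r - 23) ^ 3 := by positivity
    refine le_of_mul_le_mul_right ?_ hp
    calc E * (n * r - 23) ^ 3 = E * ((n * r - 23) * (n * r - 23) * (n * r - 23)) := by ring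
      _ ≤ E * ((D - 1) * (D - 3) * (D - 5)) := by
          refine mul_le_mul_of_nonneg_left
            (prod_three_le h23.le h23.le h23.le ?_ ?_ ?_) hE <;> linarith
      _ ≤ (1 + q) ^ 3 * (((r - 1) / n) ^ 3 * e) * (n * r) ^ 3 := by rw [← e1]; exact u
      _ = (((r - 1) / n) ^ 3 * e) * ((n * r) ^ 3 * (1 + q) ^ 3) := by ring
      _ ≤ (((r - 1) / n) ^ 3 * e) * ((1 + 4 * q) * (n * r - 23) ^ 3) := by gcongr
      _ = _ := by ring

lemma card_freeTriples {d : ℕ} (R : Regime V d) {s : Finset (Finset V)}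
    (hs : s ⊆ triples V) (hs3 : s.card ≤ 3) :
    (1 - ee d / 1000) * ((Fintype.card V : ℝ) ^ 3 / 6) ≤ (freeTriples s).card ∧
    ((freeTriples s).card : ℝ) ≤ (Fintype.card V : ℝ) ^ 3 / 6 := by
  have hW : (cover s).card ≤ 9 := (card_cover_le hs).trans (by omega)
  constructor
  · rw [freeTriples, Finset.card_powersetCard, Finset.card_compl]
    have h1 := Nat.pow_le_choose (α := ℝ) 3 (Fintype.card V - (cover s).card)
    have hn1 := R.card_large
    have hn2 : 100 ≤ Fintype.card V := by
      have : (100:ℝ) ≤ Fintype.card V := by linarith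
      exact_mod_cast this
    have h2 : Fintype.card V - 11 ≤ Fintype.card V - (cover s).card + 1 - 3 := by omega
    have h3 : ((Fintype.card V : ℝ) - 11) ≤ ((Fintype.card V - (cover s).card + 1 - 3 : ℕ) : ℝ) := by
      have : ((Fintype.card V - 11 : ℕ) : ℝ) ≤ ((Fintype.card V - (cover s).card + 1 - 3 : ℕ) : ℝ) := by
        exact_mod_cast h2
      rwa [Nat.cast_sub (by omega)] at this
    have h4 : ((Fintype.card V : ℝ) - 11) ^ 3 / 6 ≤ ((Fintype.card V - (cover s).card).choose 3 : ℕ) := by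
      refine le_trans ?_ h1
      have : (0:ℝ) ≤ (Fintype.card V : ℝ) - 11 := by linarith
      have h6 : ((Nat.factorial 3 : ℕ) : ℝ) = 6 := by norm_num [Nat.factorial]
      rw [h6]
      gcongr
    refine le_trans ?_ h4
    have hqn := R.ee_mul_card
    have hr4 : (1:ℝ) ≤ (d:ℝ) ^ 4 := one_le_pow₀ (by have := R.large'; linarith)
    generalize (Fintype.card V : ℝ) = n at *
    generalize ee d = q at *
    have h7 : 10 ^ 17 ≤ q * n := by nlinarith
    have h8 : n ^ 3 - 33 * n ^ 2 ≤ (n - 11) ^ 3 := by nlinarith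
    have h9 : 33 * n ^ 2 ≤ q / 1000 * n ^ 3 := by
      have : 33 * n ^ 2 ≤ (q * n) / 1000 * n ^ 2 := by
        gcongr; linarith
      nlinarith
    linarith
  · refine le_trans ?_ card_triples_le
    exact_mod_cast Finset.card_le_card (freeTriples_subset.trans Finset.sdiff_subset)

lemma sum_extc_insert_free {d : ℕ} (R : Regime V d) {s : Finset (Finset V)}
    (hs : s ⊆ triples V) (hs3 : s.card ≤ 3) :
    (1 - 4 * ee d) * (triMean d * extc d (clq s))
      ≤ ∑ τ ∈ freeTriples s, (extc d (clq (insert τ s)) : ℝ) ∧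
    ∑ τ ∈ freeTriples s, (extc d (clq (insert τ s)) : ℝ)
      ≤ (1 + 4 * ee d) * (triMean d * extc d (clq s)) := by
  obtain ⟨c1, c2⟩ := card_freeTriples R hs hs3
  have hn : (0:ℝ) < Fintype.card V := by have := R.card_large; linarith
  have hd := R.large'
  have he : (0:ℝ) ≤ extc d (clq s) := Nat.cast_nonneg _
  have hq0 := ee_nonneg d
  have hq1 := ee_small R.large
  have l := Finset.sum_le_sum fun τ hτ => (extc_insert_free R hs hs3 (τ := τ) hτ).1
  have u := Finset.sum_le_sum fun τ hτ => (extc_insert_free R hs hs3 (τ := τ) hτ).2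
  rw [Finset.sum_const, nsmul_eq_mul] at l u
  unfold triMean
  have hr1 : (0:ℝ) < (d:ℝ) - 1 := by linarith
  generalize ((freeTriples s).card : ℝ) = c at *
  generalize (Fintype.card V : ℝ) = n at *
  generalize (extc d (clq s) : ℝ) = e at *
  generalize ee d = q at *
  generalize (d:ℝ) - 1 = t at *
  have key : n ^ 3 / 6 * ((t / n) ^ 3 * e) = t ^ 3 / 6 * e := by field_simp
  have hp : 0 ≤ t ^ 3 / 6 * e := by positivity
  constructor
  · refine le_trans ?_ l
    calc (1 - 4 * q) * (t ^ 3 / 6 * e) ≤ ((1 - q / 1000) * (1 - 3 * q)) * (t ^ 3 / 6 * e) := by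
          apply mul_le_mul_of_nonneg_right _ hp
          nlinarith
      _ = (1 - q / 1000) * (n ^ 3 / 6) * ((1 - 3 * q) * ((t / n) ^ 3 * e)) := by rw [← key]; ring
      _ ≤ _ := by
          apply mul_le_mul_of_nonneg_right c1
          have : 0 ≤ 1 - 3 * q := by linarith
          positivity
  · refine u.trans ?_
    calc c * ((1 + 4 * q) * ((t / n) ^ 3 * e)) ≤ n ^ 3 / 6 * ((1 + 4 * q) * ((t / n) ^ 3 * e)) := by
          gcongr
      _ = _ := by rw [← key]; ring

open scoped Classical in
/-- The number of triangles. -/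
noncomputable def triCount (G : SimpleGraph V) : ℕ :=
  ((triples V).filter fun τ => clq {τ} ≤ G).card

open scoped Classical in
/-- Sum of falling factorials of the number of further triangles over the graphs containing
`clq s`. -/
noncomputable def mom (d p : ℕ) (s : Finset (Finset V)) : ℕ :=
  ∑ G ∈ (regs V d).filter (fun G => clq s ≤ G), (triCount G - s.card).descFactorial p

lemma mom_zero (d : ℕ) (s : Finset (Finset V)) : mom d 0 s = extc d (clq s) := by
  simp [mom, extc]

lemma mom_succ (d p : ℕ) {s : Finset (Finset V)} (hs : s ⊆ triples V) :
    mom d (p + 1) s = ∑ τ ∈ triples V \ s, mom d p (insert τ s) := by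
  classical
  unfold mom
  simp only [Finset.sum_filter]
  rw [Finset.sum_comm]
  refine Finset.sum_congr rfl fun G _ => ?_
  have h1 : ∀ τ ∈ triples V \ s, (if clq (insert τ s) ≤ G then
      (triCount G - (insert τ s).card).descFactorial p else 0)
      = if clq s ≤ G ∧ clq {τ} ≤ G then (triCount G - s.card - 1).descFactorial p else 0 := by
    intro τ hτ
    rw [Finset.mem_sdiff] at hτ
    rw [clq_insert, sup_le_iff, Finset.card_insert_of_notMem hτ.2, Nat.sub_sub]
    congr
  rw [Finset.sum_congr rfl h1]
  by_cases hG : clq s ≤ G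
  · simp only [hG, true_and, if_true]
    rw [← Finset.sum_filter, Finset.sum_const, smul_eq_mul]
    have h2 : ((triples V \ s).filter fun τ => clq {τ} ≤ G).card = triCount G - s.card := by
      have h3 : (triples V \ s).filter (fun τ => clq {τ} ≤ G)
          = ((triples V).filter fun τ => clq {τ} ≤ G) \ s := by
        ext τ; simp only [Finset.mem_filter, Finset.mem_sdiff]; tauto
      rw [h3, Finset.card_sdiff_of_subset]
      · rfl
      · intro τ hτ
        exact Finset.mem_filter.2 ⟨hs hτ, clq_le_iff.1 hG τ hτ⟩
    rw [h2]
    rcases h : triCount G - s.card with _ | k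
    · simp
    · rw [Nat.succ_descFactorial_succ, Nat.add_sub_cancel]
  · simp [hG]

end TriangleMoments

section TriangleConcentration

set_option linter.unusedSectionVars false

variable {V : Type*} [Fintype V] [DecidableEq V]

lemma mom_le {d : ℕ} (R : Regime V d) (p : ℕ) : ∀ {s : Finset (Finset V)}, s ⊆ triples V →
    s.card + p ≤ 4 → (mom d p s : ℝ) ≤ (10 * (d:ℝ) ^ 3) ^ p * extc d (clq s) := by
  induction p with
  | zero => intro s _ _; rw [mom_zero]; simp
  | succ p ih =>
    intro s hs hsp
    rw [mom_succ d p hs]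
    push_cast
    calc ∑ τ ∈ triples V \ s, (mom d p (insert τ s) : ℝ)
        ≤ ∑ τ ∈ triples V \ s, (10 * (d:ℝ) ^ 3) ^ p * (extc d (clq (insert τ s)) : ℝ) := by
          refine Finset.sum_le_sum fun τ hτ => ?_
          rw [Finset.mem_sdiff] at hτ
          refine ih (Finset.insert_subset hτ.1 hs) ?_
          rw [Finset.card_insert_of_notMem hτ.2]; omega
      _ = (10 * (d:ℝ) ^ 3) ^ p * ∑ τ ∈ triples V \ s, (extc d (clq (insert τ s)) : ℝ) := by
          rw [Finset.mul_sum]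
      _ ≤ (10 * (d:ℝ) ^ 3) ^ p * (10 * (d:ℝ) ^ 3 * extc d (clq s)) := by
          have := sum_extc_insert_le R hs (by omega)
          gcongr
      _ = _ := by ring

lemma triMean_ge {d : ℕ} (hd : 10000 ≤ d) : (d:ℝ) ^ 3 / 7 ≤ triMean d := by
  have h : (10000:ℝ) ≤ d := by exact_mod_cast hd
  unfold triMean
  have h1 : (d:ℝ) * (19 / 20) ≤ d - 1 := by linarith
  have h2 : ((d:ℝ) * (19 / 20)) ^ 3 ≤ (d - 1) ^ 3 := by gcongr
  have h3 : (0:ℝ) ≤ (d:ℝ) ^ 3 := by positivity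
  nlinarith

lemma triMean_nonneg {d : ℕ} (hd : 10000 ≤ d) : 0 ≤ triMean d :=
  le_trans (by positivity) (triMean_ge hd)

lemma triMean_le {d : ℕ} (hd : 10000 ≤ d) : triMean d ≤ (d:ℝ) ^ 3 / 6 := by
  have h : (10000:ℝ) ≤ d := by exact_mod_cast hd
  unfold triMean
  have : (0:ℝ) ≤ d - 1 := by linarith
  gcongr
  linarith

lemma touching_error_le {d : ℕ} (R : Regime V d) {p : ℕ} (hp : p ≤ 3) :
    (10 * (d:ℝ) ^ 3) ^ p * (400 * (d:ℝ) ^ 3 / Fintype.card V)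
      ≤ ee d / 2 * triMean d ^ (p + 1) := by
  have h1 := triMean_ge R.large
  have h0 := triMean_nonneg R.large
  have h2 := R.ee_mul_card
  have h4 : (1:ℝ) ≤ (d:ℝ) ^ 4 := one_le_pow₀ (by have := R.large'; linarith)
  have hn : (0:ℝ) < Fintype.card V := by have := R.card_large; linarith
  have hq := ee_nonneg d
  generalize (Fintype.card V : ℝ) = n at *
  generalize triMean d = l at *
  generalize ee d = q at *
  have h5 : 10 ^ 17 ≤ q * n := by nlinarith
  have h6 : (10 * (d:ℝ) ^ 3) ^ p ≤ 343000 * l ^ p := by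
    calc (10 * (d:ℝ) ^ 3) ^ p ≤ (70 * l) ^ p := by
          apply pow_le_pow_left₀ (by positivity); linarith
      _ = 70 ^ p * l ^ p := mul_pow _ _ _
      _ ≤ 70 ^ 3 * l ^ p := by
          gcongr; norm_num
      _ = _ := by norm_num
  have h7 : 400 * (d:ℝ) ^ 3 / n ≤ 2800 * l / n :=
    div_le_div_of_nonneg_right (by linarith) hn.le
  calc (10 * (d:ℝ) ^ 3) ^ p * (400 * (d:ℝ) ^ 3 / n)
      ≤ (343000 * l ^ p) * (2800 * l / n) := by gcongr
    _ = 960400000 / n * l ^ (p + 1) := by ring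
    _ ≤ _ := by
      refine mul_le_mul_of_nonneg_right ?_ (pow_nonneg h0 _)
      rw [div_le_iff₀ hn]; linarith

lemma mom_step_aux {q l lp e S A B k : ℝ} (hq0 : 0 ≤ q) (hq1 : q ≤ 1 / 1000000) (hl : 0 ≤ l)
    (hlp : 0 ≤ lp) (he : 0 ≤ e) (hk0 : 0 ≤ k) (hk : k ≤ 3)
    (h1 : (1 - 4 * q) * (l * e) ≤ S) (h2 : S ≤ (1 + 4 * q) * (l * e))
    (h3 : |A - lp * S| ≤ 6 * k * q * (lp * S)) (h4 : 0 ≤ B) (h5 : B ≤ q / 2 * (lp * l) * e) :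
    |A + B - lp * l * e| ≤ 6 * (k + 1) * q * (lp * l * e) := by
  have hx : 0 ≤ lp * l * e := by positivity
  have g1 : lp * S ≤ (1 + 4 * q) * (lp * l * e) := by
    have := mul_le_mul_of_nonneg_left h2 hlp; linarith
  have g2 : (1 - 4 * q) * (lp * l * e) ≤ lp * S := by
    have := mul_le_mul_of_nonneg_left h1 hlp; linarith
  have g3 : 6 * k * q * (lp * S) ≤ (6 * k + 1) * q * (lp * l * e) := by
    have e1 : 6 * k * q * (lp * S) ≤ 6 * k * q * ((1 + 4 * q) * (lp * l * e)) := by gcongr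
    have e2 : 6 * k * (1 + 4 * q) ≤ 6 * k + 1 := by nlinarith
    have e3 : 6 * k * (1 + 4 * q) * (q * (lp * l * e)) ≤ (6 * k + 1) * (q * (lp * l * e)) := by
      gcongr
    linarith
  have h3' := h3.trans g3
  have h5' : B ≤ q / 2 * (lp * l * e) := by linarith
  rw [abs_le] at h3' ⊢
  generalize lp * S = Y at *
  generalize lp * l * e = X at *
  have hqx : 0 ≤ q * X := mul_nonneg hq0 hx
  constructor <;> linarith

lemma mom_near {d : ℕ} (R : Regime V d) (p : ℕ) : ∀ {s : Finset (Finset V)}, s ⊆ triples V →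
    PwDisj s → s.card + p ≤ 4 →
    |(mom d p s : ℝ) - triMean d ^ p * extc d (clq s)|
      ≤ 6 * p * ee d * (triMean d ^ p * extc d (clq s)) := by
  induction p with
  | zero => intro s _ _ _; rw [mom_zero]; simp
  | succ p ih =>
    intro s hs hps hsp
    have hl := triMean_nonneg R.large
    have hcard : ∀ τ ∈ triples V \ s, (insert τ s).card + p ≤ 4 := fun τ hτ => by
      rw [Finset.card_insert_of_notMem (Finset.mem_sdiff.1 hτ).2]; omega
    rw [mom_succ d p hs]
    push_cast
    rw [← Finset.sum_sdiff freeTriples_subset, add_comm]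
    obtain ⟨f1, f2⟩ := sum_extc_insert_free R hs (by omega)
    rw [pow_succ]
    refine mom_step_aux (ee_nonneg d) (ee_small R.large) hl (pow_nonneg hl p) (Nat.cast_nonneg _)
      (Nat.cast_nonneg p) (by exact_mod_cast (by omega : p ≤ 3)) f1 f2 ?_
      (Finset.sum_nonneg fun _ _ => Nat.cast_nonneg _) ?_
    · rw [Finset.mul_sum, ← Finset.sum_sub_distrib]
      refine (Finset.abs_sum_le_sum_abs _ _).trans ?_
      rw [Finset.mul_sum]
      refine Finset.sum_le_sum fun τ hτ => ?_
      have hτ' := freeTriples_subset hτ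
      exact ih (Finset.insert_subset (Finset.mem_sdiff.1 hτ').1 hs)
        (hps.insert (mem_freeTriples.1 hτ).2) (hcard τ hτ')
    · calc ∑ τ ∈ (triples V \ s) \ freeTriples s, (mom d p (insert τ s) : ℝ)
          ≤ ∑ τ ∈ (triples V \ s) \ freeTriples s,
            (10 * (d:ℝ) ^ 3) ^ p * (extc d (clq (insert τ s)) : ℝ) := by
            refine Finset.sum_le_sum fun τ hτ => ?_
            have hτ' := (Finset.mem_sdiff.1 hτ).1
            exact mom_le R p (Finset.insert_subset (Finset.mem_sdiff.1 hτ').1 hs) (hcard τ hτ')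
        _ = (10 * (d:ℝ) ^ 3) ^ p * ∑ τ ∈ (triples V \ s) \ freeTriples s,
            (extc d (clq (insert τ s)) : ℝ) := by rw [Finset.mul_sum]
        _ ≤ (10 * (d:ℝ) ^ 3) ^ p * (400 * (d:ℝ) ^ 3 / Fintype.card V * extc d (clq s)) := by
            have := sum_extc_insert_touching_le R hs (by omega) hps
            gcongr
        _ = (10 * (d:ℝ) ^ 3) ^ p * (400 * (d:ℝ) ^ 3 / Fintype.card V) * extc d (clq s) := by ring
        _ ≤ _ := by
            have := touching_error_le R (p := p) (by omega)
            rw [pow_succ (triMean d)] at this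
            exact mul_le_mul_of_nonneg_right this (Nat.cast_nonneg _)

lemma cast_descFactorial_succ (n k : ℕ) :
    (n.descFactorial (k + 1) : ℝ) = n.descFactorial k * ((n:ℝ) - k) := by
  rw [← descPochhammer_eval_eq_descFactorial ℝ n (k + 1), descPochhammer_succ_eval,
    descPochhammer_eval_eq_descFactorial]

lemma sum_descFactorial_near {d : ℕ} (R : Regime V d) {p : ℕ} (hp : p ≤ 4) :
    |∑ G ∈ regs V d, ((triCount G).descFactorial p : ℝ) - triMean d ^ p * (regs V d).card|
      ≤ 24 * ee d * (triMean d ^ p * (regs V d).card) := by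
  have h := mom_near R p (s := ∅) (Finset.empty_subset _) (by intro ρ hρ; simp at hρ) (by simpa)
  have h1 : (mom d p (∅ : Finset (Finset V)) : ℝ)
      = ∑ G ∈ regs V d, ((triCount G).descFactorial p : ℝ) := by
    simp [mom, clq_empty]
  have h2 : extc d (clq (∅ : Finset (Finset V))) = (regs V d).card := by
    simp [extc, clq_empty]
  rw [h1, h2] at h
  refine h.trans ?_
  have := triMean_nonneg R.large
  have := ee_nonneg d
  have h4 : (p:ℝ) ≤ 4 := by exact_mod_cast hp
  gcongr
  linarith

lemma ee_mul_pow (d : ℕ) (hd : 10000 ≤ d) : ee d * (d:ℝ) ^ 6 = 10 ^ 17 := by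
  have : (d:ℝ) ≠ 0 := by
    have : 0 < d := by omega
    positivity
  unfold ee
  field_simp

lemma sum_triCount_near {d : ℕ} (R : Regime V d) :
    |∑ G ∈ regs V d, (triCount G : ℝ) - triMean d * (regs V d).card|
      ≤ 24 * ee d * (triMean d * (regs V d).card) := by
  have := sum_descFactorial_near R (p := 1) (by norm_num)
  simpa using this

lemma sum_triCount_sq_le {d : ℕ} (R : Regime V d) :
    ∑ G ∈ regs V d, ((triCount G : ℝ) - triMean d) ^ 2
      ≤ (triMean d + 10 ^ 18) * (regs V d).card := by
  have m1 := sum_descFactorial_near R (p := 1) (by norm_num)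
  have m2 := sum_descFactorial_near R (p := 2) (by norm_num)
  have e1 : ∑ G ∈ regs V d, ((triCount G : ℝ) - triMean d) ^ 2
      = ∑ G ∈ regs V d, ((triCount G).descFactorial 2 : ℝ)
        + (1 - 2 * triMean d) * ∑ G ∈ regs V d, ((triCount G).descFactorial 1 : ℝ)
        + triMean d ^ 2 * (regs V d).card := by
    rw [← nsmul_eq_mul' (triMean d ^ 2), ← Finset.sum_const, Finset.mul_sum,
      ← Finset.sum_add_distrib, ← Finset.sum_add_distrib]
    refine Finset.sum_congr rfl fun G _ => ?_
    simp only [cast_descFactorial_succ, Nat.descFactorial_zero]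
    push_cast; ring
  rw [e1]
  have hl := triMean_nonneg R.large
  have hl1 := triMean_ge R.large
  have hl2 := triMean_le R.large
  have hq := ee_nonneg d
  have hqd := ee_mul_pow d R.large
  have hN : (0:ℝ) ≤ (regs V d).card := Nat.cast_nonneg _
  have hd := R.large'
  have hl3 : 1 ≤ triMean d := by
    have : (10000:ℝ) ^ 3 ≤ d ^ 3 := by gcongr
    linarith
  have hql : ee d * triMean d ^ 2 ≤ 10 ^ 17 / 36 := by
    calc ee d * triMean d ^ 2 ≤ ee d * (d ^ 3 / 6) ^ 2 := by gcongr
      _ = ee d * d ^ 6 / 36 := by ring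
      _ = _ := by rw [hqd]
  generalize (∑ G ∈ regs V d, ((triCount G).descFactorial 2 : ℝ)) = M2 at *
  generalize (∑ G ∈ regs V d, ((triCount G).descFactorial 1 : ℝ)) = M1 at *
  generalize ((regs V d).card : ℝ) = N at *
  generalize triMean d = l at *
  generalize ee d = q at *
  rw [abs_le] at m1 m2
  have h1 : (1 - 2 * l) * (M1 - l * N) ≤ (2 * l - 1) * (24 * q * (l * N)) := by
    rw [pow_one] at m1
    nlinarith [m1.1]
  have h2 : q * l ^ 2 * N ≤ 10 ^ 17 / 36 * N := by gcongr
  have h3 : 0 ≤ q * l * N := by positivity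
  nlinarith [m2.2]

lemma sum_triCount_fourth_le {d : ℕ} (R : Regime V d) :
    ∑ G ∈ regs V d, ((triCount G : ℝ) - triMean d) ^ 4
      ≤ 10 ^ 19 * (d:ℝ) ^ 6 * (regs V d).card := by
  have m1 := sum_descFactorial_near R (p := 1) (by norm_num)
  have m2 := sum_descFactorial_near R (p := 2) (by norm_num)
  have m3 := sum_descFactorial_near R (p := 3) (by norm_num)
  have m4 := sum_descFactorial_near R (p := 4) (by norm_num)
  have e1 : ∑ G ∈ regs V d, ((triCount G : ℝ) - triMean d) ^ 4
      = ∑ G ∈ regs V d, ((triCount G).descFactorial 4 : ℝ)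
        + (6 - 4 * triMean d) * ∑ G ∈ regs V d, ((triCount G).descFactorial 3 : ℝ)
        + (7 - 12 * triMean d + 6 * triMean d ^ 2)
          * ∑ G ∈ regs V d, ((triCount G).descFactorial 2 : ℝ)
        + (1 - 4 * triMean d + 6 * triMean d ^ 2 - 4 * triMean d ^ 3)
          * ∑ G ∈ regs V d, ((triCount G).descFactorial 1 : ℝ)
        + triMean d ^ 4 * (regs V d).card := by
    rw [← nsmul_eq_mul' (triMean d ^ 4), ← Finset.sum_const, Finset.mul_sum, Finset.mul_sum,
      Finset.mul_sum, ← Finset.sum_add_distrib, ← Finset.sum_add_distrib,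
      ← Finset.sum_add_distrib, ← Finset.sum_add_distrib]
    refine Finset.sum_congr rfl fun G _ => ?_
    simp only [cast_descFactorial_succ, Nat.descFactorial_zero]
    push_cast; ring
  rw [e1]
  have hl := triMean_nonneg R.large
  have hl1 := triMean_ge R.large
  have hl2 := triMean_le R.large
  have hq := ee_nonneg d
  have hqd := ee_mul_pow d R.large
  have hN : (0:ℝ) ≤ (regs V d).card := Nat.cast_nonneg _
  have hd := R.large'
  have hl3 : 1000 ≤ triMean d := by
    have : (10000:ℝ) ^ 3 ≤ d ^ 3 := by gcongr
    linarith
  have hl22 : triMean d ^ 2 ≤ d ^ 6 / 36 := by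
    calc triMean d ^ 2 ≤ (d ^ 3 / 6) ^ 2 := by gcongr
      _ = _ := by ring
  have hql : ee d * triMean d ^ 4 ≤ 10 ^ 17 / 1296 * d ^ 6 := by
    calc ee d * triMean d ^ 4 ≤ ee d * (d ^ 3 / 6) ^ 4 := by gcongr
      _ = ee d * d ^ 6 / 1296 * d ^ 6 := by ring
      _ = _ := by rw [hqd]
  generalize (∑ G ∈ regs V d, ((triCount G).descFactorial 4 : ℝ)) = M4 at *
  generalize (∑ G ∈ regs V d, ((triCount G).descFactorial 3 : ℝ)) = M3 at *
  generalize (∑ G ∈ regs V d, ((triCount G).descFactorial 2 : ℝ)) = M2 at *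
  generalize (∑ G ∈ regs V d, ((triCount G).descFactorial 1 : ℝ)) = M1 at *
  generalize ((regs V d).card : ℝ) = N at *
  generalize (d:ℝ) ^ 6 = D at *
  generalize triMean d = l at *
  generalize ee d = q at *
  rw [abs_le] at m1 m2 m3 m4
  rw [pow_one] at m1
  have hl2' : 1000 * l ≤ l ^ 2 := by nlinarith
  have hl3' : 1000 * l ^ 2 ≤ l ^ 3 := by nlinarith [sq_nonneg l]
  have hl4' : 1000 * l ^ 3 ≤ l ^ 4 := by nlinarith [pow_nonneg hl 3]
  have a3 : (6 - 4 * l) * (M3 - l ^ 3 * N) ≤ (4 * l) * (24 * q * (l ^ 3 * N)) := by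
    have z : 0 ≤ 24 * q * (l ^ 3 * N) := by positivity
    nlinarith [m3.1]
  have a2 : (7 - 12 * l + 6 * l ^ 2) * (M2 - l ^ 2 * N) ≤ (6 * l ^ 2) * (24 * q * (l ^ 2 * N)) := by
    have z : 0 ≤ 24 * q * (l ^ 2 * N) := by positivity
    have z1 : 0 ≤ 7 - 12 * l + 6 * l ^ 2 := by nlinarith
    calc _ ≤ (7 - 12 * l + 6 * l ^ 2) * (24 * q * (l ^ 2 * N)) :=
          mul_le_mul_of_nonneg_left m2.2 z1
      _ ≤ _ := mul_le_mul_of_nonneg_right (by linarith) z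
  have a1 : (1 - 4 * l + 6 * l ^ 2 - 4 * l ^ 3) * (M1 - l * N)
      ≤ (4 * l ^ 3) * (24 * q * (l * N)) := by
    have z : 0 ≤ 24 * q * (l * N) := by positivity
    have z1 : 0 ≤ -(1 - 4 * l + 6 * l ^ 2 - 4 * l ^ 3) := by nlinarith
    calc (1 - 4 * l + 6 * l ^ 2 - 4 * l ^ 3) * (M1 - l * N)
        = -(1 - 4 * l + 6 * l ^ 2 - 4 * l ^ 3) * (-(M1 - l * N)) := by ring
      _ ≤ -(1 - 4 * l + 6 * l ^ 2 - 4 * l ^ 3) * (24 * q * (l * N)) :=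
          mul_le_mul_of_nonneg_left (by linarith [m1.1]) z1
      _ ≤ _ := mul_le_mul_of_nonneg_right (by nlinarith) z
  have hqN : q * l ^ 4 * N ≤ 10 ^ 17 / 1296 * D * N := by gcongr
  have hlN : l ^ 2 * N ≤ D / 36 * N := by gcongr
  have hlN1 : l * N ≤ l ^ 2 * N := by
    have : l ≤ l ^ 2 := by nlinarith
    gcongr
  have main : M4 + (6 - 4 * l) * M3 + (7 - 12 * l + 6 * l ^ 2) * M2
      + (1 - 4 * l + 6 * l ^ 2 - 4 * l ^ 3) * M1 + l ^ 4 * N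
      ≤ 360 * (q * l ^ 4 * N) + 3 * (l ^ 2 * N) + l * N := by
    have := m4.2
    linarith
  refine main.trans ?_
  have hDN : 0 ≤ D * N := by
    have : 0 ≤ D := by nlinarith [sq_nonneg l]
    positivity
  linarith

end TriangleConcentration

section MatchingTriangles

set_option linter.unusedSectionVars false

variable {V : Type*} [Fintype V] [DecidableEq V]

open scoped Classical in
/-- The number of perfect matchings. -/
noncomputable def pms (G : SimpleGraph V) : ℕ := ((regs V 1).filter fun M => M ≤ G).card

lemma sum_pms (d : ℕ) : ∑ G ∈ regs V d, pms G = ∑ M ∈ regs V 1, extc d M := by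
  classical
  unfold pms extc
  simp only [Finset.card_filter]
  exact Finset.sum_comm

lemma sum_pms_sq (d : ℕ) :
    ∑ G ∈ regs V d, pms G ^ 2 = ∑ M ∈ regs V 1, ∑ M' ∈ regs V 1, extc d (M ⊔ M') := by
  classical
  have h : ∀ G : SimpleGraph V, pms G ^ 2 = ∑ M ∈ regs V 1, ∑ M' ∈ regs V 1,
      if M ⊔ M' ≤ G then 1 else 0 := by
    intro G
    unfold pms
    rw [sq, Finset.card_filter, Finset.sum_mul_sum]
    refine Finset.sum_congr rfl fun M _ => Finset.sum_congr rfl fun M' _ => ?_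
    simp only [sup_le_iff]
    split_ifs <;> simp_all
  simp only [h]
  unfold extc
  simp only [Finset.card_filter]
  rw [Finset.sum_comm]
  refine Finset.sum_congr rfl fun M _ => ?_
  exact Finset.sum_comm

lemma sum_pms_mul_triCount (d : ℕ) :
    ∑ G ∈ regs V d, pms G * triCount G
      = ∑ M ∈ regs V 1, ∑ τ ∈ triples V, extc d (M ⊔ clq {τ}) := by
  classical
  have h : ∀ G : SimpleGraph V, pms G * triCount G = ∑ M ∈ regs V 1, ∑ τ ∈ triples V,
      if M ⊔ clq {τ} ≤ G then 1 else 0 := by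
    intro G
    unfold pms triCount
    rw [Finset.card_filter, Finset.card_filter, Finset.sum_mul_sum]
    refine Finset.sum_congr rfl fun M _ => Finset.sum_congr rfl fun M' _ => ?_
    simp only [sup_le_iff]
    split_ifs <;> simp_all
  simp only [h]
  unfold extc
  simp only [Finset.card_filter]
  rw [Finset.sum_comm]
  refine Finset.sum_congr rfl fun M _ => ?_
  exact Finset.sum_comm

lemma exists_unique_partner {M : SimpleGraph V} (hM : M ∈ regs V 1) (v : V) :
    ∃ w, ∀ u, M.Adj v u ↔ u = w := by
  classical
  have := mem_regs.1 hM v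
  unfold dg at this
  obtain ⟨w, hw⟩ := Finset.card_eq_one.1 this
  refine ⟨w, fun u => ?_⟩
  have := Finset.ext_iff.1 hw u
  simpa using this

open scoped Classical in
/-- Triples containing an edge of `M`. -/
noncomputable def edgeTriples (M : SimpleGraph V) : Finset (Finset V) :=
  (triples V).filter fun τ => ∃ x ∈ τ, ∃ y ∈ τ, M.Adj x y

lemma card_edgeTriples {M : SimpleGraph V} (hM : M ∈ regs V 1) :
    ((edgeTriples M).card : ℝ) ≤ (Fintype.card V : ℝ) ^ 2 / 2 := by
  classical
  choose φ hφ using exists_unique_partner hM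
  have h := Finset.card_mul_le_card_mul (s := edgeTriples M)
    (t := (Finset.univ : Finset (V × V)))
    (fun τ p => τ = {p.1, φ p.1, p.2}) (m := 2) (n := 1) ?_ ?_
  · rw [Finset.card_univ, Fintype.card_prod] at h
    have h' : ((edgeTriples M).card : ℝ) * 2 ≤ Fintype.card V * Fintype.card V * 1 := by
      exact_mod_cast h
    nlinarith
  · intro τ hτ
    obtain ⟨hτ3, x, hx, y, hy, hxy⟩ := Finset.mem_filter.1 hτ
    have h1 : φ x = y := ((hφ x y).1 hxy).symm
    have h2 : φ y = x := ((hφ y x).1 hxy.symm).symm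
    have hne : x ≠ y := hxy.ne
    obtain ⟨z, hz⟩ : ∃ z, τ = {x, y, z} := by
      have hy' : y ∈ τ.erase x := Finset.mem_erase.2 ⟨hne.symm, hy⟩
      have h3 : ((τ.erase x).erase y).card = 1 := by
        rw [Finset.card_erase_of_mem hy', Finset.card_erase_of_mem hx, mem_triples.1 hτ3]
      obtain ⟨z, hz⟩ := Finset.card_eq_one.1 h3
      exact ⟨z, by rw [← hz, Finset.insert_erase hy', Finset.insert_erase hx]⟩
    refine Finset.one_lt_card.2 ⟨(x, z), ?_, (y, z), ?_, ?_⟩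
    · simp [Finset.mem_bipartiteAbove, h1, hz]
    · simp only [Finset.mem_bipartiteAbove, Finset.mem_univ, true_and, h2, hz]
      ext; simp; tauto
    · simp [hne]
  · intro p _
    refine Finset.card_le_one.2 fun a ha b hb => ?_
    rw [Finset.mem_bipartiteBelow] at ha hb
    rw [ha.2, hb.2]

lemma degSum_resid_matching {d : ℕ} (R : Regime V d) {M : SimpleGraph V} (hM : M ∈ regs V 1) :
    degSum (resid d M) = Fintype.card V * ((d:ℝ) - 1) := by
  have h := mem_regs.1 hM
  have := R.large
  rw [degSum_resid (fun v => by rw [h v]; omega)]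
  simp only [h]
  simp; ring

lemma edge_upper_aux {q N : ℝ} (hq0 : 0 ≤ q) (hq1 : q ≤ 1 / 1000000) (hN : 10 ^ 10 ≤ q * N)
    (hN0 : 0 < N) : N ^ 2 * (1 + q) ^ 2 ≤ (1 + 4 * q) * (N - 23) ^ 2 := by
  have h1 : N * (1 - q / 1000) ≤ N - 23 := by nlinarith
  have h2 : (0:ℝ) ≤ 1 - q / 1000 := by linarith
  have h3 : (1 + q) ^ 2 ≤ (1 + 4 * q) * (1 - q / 1000) ^ 2 := by
    have e1 : 1 - 2 * (q / 1000) ≤ (1 - q / 1000) ^ 2 := by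
      nlinarith [mul_nonneg hq0 hq0]
    have e2 : (1 + q) ^ 2 ≤ (1 + 4 * q) * (1 - 2 * (q / 1000)) := by
      nlinarith [mul_nonneg hq0 hq0, mul_le_mul_of_nonneg_left hq1 hq0]
    refine e2.trans ?_
    gcongr
  calc N ^ 2 * (1 + q) ^ 2 ≤ N ^ 2 * ((1 + 4 * q) * (1 - q / 1000) ^ 2) := by gcongr
    _ = (1 + 4 * q) * (N * (1 - q / 1000)) ^ 2 := by ring
    _ ≤ _ := by gcongr

lemma Regime.matching_large {d : ℕ} (R : Regime V d) :
    (d:ℝ) ^ 11 / 4 + 6 ≤ Fintype.card V * ((d:ℝ) - 1) ∧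
      10 ^ 10 ≤ ee d * (Fintype.card V * ((d:ℝ) - 1)) := by
  have h1 := R.pow_succ_le
  have h2 := R.large'
  have h3 := R.card_large
  have h4 : (1:ℝ) ≤ (d:ℝ) ^ 4 := one_le_pow₀ (by linarith)
  have h5 := R.ee_mul_card
  constructor
  · have : (Fintype.card V : ℝ) * d * (1 / 2) ≤ Fintype.card V * ((d:ℝ) - 1) := by
      rw [mul_assoc]; gcongr; linarith
    nlinarith
  · have : 10 ^ 17 ≤ ee d * Fintype.card V := by linarith
    rw [← mul_assoc]
    nlinarith

lemma extc_matching_free_triple {d : ℕ} (R : Regime V d) {M : SimpleGraph V} (hM : M ∈ regs V 1)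
    {τ : Finset V} (hτ : τ ∈ triples V) (hτM : τ ∉ edgeTriples M) :
    (extc d (M ⊔ clq {τ}) : ℝ)
      ≤ (1 + 4 * ee d) * ((((d:ℝ) - 2) / Fintype.card V) ^ 3 * extc d M) := by
  classical
  have hno : ∀ x ∈ τ, ∀ y ∈ τ, ¬ M.Adj x y := by
    intro x hx y hy h
    exact hτM (Finset.mem_filter.2 ⟨hτ, x, hx, y, hy, h⟩)
  obtain ⟨x, y, z, hxy, hxz, hyz, rfl⟩ := Finset.card_eq_three.1 (mem_triples.1 hτ)
  rw [clq_triple hxy hxz hyz]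
  have hdM := mem_regs.1 hM
  have hlarge := R.large
  have hres : ∀ v, resid d M v = d - 1 := fun v => by unfold resid; rw [hdM v]
  obtain ⟨hl1, hl2⟩ := R.matching_large
  obtain ⟨-, u⟩ := extc_tri R.large R.even hxy hxz hyz (hno _ (by simp) _ (by simp))
    (hno _ (by simp) _ (by simp)) (hno _ (by simp) _ (by simp))
    (fun v => by rw [hdM v]; omega) (hres x) (hres y) (hres z)
    (by rw [degSum_resid_matching R hM]; exact hl1)
  rw [degSum_resid_matching R hM, show d - 1 - 1 = d - 2 by omega,
    Nat.cast_sub (by omega : 1 ≤ d), Nat.cast_sub (by omega : 2 ≤ d)] at u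
  push_cast at u
  have hq0 := ee_nonneg d
  have hq1 := ee_small R.large
  have hn : (0:ℝ) < Fintype.card V := by have := R.card_large; linarith
  have hE : (0:ℝ) ≤ extc d (M ⊔ tri x y z) := Nat.cast_nonneg _
  have he : (0:ℝ) ≤ extc d M := Nat.cast_nonneg _
  have hr1 : (0:ℝ) < (d:ℝ) - 1 := by have := R.large'; linarith
  have hr2 : (0:ℝ) < (d:ℝ) - 2 := by have := R.large'; linarith
  have hN0 : 0 < (Fintype.card V : ℝ) * ((d:ℝ) - 1) := by positivity
  have hf := free_upper_aux hq0 hq1 hl2 hN0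
  have hbig : (10:ℝ) ^ 15 ≤ Fintype.card V * ((d:ℝ) - 1) := by
    nlinarith [mul_le_mul_of_nonneg_right hq1 hN0.le]
  clear hres hdM hno hτM hτ hl1
  have e1 : ∀ c : ℝ, c * ((((d:ℝ) - 1) * ((d:ℝ) - 2)) * (((d:ℝ) - 1) * ((d:ℝ) - 2))
      * (((d:ℝ) - 1) * ((d:ℝ) - 2)) * extc d M)
      = c * ((((d:ℝ) - 2) / Fintype.card V) ^ 3 * extc d M)
        * (Fintype.card V * ((d:ℝ) - 1)) ^ 3 := by
    intro c; field_simp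
  rw [e1] at u
  generalize (extc d (M ⊔ tri x y z) : ℝ) = E at *
  have hX : 0 ≤ (((d:ℝ) - 2) / Fintype.card V) ^ 3 * extc d M := by positivity
  generalize (((d:ℝ) - 2) / Fintype.card V) ^ 3 * extc d M = X at *
  generalize (Fintype.card V : ℝ) * ((d:ℝ) - 1) = N at *
  generalize ee d = q at *
  have h23 : 0 < N - 23 := by linarith
  have hp : 0 < (N - 23) ^ 3 := by positivity
  refine le_of_mul_le_mul_right ?_ hp
  calc E * (N - 23) ^ 3 = E * ((N - 23) * (N - 23) * (N - 23)) := by ring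
    _ ≤ E * ((N - 1) * (N - 3) * (N - 5)) := by
        refine mul_le_mul_of_nonneg_left
          (prod_three_le h23.le h23.le h23.le ?_ ?_ ?_) hE <;> linarith
    _ ≤ (1 + q) ^ 3 * X * N ^ 3 := u
    _ = X * (N ^ 3 * (1 + q) ^ 3) := by ring
    _ ≤ X * ((1 + 4 * q) * (N - 23) ^ 3) := by gcongr
    _ = _ := by ring

lemma extc_matching_edge_triple {d : ℕ} (R : Regime V d) {M : SimpleGraph V} (hM : M ∈ regs V 1)
    {τ : Finset V} (hτM : τ ∈ edgeTriples M) :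
    (extc d (M ⊔ clq {τ}) : ℝ)
      ≤ (1 + 4 * ee d) * (((d:ℝ) - 1) * ((d:ℝ) - 2) / Fintype.card V ^ 2 * extc d M) := by
  classical
  obtain ⟨hτ, x, hx, y, hy, hadj⟩ := Finset.mem_filter.1 hτM
  have hxy : x ≠ y := hadj.ne
  have hy' : y ∈ τ.erase x := Finset.mem_erase.2 ⟨hxy.symm, hy⟩
  have h3 : ((τ.erase x).erase y).card = 1 := by
    rw [Finset.card_erase_of_mem hy', Finset.card_erase_of_mem hx, mem_triples.1 hτ]
  obtain ⟨z, hz⟩ := Finset.card_eq_one.1 h3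
  have hzm : z ∈ (τ.erase x).erase y := by rw [hz]; simp
  have hyz : y ≠ z := (Finset.ne_of_mem_erase hzm).symm
  have hxz : x ≠ z := (Finset.ne_of_mem_erase (Finset.mem_of_mem_erase hzm)).symm
  have hτe : τ = {x, y, z} := by rw [← hz, Finset.insert_erase hy', Finset.insert_erase hx]
  obtain ⟨px, hpx⟩ := exists_unique_partner hM x
  obtain ⟨py, hpy⟩ := exists_unique_partner hM y
  have n1 : ¬ M.Adj x z := fun h => hyz (((hpx y).1 hadj).trans ((hpx z).1 h).symm)
  have n2 : ¬ M.Adj y z := fun h => hxz (((hpy x).1 hadj.symm).trans ((hpy z).1 h).symm)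
  have n2' : ¬ (M ⊔ SimpleGraph.edge x z).Adj y z :=
    not_adj_sup_edge n2 (by rintro (⟨h, -⟩ | ⟨h, -⟩) <;> [exact hxy h.symm; exact hyz h])
  have hgr : M ⊔ clq {τ} = M ⊔ SimpleGraph.edge x z ⊔ SimpleGraph.edge y z := by
    rw [hτe, clq_triple hxy hxz hyz]
    have hle : SimpleGraph.edge x y ≤ M := by
      intro a b hab
      rw [SimpleGraph.edge_adj] at hab
      rcases hab with ⟨⟨rfl, rfl⟩ | ⟨rfl, rfl⟩, -⟩
      · exact hadj
      · exact hadj.symm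
    unfold tri
    rw [sup_assoc (SimpleGraph.edge x y), ← sup_assoc M (SimpleGraph.edge x y),
      sup_eq_left.2 hle, sup_assoc]
  have hdM := mem_regs.1 hM
  have hlarge := R.large
  have hres : ∀ v, resid d M v = d - 1 := fun v => by unfold resid; rw [hdM v]
  obtain ⟨hl1, hl2⟩ := R.matching_large
  have g0 : ∀ v, dg M v ≤ d := fun v => by rw [hdM v]; omega
  have g1 : ∀ v, dg (M ⊔ SimpleGraph.edge x z) v ≤ d := fun v => by
    rw [dg_sup_edge M hxz n1, hdM v]
    unfold inc
    split_ifs <;> omega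
  have hDM := degSum_resid_matching R hM
  have hD := degSum_sup_edge hxz n1 g1
  obtain ⟨-, u1⟩ := extc_sup_edge hxz n1 g0 R.large R.even (by rw [hDM]; linarith)
  obtain ⟨-, u2⟩ := extc_sup_edge hyz n2' g1 R.large R.even (by rw [hD, hDM]; linarith)
  rw [hD, resid_sup_edge_apply hxz n1, resid_sup_edge_apply hxz n1, hres, hres,
    show inc x z y = 0 by simp [inc, hxy.symm, hyz], show inc x z z = 1 by simp [inc, hxz.symm],
    show d - 1 - 1 = d - 2 by omega, Nat.sub_zero, hDM,
    Nat.cast_sub (by omega : 1 ≤ d), Nat.cast_sub (by omega : 2 ≤ d)] at u2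
  rw [hres, hres, hDM, Nat.cast_sub (by omega : 1 ≤ d)] at u1
  push_cast at u1 u2
  rw [hgr]
  have hq0 := ee_nonneg d
  have hq1 := ee_small R.large
  have hn : (0:ℝ) < Fintype.card V := by have := R.card_large; linarith
  have hE : (0:ℝ) ≤ extc d (M ⊔ SimpleGraph.edge x z ⊔ SimpleGraph.edge y z) := Nat.cast_nonneg _
  have he : (0:ℝ) ≤ extc d M := Nat.cast_nonneg _
  have hr1 : (0:ℝ) < (d:ℝ) - 1 := by have := R.large'; linarith
  have hr2 : (0:ℝ) < (d:ℝ) - 2 := by have := R.large'; linarith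
  have hN0 : 0 < (Fintype.card V : ℝ) * ((d:ℝ) - 1) := by positivity
  have hf := edge_upper_aux hq0 hq1 hl2 hN0
  have hbig : (10:ℝ) ^ 15 ≤ Fintype.card V * ((d:ℝ) - 1) := by
    nlinarith [mul_le_mul_of_nonneg_right hq1 hN0.le]
  clear hres hdM hτM hτ hl1 hD hDM g0 g1 n1 n2 n2' hgr
  generalize (extc d (M ⊔ SimpleGraph.edge x z ⊔ SimpleGraph.edge y z) : ℝ) = E at *
  generalize (extc d (M ⊔ SimpleGraph.edge x z) : ℝ) = E1 at *
  generalize (extc d M : ℝ) = e at *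
  generalize (Fintype.card V : ℝ) = n at *
  have hr12 : (d:ℝ) - 2 = (d:ℝ) - 1 - 1 := by ring
  rw [hr12] at u2 hr2 ⊢
  clear hr12
  generalize (d:ℝ) - 1 = t at *
  generalize ee d = q at *
  have h23 : 0 < n * t - 23 := by linarith
  have h1' : 0 ≤ n * t - 1 := by linarith
  have h1'' : 0 ≤ n * t - 2 - 1 := by linarith
  have hp : 0 < (n * t - 23) ^ 2 := by positivity
  refine le_of_mul_le_mul_right ?_ hp
  calc E * (n * t - 23) ^ 2 = E * ((n * t - 23) * (n * t - 23)) := by ring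
    _ ≤ E * ((n * t - 2 - 1) * (n * t - 1)) := by
        refine mul_le_mul_of_nonneg_left (mul_le_mul ?_ ?_ h23.le ?_) hE <;> linarith
    _ = E * (n * t - 2 - 1) * (n * t - 1) := by ring
    _ ≤ (1 + q) * (t * (t - 1) * E1) * (n * t - 1) := by gcongr
    _ = (1 + q) * (t * (t - 1) * (E1 * (n * t - 1))) := by ring
    _ ≤ (1 + q) * (t * (t - 1) * ((1 + q) * (t * t * e))) := by gcongr
    _ = t * (t - 1) / n ^ 2 * e * ((n * t) ^ 2 * (1 + q) ^ 2) := by field_simp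
    _ ≤ t * (t - 1) / n ^ 2 * e * ((1 + 4 * q) * (n * t - 23) ^ 2) := by gcongr
    _ = _ := by ring

lemma sum_extc_matching_triple {d : ℕ} (R : Regime V d) {M : SimpleGraph V} (hM : M ∈ regs V 1) :
    ∑ τ ∈ triples V, (extc d (M ⊔ clq {τ}) : ℝ)
      ≤ (1 + 4 * ee d) * ((((d:ℝ) - 1) ^ 3 - 1) / 6) * extc d M := by
  classical
  have hsub : edgeTriples M ⊆ triples V := Finset.filter_subset _ _
  have hn : (0:ℝ) < Fintype.card V := by have := R.card_large; linarith
  have he : (0:ℝ) ≤ extc d M := Nat.cast_nonneg _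
  have hq0 := ee_nonneg d
  have hr1 : (0:ℝ) < (d:ℝ) - 1 := by have := R.large'; linarith
  have hr2 : (0:ℝ) < (d:ℝ) - 2 := by have := R.large'; linarith
  rw [← Finset.sum_sdiff hsub]
  have s1 : ∑ τ ∈ triples V \ edgeTriples M, (extc d (M ⊔ clq {τ}) : ℝ)
      ≤ (1 + 4 * ee d) * (((d:ℝ) - 2) ^ 3 / 6 * extc d M) := by
    calc _ ≤ ∑ τ ∈ triples V \ edgeTriples M,
          (1 + 4 * ee d) * ((((d:ℝ) - 2) / Fintype.card V) ^ 3 * extc d M) := by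
          refine Finset.sum_le_sum fun τ hτ => ?_
          rw [Finset.mem_sdiff] at hτ
          exact extc_matching_free_triple R hM hτ.1 hτ.2
      _ ≤ ∑ τ ∈ triples V,
          (1 + 4 * ee d) * ((((d:ℝ) - 2) / Fintype.card V) ^ 3 * extc d M) :=
          Finset.sum_le_sum_of_subset_of_nonneg Finset.sdiff_subset
            fun _ _ _ => by positivity
      _ = (triples V).card
          * ((1 + 4 * ee d) * ((((d:ℝ) - 2) / Fintype.card V) ^ 3 * extc d M)) := by
          rw [Finset.sum_const, nsmul_eq_mul]
      _ ≤ (Fintype.card V : ℝ) ^ 3 / 6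
          * ((1 + 4 * ee d) * ((((d:ℝ) - 2) / Fintype.card V) ^ 3 * extc d M)) :=
          mul_le_mul_of_nonneg_right card_triples_le (by positivity)
      _ = _ := by field_simp
  have s2 : ∑ τ ∈ edgeTriples M, (extc d (M ⊔ clq {τ}) : ℝ)
      ≤ (1 + 4 * ee d) * (((d:ℝ) - 1) * ((d:ℝ) - 2) / 2 * extc d M) := by
    calc _ ≤ ∑ τ ∈ edgeTriples M,
          (1 + 4 * ee d) * (((d:ℝ) - 1) * ((d:ℝ) - 2) / Fintype.card V ^ 2 * extc d M) :=
          Finset.sum_le_sum fun τ hτ => extc_matching_edge_triple R hM hτ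
      _ = (edgeTriples M).card
          * ((1 + 4 * ee d) * (((d:ℝ) - 1) * ((d:ℝ) - 2) / Fintype.card V ^ 2 * extc d M)) := by
          rw [Finset.sum_const, nsmul_eq_mul]
      _ ≤ (Fintype.card V : ℝ) ^ 2 / 2
          * ((1 + 4 * ee d) * (((d:ℝ) - 1) * ((d:ℝ) - 2) / Fintype.card V ^ 2 * extc d M)) :=
          mul_le_mul_of_nonneg_right (card_edgeTriples hM) (by positivity)
      _ = _ := by field_simp
  refine (add_le_add s1 s2).trans (le_of_eq ?_)
  ring

lemma sum_pms_mul_triCount_le {d : ℕ} (R : Regime V d) :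
    ∑ G ∈ regs V d, (pms G : ℝ) * triCount G
      ≤ (1 + 4 * ee d) * ((((d:ℝ) - 1) ^ 3 - 1) / 6) * ∑ G ∈ regs V d, (pms G : ℝ) := by
  have h1 : ∑ G ∈ regs V d, (pms G : ℝ) * triCount G
      = ∑ M ∈ regs V 1, ∑ τ ∈ triples V, (extc d (M ⊔ clq {τ}) : ℝ) := by
    exact_mod_cast sum_pms_mul_triCount (V := V) d
  have h2 : ∑ G ∈ regs V d, (pms G : ℝ) = ∑ M ∈ regs V 1, (extc d M : ℝ) := by
    exact_mod_cast sum_pms (V := V) d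
  rw [h1, h2, Finset.mul_sum]
  exact Finset.sum_le_sum fun M hM => sum_extc_matching_triple R hM

end MatchingTriangles

section MatchingPairs

set_option linter.unusedSectionVars false

variable {V : Type*} [Fintype V] [DecidableEq V]

lemma dg_of_partner {G : SimpleGraph V} {v w : V} (h : ∀ u, G.Adj v u ↔ u = w) : dg G v = 1 := by
  classical
  unfold dg
  rw [Finset.card_eq_one]
  exact ⟨w, by ext u; simp [h]⟩

lemma dg_inf_partner {M M' : SimpleGraph V} {φ φ' : V → V} (h : ∀ v u, M.Adj v u ↔ u = φ v)
    (h' : ∀ v u, M'.Adj v u ↔ u = φ' v) (v : V) :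
    dg (M ⊓ M') v = if φ v = φ' v then 1 else 0 := by
  split_ifs with e
  · refine dg_of_partner (w := φ v) fun u => ?_
    rw [SimpleGraph.inf_adj, h, h', e, and_self]
  · by_contra hne
    unfold dg at hne
    obtain ⟨u, hu⟩ := Finset.card_pos.1 (Nat.pos_of_ne_zero hne)
    simp only [Finset.mem_filter, Finset.mem_univ, true_and, SimpleGraph.inf_adj, h, h'] at hu
    exact e (hu.1.symm.trans hu.2)

lemma dg_sup_partner {M M' : SimpleGraph V} {φ φ' : V → V} (h : ∀ v u, M.Adj v u ↔ u = φ v)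
    (h' : ∀ v u, M'.Adj v u ↔ u = φ' v) (v : V) :
    dg (M ⊔ M') v = if φ v = φ' v then 1 else 2 := by
  classical
  split_ifs with e
  · refine dg_of_partner (w := φ v) fun u => ?_
    rw [SimpleGraph.sup_adj, h, h', e, or_self]
  · unfold dg
    rw [Finset.card_eq_two]
    refine ⟨φ v, φ' v, e, ?_⟩
    ext u
    simp [h, h']

lemma partner_invol {M : SimpleGraph V} {φ : V → V} (h : ∀ v u, M.Adj v u ↔ u = φ v) (v : V) :
    φ (φ v) = v :=
  ((h (φ v) v).1 ((h v (φ v)).2 rfl).symm).symm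

lemma partner_eq_iff {M M' : SimpleGraph V} {φ φ' : V → V} (h : ∀ v u, M.Adj v u ↔ u = φ v)
    (h' : ∀ v u, M'.Adj v u ↔ u = φ' v) (v : V) : φ (φ v) = φ' (φ v) ↔ φ v = φ' v := by
  rw [partner_invol h]
  constructor
  · intro e
    have := congrArg φ' e
    rw [partner_invol h'] at this
    exact this.symm
  · intro e
    rw [e, partner_invol h']

lemma resid_sup_partner {d : ℕ} (hd : 2 ≤ d) {M M' : SimpleGraph V} {φ φ' : V → V}
    (h : ∀ v u, M.Adj v u ↔ u = φ v) (h' : ∀ v u, M'.Adj v u ↔ u = φ' v) (v : V) :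
    resid d (M ⊔ M') v = d - 2 + dg (M ⊓ M') v := by
  unfold resid
  rw [dg_sup_partner h h', dg_inf_partner h h']
  split_ifs <;> omega

lemma mul_nbSum_sup_partner {d : ℕ} (hd : 2 ≤ d) {M M' : SimpleGraph V} {φ φ' : V → V}
    (h : ∀ v u, M.Adj v u ↔ u = φ v) (h' : ∀ v u, M'.Adj v u ↔ u = φ' v) (v : V) :
    (resid d (M ⊔ M') v : ℝ) * nbSum (resid d (M ⊔ M')) (M ⊔ M') v
      = dg (M ⊓ M') v * ((d:ℝ) - 1) ^ 2 + (1 - dg (M ⊓ M') v) * (2 * ((d:ℝ) - 2) ^ 2) := by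
  classical
  unfold nbSum
  have e1 := partner_eq_iff h h' v
  have e2 := partner_eq_iff h' h v
  simp only [SimpleGraph.sup_adj, h, h', resid_sup_partner hd h h', dg_inf_partner h h',
    Nat.cast_add, Nat.cast_sub hd]
  by_cases e : φ v = φ' v
  · simp only [e, or_self, Finset.sum_ite_eq', Finset.mem_univ, if_true]
    have : φ (φ' v) = φ' (φ' v) := by rw [← e]; exact e1.2 e
    simp only [this, if_true]
    push_cast; ring
  · have n1 : φ (φ v) ≠ φ' (φ v) := fun a => e (e1.1 a)
    have n2 : φ (φ' v) ≠ φ' (φ' v) := fun a => e (e2.1 a.symm).symm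
    have : ∀ u, (if u = φ v ∨ u = φ' v then
        (((d:ℝ) - (2:ℕ)) + ((if φ u = φ' u then 1 else 0 : ℕ) : ℝ)) else 0)
        = (if u = φ v then ((d:ℝ) - 2) else 0) + (if u = φ' v then ((d:ℝ) - 2) else 0) := by
      intro u
      by_cases a : u = φ v
      · subst a
        simp [n1, e]
      · by_cases b : u = φ' v
        · subst b
          simp [n2, a]
        · simp [a, b]
    rw [Finset.sum_congr rfl fun u _ => this u, Finset.sum_add_distrib]
    simp [e]
    ring

/-- The bound for the number of extensions of a pair of matchings sharing `k` edges. -/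
lemma pair_stats {d m k : ℕ} (hd : 2 ≤ d) (hV : Fintype.card V = 2 * m) {M M' : SimpleGraph V}
    (hM : M ∈ regs V 1) (hM' : M' ∈ regs V 1) (hk : ∑ v, dg (M ⊓ M') v = 2 * k) :
    (∀ v, dg (M ⊔ M') v ≤ 2) ∧
    degSum (resid d (M ⊔ M')) = 2 * m * ((d:ℝ) - 2) + 2 * k ∧
    degSq (resid d (M ⊔ M')) = 2 * m * (((d:ℝ) - 2) * ((d:ℝ) - 3)) + 4 * k * ((d:ℝ) - 2) ∧
    edgeSum (resid d (M ⊔ M')) (M ⊔ M')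
      = k * ((d:ℝ) - 1) ^ 2 + (2 * m - 2 * k) * ((d:ℝ) - 2) ^ 2 ∧
    conf (resid d (M ⊔ M')) = ((2 * (m * (d - 2) + k) - 1).doubleFactorial : ℝ)
      / (((d - 2).factorial : ℝ) ^ (2 * m) * ((d:ℝ) - 1) ^ (2 * k)) := by
  classical
  choose φ hφ using exists_unique_partner hM
  choose φ' hφ' using exists_unique_partner hM'
  have hr := resid_sup_partner hd hφ hφ'
  have hV' : (Fintype.card V : ℝ) = 2 * m := by exact_mod_cast hV
  have hk' : ∑ v, (dg (M ⊓ M') v : ℝ) = 2 * k := by exact_mod_cast hk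
  have h01 : ∀ v, dg (M ⊓ M') v = 0 ∨ dg (M ⊓ M') v = 1 := fun v => by
    rw [dg_inf_partner hφ hφ']; split_ifs <;> simp
  have hsum : ∑ v, resid d (M ⊔ M') v = 2 * (m * (d - 2) + k) := by
    rw [Finset.sum_congr rfl fun v _ => hr v, Finset.sum_add_distrib, hk, Finset.sum_const,
      Finset.card_univ, hV, smul_eq_mul]
    ring
  refine ⟨fun v => ?_, ?_, ?_, ?_, ?_⟩
  · rw [dg_sup_partner hφ hφ']; split_ifs <;> omega
  · rw [degSum_eq_cast, hsum]
    push_cast [Nat.cast_sub hd]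
    ring
  · unfold degSq
    have : ∀ v, (resid d (M ⊔ M') v : ℝ) * ((resid d (M ⊔ M') v : ℝ) - 1)
        = ((d:ℝ) - 2) * ((d:ℝ) - 3) + dg (M ⊓ M') v * (2 * ((d:ℝ) - 2)) := by
      intro v
      rw [hr v]
      push_cast [Nat.cast_sub hd]
      rcases h01 v with e | e <;> rw [e] <;> push_cast <;> ring
    rw [Finset.sum_congr rfl fun v _ => this v, Finset.sum_add_distrib, ← Finset.sum_mul,
      ← Finset.sum_mul, hk', Finset.sum_const, Finset.card_univ, nsmul_eq_mul, hV']
    ring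
  · unfold edgeSum
    rw [Finset.sum_congr rfl fun v _ => mul_nbSum_sup_partner hd hφ hφ' v, Finset.sum_add_distrib,
      ← Finset.sum_mul, ← Finset.sum_mul, Finset.sum_sub_distrib, hk', Finset.sum_const,
      Finset.card_univ, nsmul_eq_mul, hV']
    ring
  · unfold conf
    rw [hsum]
    congr 1
    have : ∀ v, ((resid d (M ⊔ M') v).factorial : ℝ)
        = (d - 2).factorial * ((d:ℝ) - 1) ^ (dg (M ⊓ M') v) := by
      intro v
      rw [hr v]
      rcases h01 v with e | e <;> rw [e]
      · simp
      · rw [Nat.factorial_succ]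
        push_cast [Nat.cast_sub hd]
        ring
    rw [Finset.prod_congr rfl fun v _ => this v, Finset.prod_mul_distrib, Finset.prod_pow_eq_pow_sum,
      hk, Finset.prod_const, Finset.card_univ, hV]

open scoped Classical in
/-- The number of perfect matchings meeting `M` in a given set of edges. -/
lemma card_matching_inf_eq {m k : ℕ} (hV : Fintype.card V = 2 * m) (hkm : k ≤ m)
    {M H : SimpleGraph V}
    (hM : M ∈ regs V 1) (hH : H ≤ M) (hk : ∑ v, dg H v = 2 * k) :
    (((regs V 1).filter fun M' => M ⊓ M' = H).card : ℝ) ≤ ((2 * (m - k) - 1).doubleFactorial : ℝ) ∧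
    (k < m → (((regs V 1).filter fun M' => M ⊓ M' = H).card : ℝ)
      ≤ ((2 * (m - k) - 1).doubleFactorial : ℝ)
        * Real.exp (-(1 / 2) + kap 2 (2 * ((m:ℝ) - k)) / 2)) := by
  classical
  choose φ hφ using exists_unique_partner hM
  have hdM := mem_regs.1 hM
  set δ : V → ℕ := fun v => 1 - dg H v with hδ
  have hH1 : ∀ v, dg H v ≤ 1 := fun v => (dg_mono hH v).trans (hdM v).le
  have hHadj : ∀ v, dg H v = 1 ↔ H.Adj v (φ v) := by
    intro v
    constructor
    · intro e
      unfold dg at e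
      obtain ⟨w, hw⟩ := Finset.card_eq_one.1 e
      have hw' : H.Adj v w := by
        have := Finset.ext_iff.1 hw w
        simpa using this
      rwa [← (hφ v w).1 (hH hw')]
    · intro e
      refine dg_of_partner (w := φ v) fun u => ⟨fun a => (hφ v u).1 (hH a), fun a => a ▸ e⟩
  have hHφ : ∀ v, dg H (φ v) = dg H v := by
    intro v
    have h1 : dg H (φ v) = 1 ↔ dg H v = 1 := by
      rw [hHadj, hHadj, partner_invol hφ]
      exact ⟨fun a => a.symm, fun a => a.symm⟩
    have := hH1 v
    have := hH1 (φ v)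
    omega
  have hδs : ∑ v, δ v = 2 * (m - k) := by
    have : ∑ v, δ v + ∑ v, dg H v = 2 * m := by
      rw [← Finset.sum_add_distrib, Finset.sum_congr rfl fun v _ =>
        (Nat.sub_add_cancel (hH1 v) : δ v + dg H v = 1), Finset.sum_const, Finset.card_univ, hV]
      simp
    omega
  have hle : ((regs V 1).filter fun M' => M ⊓ M' = H).card ≤ (gset δ M).card := by
    refine Finset.card_le_card_of_injOn (fun M' => M' \ M) ?_ ?_
    · intro M' hM'
      obtain ⟨h1, h2⟩ := Finset.mem_filter.1 hM'
      rw [Finset.mem_coe, mem_gset]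
      have hdis : ∀ u v, (M' \ M).Adj u v → ¬ M.Adj u v := fun u v a =>
        ((SimpleGraph.sdiff_adj _ _ _ _).1 a).2
      refine ⟨fun v => ?_, hdis⟩
      have h3 : M' = (M' \ M) ⊔ H := by rw [← h2, inf_comm, sup_comm, sup_inf_sdiff]
      have h4 := dg_sup_of_disjoint (G := M' \ M) (H := H) (fun u v a b => hdis u v a (hH b)) v
      rw [← h3, mem_regs.1 h1 v] at h4
      simp only [hδ]
      omega
    · intro A hA B hB hAB
      have a2 := (Finset.mem_filter.1 hA).2
      have b2 := (Finset.mem_filter.1 hB).2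
      calc A = (M ⊓ A) ⊔ A \ M := by rw [inf_comm, sup_inf_sdiff]
        _ = (M ⊓ B) ⊔ B \ M := by rw [a2, b2]; exact congrArg _ hAB
        _ = B := by rw [inf_comm, sup_inf_sdiff]
  have hconf : conf δ = ((2 * (m - k) - 1).doubleFactorial : ℝ) := by
    unfold conf
    rw [hδs, Finset.prod_eq_one, div_one]
    intro v _
    have : δ v ≤ 1 := Nat.sub_le _ _
    interval_cases h : δ v <;> simp
  have hle' : (((regs V 1).filter fun M' => M ⊓ M' = H).card : ℝ) ≤ (gset δ M).card := by
    exact_mod_cast hle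
  constructor
  · rw [← hconf]
    exact hle'.trans (card_gset_le_conf _ δ M hδs)
  · intro hlt
    refine hle'.trans ?_
    have hb := (card_gset_bounds (d := 2) (by norm_num) _ δ M hδs fun v => by
      rw [hdM v]; simp only [hδ]; omega).2
    have hD : degSum δ = 2 * ((m:ℝ) - k) := by
      rw [degSum_eq_cast, hδs]; push_cast [Nat.cast_sub hkm]; ring
    have hD0 : (0:ℝ) < 2 * ((m:ℝ) - k) := by
      have : (k:ℝ) < m := by exact_mod_cast hlt
      linarith
    have hδ01 : ∀ v, (δ v : ℝ) * ((δ v : ℝ) - 1) = 0 := by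
      intro v
      have : δ v ≤ 1 := Nat.sub_le _ _
      interval_cases h : δ v <;> simp
    have hP : degSq δ = 0 := Finset.sum_eq_zero fun v _ => hδ01 v
    have hR : edgeSum δ M = degSum δ / 2 := by
      unfold edgeSum degSum
      congr 1
      refine Finset.sum_congr rfl fun v _ => ?_
      have : nbSum δ M v = δ v := by
        unfold nbSum
        simp only [hφ, Finset.sum_ite_eq', Finset.mem_univ, if_true]
        simp only [hδ, hHφ]
      rw [this]
      linarith [hδ01 v]
    have hLT : gL δ M = 1 / 2 ∧ gT δ M = 1 / 2 := by
      unfold gL gT lam lamt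
      rw [hP, hR, div_right_comm (degSum δ) 2, div_self (by rw [hD]; exact hD0.ne')]
      constructor <;> norm_num
    rw [hLT.1, hLT.2, hconf, hD] at hb
    rw [show (-(1 / 2) + kap 2 (2 * ((m:ℝ) - k)) / 2 : ℝ)
      = -(1 / 2) + kap ((2:ℕ):ℝ) (2 * ((m:ℝ) - k)) * (1 / 2) by push_cast; ring]
    exact hb

lemma card_matchings_ge {m : ℕ} (hV : Fintype.card V = 2 * m) :
    ((2 * m - 1).doubleFactorial : ℝ) ≤ ((regs V 1).card : ℝ) := by
  classical
  have hs : ∑ _v : V, 1 = 2 * m := by simp [hV]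
  have hb := (card_gset_bounds (V := V) (d := 1) le_rfl m (fun _ => 1) ⊥ hs fun v => by
      rw [dg_bot]).1
  have hP : degSq (fun _ : V => 1) = 0 := by simp [degSq]
  have hR : edgeSum (fun _ : V => 1) ⊥ = 0 := by simp [edgeSum, nbSum]
  have hLT : gL (fun _ : V => 1) ⊥ = 0 ∧ gT (fun _ : V => 1) ⊥ = 0 := by
    unfold gL gT lam lamt
    rw [hP, hR]
    simp
  rw [hLT.1, hLT.2] at hb
  have hconf : conf (fun _ : V => 1) = ((2 * m - 1).doubleFactorial : ℝ) := by
    unfold conf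
    rw [hs]; simp
  rw [hconf] at hb
  simpa [regs] using hb

end MatchingPairs

section MatchingFibres

set_option linter.unusedSectionVars false

variable {V : Type*} [Fintype V] [DecidableEq V]

lemma sum_dg_eq_card_edgeFinset (G : SimpleGraph V) [Fintype G.edgeSet] :
    ∑ v, dg G v = 2 * G.edgeFinset.card := by
  classical
  rw [Finset.sum_congr rfl fun v _ => dg_eq_degree G v, G.sum_degrees_eq_twice_card_edges]
  congr!

open scoped Classical in
/-- Summing over the perfect matchings according to the intersection with a fixed one. -/
lemma sum_matchings_le {m : ℕ} (hV : Fintype.card V = 2 * m) {M : SimpleGraph V}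
    (hM : M ∈ regs V 1) (f : SimpleGraph V → ℝ) (F B : ℕ → ℝ) (hF0 : ∀ k ≤ m, 0 ≤ F k)
    (hF : ∀ k ≤ m, ∀ M' ∈ regs V 1, ∑ v, dg (M ⊓ M') v = 2 * k → f M' ≤ F k)
    (hB : ∀ k ≤ m, ∀ H ≤ M, ∑ v, dg H v = 2 * k →
      (((regs V 1).filter fun M' => M ⊓ M' = H).card : ℝ) ≤ B k) :
    ∑ M' ∈ regs V 1, f M' ≤ ∑ k ∈ Finset.range (m + 1), (m.choose k : ℝ) * (B k * F k) := by
  have hcard : M.edgeFinset.card = m := by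
    have := sum_dg_eq_card_edgeFinset M
    rw [Finset.sum_congr rfl fun v _ => mem_regs.1 hM v] at this
    simp only [Finset.sum_const, Finset.card_univ, hV, smul_eq_mul, mul_one] at this
    omega
  have hmaps : ∀ M' ∈ regs V 1, (M ⊓ M').edgeFinset ∈ M.edgeFinset.powerset := fun M' _ =>
    Finset.mem_powerset.2 (SimpleGraph.edgeFinset_subset_edgeFinset.2 inf_le_left)
  rw [← Finset.sum_fiberwise_of_maps_to hmaps]
  have key := Finset.sum_powerset_apply_card (x := M.edgeFinset) (fun k => B k * F k)
  rw [hcard] at key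
  simp only [nsmul_eq_mul] at key
  rw [← key]
  refine Finset.sum_le_sum fun S hS => ?_
  have hS := Finset.mem_powerset.1 hS
  have hSm : S.card ≤ m := by rw [← hcard]; exact Finset.card_le_card hS
  set H : SimpleGraph V := SimpleGraph.fromEdgeSet (S : Set (Sym2 V)) with hH
  have hHe : H.edgeFinset = S := by
    ext e
    rw [SimpleGraph.mem_edgeFinset, hH, SimpleGraph.edgeSet_fromEdgeSet]
    constructor
    · exact fun h => h.1
    · intro h
      exact ⟨h, fun hd => M.not_isDiag_of_mem_edgeFinset (hS h) hd⟩
  have hHM : H ≤ M := by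
    rw [← SimpleGraph.edgeFinset_subset_edgeFinset, hHe]; exact hS
  have hHs : ∑ v, dg H v = 2 * S.card := by rw [sum_dg_eq_card_edgeFinset, hHe]
  have hset : ((regs V 1).filter fun M' => (M ⊓ M').edgeFinset = S)
      = (regs V 1).filter fun M' => M ⊓ M' = H := by
    refine Finset.filter_congr fun M' _ => ?_
    rw [← hHe, SimpleGraph.edgeFinset_inj]
  rw [hset]
  calc ∑ M' ∈ (regs V 1).filter (fun M' => M ⊓ M' = H), f M'
      ≤ ∑ M' ∈ (regs V 1).filter (fun M' => M ⊓ M' = H), F S.card := by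
        refine Finset.sum_le_sum fun M' h => ?_
        obtain ⟨h1, h2⟩ := Finset.mem_filter.1 h
        exact hF _ hSm M' h1 (by rw [h2, hHs])
    _ = ((regs V 1).filter fun M' => M ⊓ M' = H).card * F S.card := by
        rw [Finset.sum_const, nsmul_eq_mul]
    _ ≤ _ := mul_le_mul_of_nonneg_right (hB _ hSm H hHM hHs) (hF0 _ hSm)

end MatchingFibres

section NegativeBinomial

/-- The unnormalised negative binomial weights. -/
noncomputable def nb (x ρ : ℝ) (k : ℕ) : ℝ :=
  (∏ i ∈ Finset.range k, (x + i)) * ρ ^ k / k.factorial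

lemma nb_nonneg {x ρ : ℝ} (hx : 0 ≤ x) (hρ : 0 ≤ ρ) (k : ℕ) : 0 ≤ nb x ρ k := by
  unfold nb
  have : 0 ≤ ∏ i ∈ Finset.range k, (x + i) := Finset.prod_nonneg fun i _ => by positivity
  positivity

lemma nb_succ (x ρ : ℝ) (k : ℕ) : ((k:ℝ) + 1) * nb x ρ (k + 1) = ρ * (x + k) * nb x ρ k := by
  unfold nb
  rw [Finset.prod_range_succ, Nat.factorial_succ]
  have : (k.factorial : ℝ) ≠ 0 := by positivity
  have : (k:ℝ) + 1 ≠ 0 := by positivity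
  push_cast
  field_simp
  ring

lemma nb_eq_multichoose (x ρ : ℝ) (k : ℕ) : nb x ρ k = Ring.choose (x + k - 1) k * ρ ^ k := by
  have h := Ring.factorial_nsmul_multichoose_eq_ascPochhammer x k
  rw [Ring.multichoose_eq, nsmul_eq_mul, Polynomial.ascPochhammer_smeval_eq_eval] at h
  have hp : ∏ i ∈ Finset.range k, (x + i) = (ascPochhammer ℝ k).eval x := by
    clear h
    induction k with
    | zero => simp
    | succ k ih => rw [Finset.prod_range_succ, ih, ascPochhammer_succ_eval]
  unfold nb
  rw [hp, ← h]
  have : (k.factorial : ℝ) ≠ 0 := by positivity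
  field_simp

lemma sum_nb_le {x ρ : ℝ} (hx : 0 ≤ x) (hρ : 0 ≤ ρ) (hρ1 : ρ < 1) (s : Finset ℕ) :
    ∑ k ∈ s, nb x ρ k ≤ ((1 - ρ) ^ x)⁻¹ := by
  have h := (Real.one_div_one_sub_rpow_hasFPowerSeriesOnBall_zero x).hasSum (y := ρ) (by
    simp [enorm_eq_nnnorm, ← NNReal.coe_lt_coe, abs_of_nonneg hρ, hρ1])
  simp only [zero_add, FormalMultilinearSeries.ofScalars_apply_eq, smul_eq_mul,
    ← nb_eq_multichoose, one_div] at h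
  exact sum_le_hasSum s (fun k _ => nb_nonneg hx hρ k) h

lemma sum_nb_var_le {x ρ : ℝ} (hx : 0 ≤ x) (hρ : 0 ≤ ρ) (hρ1 : ρ < 1) (m : ℕ)
    (hm : x * ρ / (1 - ρ) ≤ m + 1) :
    ∑ k ∈ Finset.range (m + 1), nb x ρ k * ((k:ℝ) - x * ρ / (1 - ρ)) ^ 2
      ≤ (x * ρ / (1 - ρ) + ρ * m / (1 - ρ)) * ∑ k ∈ Finset.range (m + 1), nb x ρ k := by
  set μ := x * ρ / (1 - ρ) with hμ
  have h1 : 0 < 1 - ρ := by linarith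
  have hμ' : ρ * x = μ * (1 - ρ) := by rw [hμ]; field_simp
  have key : ∑ k ∈ Finset.range (m + 1), (nb x ρ k * (k * ((k:ℝ) - μ)))
      ≤ ∑ k ∈ Finset.range (m + 1), (nb x ρ k * (ρ * (x + k) * ((k:ℝ) + 1 - μ))) := by
    rw [Finset.sum_range_succ', Finset.sum_range_succ]
    simp only [Nat.cast_zero, zero_mul, mul_zero, add_zero]
    have h2 : 0 ≤ nb x ρ m * (ρ * (x + m) * ((m:ℝ) + 1 - μ)) :=
      mul_nonneg (nb_nonneg hx hρ m) (mul_nonneg (by positivity) (by linarith))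
    refine le_trans (le_of_eq ?_) (le_add_of_nonneg_right h2)
    refine Finset.sum_congr rfl fun k _ => ?_
    push_cast
    linear_combination ((k:ℝ) + 1 - μ) * nb_succ x ρ k
  have h3 : ∀ k ∈ Finset.range (m + 1), nb x ρ k * (ρ * (k:ℝ)) ≤ nb x ρ k * (ρ * m) := by
    intro k hk
    have : (k:ℝ) ≤ m := by exact_mod_cast Nat.lt_succ_iff.1 (Finset.mem_range.1 hk)
    exact mul_le_mul_of_nonneg_left (mul_le_mul_of_nonneg_left this hρ) (nb_nonneg hx hρ k)
  have h4 := Finset.sum_le_sum h3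
  rw [← sub_nonpos, ← Finset.sum_sub_distrib] at key
  have e : ∀ k : ℕ, nb x ρ k * (k * ((k:ℝ) - μ)) - nb x ρ k * (ρ * (x + k) * ((k:ℝ) + 1 - μ))
      = (1 - ρ) * (nb x ρ k * ((k:ℝ) - μ) ^ 2) - (1 - ρ) * μ * nb x ρ k
        - nb x ρ k * (ρ * (k:ℝ)) := by
    intro k
    linear_combination (-(nb x ρ k) * ((k:ℝ) + 1 - μ)) * hμ'
  rw [Finset.sum_congr rfl fun k _ => e k, Finset.sum_sub_distrib, Finset.sum_sub_distrib,
    ← Finset.mul_sum, ← Finset.mul_sum] at key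
  rw [← Finset.sum_mul] at h4
  have h5 : (1 - ρ) * ∑ k ∈ Finset.range (m + 1), nb x ρ k * ((k:ℝ) - μ) ^ 2
      ≤ (1 - ρ) * ((μ + ρ * m / (1 - ρ)) * ∑ k ∈ Finset.range (m + 1), nb x ρ k) := by
    have : (1 - ρ) * ((μ + ρ * m / (1 - ρ)) * ∑ k ∈ Finset.range (m + 1), nb x ρ k)
        = (1 - ρ) * μ * ∑ k ∈ Finset.range (m + 1), nb x ρ k
          + (∑ k ∈ Finset.range (m + 1), nb x ρ k) * (ρ * m) := by field_simp
    rw [this]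
    linarith
  exact le_of_mul_le_mul_left h5 h1

end NegativeBinomial

section OddFactorials

/-- The product of the first `N` odd numbers. -/
noncomputable def oddFac (N : ℕ) : ℝ := ((2 * N - 1).doubleFactorial : ℝ)

lemma oddFac_zero : oddFac 0 = 1 := by simp [oddFac]

lemma oddFac_succ (N : ℕ) : oddFac (N + 1) = (2 * N + 1) * oddFac N := by
  unfold oddFac
  cases N with
  | zero => simp
  | succ N =>
    rw [show 2 * (N + 1 + 1) - 1 = (2 * (N + 1) - 1) + 2 by omega, Nat.doubleFactorial_add_two]
    rw [show 2 * (N + 1) - 1 + 2 = 2 * (N + 1) + 1 by omega]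
    push_cast; ring

lemma oddFac_pos (N : ℕ) : 0 < oddFac N := by
  unfold oddFac; exact_mod_cast Nat.doubleFactorial_pos _

lemma oddFac_add (X k : ℕ) :
    oddFac (X + k) = oddFac X * (2 ^ k * ∏ i ∈ Finset.range k, ((X:ℝ) + 1 / 2 + i)) := by
  induction k with
  | zero => simp
  | succ k ih =>
    rw [← add_assoc, oddFac_succ, ih, Finset.prod_range_succ]
    push_cast; ring

/-- The normalised central binomial coefficients. -/
noncomputable def cbin (j : ℕ) : ℝ := oddFac j / (2 ^ j * j.factorial)

lemma cbin_pos (j : ℕ) : 0 < cbin j := div_pos (oddFac_pos j) (by positivity)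

lemma cbin_succ (j : ℕ) : cbin (j + 1) * (2 * j + 2) = cbin j * (2 * j + 1) := by
  unfold cbin
  rw [oddFac_succ, Nat.factorial_succ]
  push_cast
  field_simp
  ring

lemma cbin_sq_mul_mono {i j : ℕ} (h : i ≤ j) : cbin i ^ 2 * i ≤ cbin j ^ 2 * j := by
  induction j, h using Nat.le_induction with
  | base => exact le_rfl
  | succ j _ ih =>
    refine ih.trans ?_
    have h1 := cbin_succ j
    have h2 : cbin (j + 1) = cbin j * (2 * j + 1) / (2 * j + 2) := by
      rw [← h1]; field_simp
    rw [h2, div_pow, mul_pow, mul_div_assoc, mul_assoc]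
    refine mul_le_mul_of_nonneg_left ?_ (sq_nonneg _)
    push_cast
    rw [div_mul_eq_mul_div, le_div_iff₀ (by positivity)]
    nlinarith

lemma choose_mul_oddFac {m k : ℕ} (h : k ≤ m) :
    (m.choose k : ℝ) * oddFac (m - k) * (2 ^ k * k.factorial) = oddFac m * (cbin (m - k) / cbin m) := by
  have h1 : (m.choose k : ℝ) = m.factorial / (k.factorial * (m - k).factorial) :=
    Nat.cast_choose ℝ h
  have h2 : (2:ℝ) ^ m = 2 ^ k * 2 ^ (m - k) := by rw [← pow_add, Nat.add_sub_cancel' h]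
  have := (oddFac_pos m).ne'
  unfold cbin
  rw [h1, h2]
  field_simp

end OddFactorials

section StirlingErrors

/-- The logarithmic error term of the Stirling approximation of `oddFac`. -/
noncomputable def stirErr (N : ℕ) : ℝ :=
  Real.log (oddFac N) - N * Real.log N - N * Real.log 2 + N

lemma log_le_half_sub_inv {x : ℝ} (hx : 1 ≤ x) : Real.log x ≤ (x - x⁻¹) / 2 := by
  rw [← Real.sinh_log (by linarith)]
  exact Real.self_le_sinh_iff.2 (Real.log_nonneg hx)

lemma abs_stirErr_succ_sub {N : ℕ} (hN : 1 ≤ N) :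
    |stirErr (N + 1) - stirErr N| ≤ 1 / (4 * (N:ℝ) ^ 2) := by
  have hN' : (1:ℝ) ≤ N := by exact_mod_cast hN
  have e : stirErr (N + 1) - stirErr N = 1 - Real.log ((2 * N + 2) / (2 * N + 1))
      - N * Real.log (1 + 1 / N) := by
    unfold stirErr
    rw [oddFac_succ, Real.log_mul (by positivity) (oddFac_pos N).ne',
      Real.log_div (by positivity) (by positivity),
      show (1:ℝ) + 1 / N = (N + 1) / N by field_simp,
      show (2:ℝ) * N + 2 = 2 * (N + 1) by ring,
      Real.log_div (by positivity) (by positivity), Real.log_mul (by norm_num) (by positivity)]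
    push_cast; ring
  have h1 : 1 / (2 * (N:ℝ) + 2) ≤ Real.log ((2 * N + 2) / (2 * N + 1)) := by
    refine le_trans (le_of_eq ?_) (Real.one_sub_inv_le_log_of_pos (by positivity))
    field_simp
    ring
  have h2 : Real.log ((2 * N + 2) / (2 * N + 1)) ≤ 1 / (2 * (N:ℝ) + 1) := by
    refine (Real.log_le_sub_one_of_pos (by positivity)).trans (le_of_eq ?_)
    field_simp
    ring
  have h3 : 2 * (N:ℝ) / (2 * N + 1) ≤ N * Real.log (1 + 1 / N) := by
    have := Real.le_log_one_add_of_nonneg (x := 1 / (N:ℝ)) (by positivity)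
    calc 2 * (N:ℝ) / (2 * N + 1) = N * (2 * (1 / N) / (1 / N + 2)) := by field_simp; ring
      _ ≤ _ := by gcongr
  have h4 : N * Real.log (1 + 1 / N) ≤ (2 * (N:ℝ) + 1) / (2 * N + 2) := by
    have := log_le_half_sub_inv (x := 1 + 1 / (N:ℝ)) (by
      have : 0 ≤ 1 / (N:ℝ) := by positivity
      linarith)
    calc N * Real.log (1 + 1 / N) ≤ N * ((1 + 1 / (N:ℝ) - (1 + 1 / (N:ℝ))⁻¹) / 2) := by gcongr
      _ = _ := by field_simp; ring
  have e1 : 2 * (N:ℝ) / (2 * N + 1) = 1 - 1 / (2 * N + 1) := by field_simp; ring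
  have e2 : (2 * (N:ℝ) + 1) / (2 * N + 2) = 1 - 1 / (2 * N + 2) := by field_simp; ring
  have e3 : 1 / (2 * (N:ℝ) + 1) - 1 / (2 * N + 2) ≤ 1 / (4 * (N:ℝ) ^ 2) := by
    have : 1 / (2 * (N:ℝ) + 1) - 1 / (2 * N + 2) = 1 / ((2 * N + 1) * (2 * N + 2)) := by
      field_simp; ring
    rw [this]
    refine one_div_le_one_div_of_le (by positivity) ?_
    nlinarith
  rw [e, abs_le]
  rw [e1] at h3
  rw [e2] at h4
  constructor <;> linarith

lemma abs_stirErr_add_sub {N : ℕ} (hN : 1 ≤ N) (j : ℕ) :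
    |stirErr (N + j) - stirErr N| ≤ j / (4 * (N:ℝ) ^ 2) := by
  have hN' : (1:ℝ) ≤ N := by exact_mod_cast hN
  induction j with
  | zero => simp
  | succ j ih =>
    have h := abs_stirErr_succ_sub (N := N + j) (by omega)
    have h2 : 1 / (4 * ((N + j : ℕ):ℝ) ^ 2) ≤ 1 / (4 * (N:ℝ) ^ 2) := by
      refine one_div_le_one_div_of_le (by positivity) ?_
      push_cast
      have : (0:ℝ) ≤ j := Nat.cast_nonneg j
      gcongr
      linarith
    have h3 := abs_sub_le (stirErr (N + j + 1)) (stirErr (N + j)) (stirErr N)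
    rw [← add_assoc]
    calc _ ≤ _ := h3
      _ ≤ 1 / (4 * (N:ℝ) ^ 2) + j / (4 * (N:ℝ) ^ 2) := by linarith
      _ = _ := by push_cast; ring

lemma log_oddFac (N : ℕ) :
    Real.log (oddFac N) = stirErr N + N * Real.log N + N * Real.log 2 - N := by
  unfold stirErr; ring

lemma oddFac_ratio_le {a m : ℕ} (ha : 1 ≤ a) (hm : 1 ≤ m) :
    oddFac (m * a) * oddFac (m * (a + 2)) / oddFac (m * (a + 1)) ^ 2
        * (((a:ℝ) + 1) / (a + 2)) ^ (2 * m)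
      ≤ Real.exp (1 / m) * ((a:ℝ) * (a + 2) / (a + 1) ^ 2) ^ (m * a) := by
  have ha' : (1:ℝ) ≤ a := by exact_mod_cast ha
  have hm' : (1:ℝ) ≤ m := by exact_mod_cast hm
  have p1 := oddFac_pos (m * a)
  have p2 := oddFac_pos (m * (a + 2))
  have p3 := oddFac_pos (m * (a + 1))
  rw [← Real.log_le_log_iff (by positivity) (by positivity),
    Real.log_mul (by positivity) (by positivity), Real.log_mul (by positivity) (by positivity),
    Real.log_div (by positivity) (by positivity), Real.log_mul (by positivity) (by positivity),
    Real.log_pow, Real.log_pow, Real.log_pow, Real.log_exp,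
    Real.log_div (by positivity) (by positivity), Real.log_div (by positivity) (by positivity),
    Real.log_mul (by positivity) (by positivity), Real.log_pow, log_oddFac, log_oddFac, log_oddFac]
  have hX : 1 ≤ m * a := Nat.mul_pos hm ha
  have s1 := abs_stirErr_add_sub hX m
  have s2 := abs_stirErr_add_sub (N := m * a + m) (by omega) m
  rw [show m * a + m + m = m * (a + 2) by ring, show m * a + m = m * (a + 1) by ring] at s2
  rw [show m * a + m = m * (a + 1) by ring] at s1
  have b1 : (m:ℝ) / (4 * ((m * a : ℕ) : ℝ) ^ 2) ≤ 1 / (2 * m) := by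
    push_cast
    rw [div_le_div_iff₀ (by positivity) (by positivity)]
    have : (1:ℝ) ≤ (a:ℝ) ^ 2 := one_le_pow₀ ha'
    nlinarith [mul_le_mul_of_nonneg_left this (sq_nonneg (m:ℝ))]
  have b2 : (m:ℝ) / (4 * ((m * (a + 1) : ℕ) : ℝ) ^ 2) ≤ 1 / (2 * m) := by
    push_cast
    rw [div_le_div_iff₀ (by positivity) (by positivity)]
    have : (1:ℝ) ≤ ((a:ℝ) + 1) ^ 2 := one_le_pow₀ (by linarith)
    nlinarith [mul_le_mul_of_nonneg_left this (sq_nonneg (m:ℝ))]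
  have s3 := (abs_le.1 (s1.trans b1)).1
  have s4 := (abs_le.1 (s2.trans b2)).2
  have e1 : (1:ℝ) / m = 1 / (2 * m) + 1 / (2 * m) := by field_simp; norm_num
  push_cast
  rw [Real.log_mul (by positivity) (by positivity), Real.log_mul (by positivity) (by positivity),
    Real.log_mul (by positivity) (by positivity), e1]
  linarith

end StirlingErrors

section PairExponent

/-- The exponent for pairs of matchings sharing a proportion `x` of edges. -/
noncomputable def lamx (a x : ℝ) : ℝ :=
  lam (a * (a - 1 + 2 * x) / (a + x)) ((x * (a + 1) ^ 2 / 2 + (1 - x) * a ^ 2) / (a + x))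

lemma abs_lamx_sub_le {a x y : ℝ} (ha : 1 ≤ a) (hx0 : 0 ≤ x) (hx1 : x ≤ 1) (hy0 : 0 ≤ y)
    (hy1 : y ≤ 1) : |lamx a x - lamx a y| ≤ 2 * |x - y| := by
  have px : 0 < a + x := by linarith
  have py : 0 < a + y := by linarith
  set c := a * (a + 1) / ((a + x) * (a + y)) with hc
  set b := 2 * (a + 2) - (a + 1) * (a / (a + x) + a / (a + y)) with hb
  have e : lamx a x - lamx a y = (x - y) * (c / 4 * b) := by
    rw [hc, hb]; unfold lamx lam; field_simp; ring
  have u1 : a / (a + x) ≤ 1 := by rw [div_le_one px]; linarith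
  have u2 : a / (a + y) ≤ 1 := by rw [div_le_one py]; linarith
  have l1 : a / (a + 1) ≤ a / (a + x) := by gcongr
  have l2 : a / (a + 1) ≤ a / (a + y) := by gcongr
  have l3 : (a + 1) * (a / (a + 1)) = a := by field_simp
  have hb0 : 0 ≤ b := by rw [hb]; nlinarith
  have hb4 : b ≤ 4 := by rw [hb]; nlinarith
  have hc0 : 0 ≤ c := by rw [hc]; positivity
  have hc2 : c ≤ 2 := by
    rw [hc, div_le_iff₀ (by positivity)]
    nlinarith [mul_nonneg hx0 hy0, mul_nonneg (by linarith : 0 ≤ a) (by linarith : 0 ≤ x + y)]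
  rw [e, abs_mul, mul_comm, abs_of_nonneg (by positivity)]
  refine mul_le_mul_of_nonneg_right ?_ (abs_nonneg _)
  nlinarith [mul_le_mul hc2 hb4 hb0 (by norm_num : (0:ℝ) ≤ 2)]

lemma lamx_one {a : ℝ} (ha : 1 ≤ a) : lamx a 1 = ((a + 2) ^ 2 - 2) / 4 := by
  have : a + 1 ≠ 0 := by linarith
  unfold lamx lam
  field_simp
  ring

lemma lamx_centre {a : ℝ} (ha : 1 ≤ a) : lamx a (1 / (a + 2))
    = ((a + 2) ^ 2 - 5) / 4 + 1 / (2 * (a + 1)) + 1 / (4 * (a + 1) ^ 2) := by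
  have h1 : a + 1 ≠ 0 := by linarith
  have h2 : a + 2 ≠ 0 := by linarith
  have e : a + 1 / (a + 2) = (a + 1) ^ 2 / (a + 2) := by field_simp; ring
  unfold lamx lam
  rw [e]
  field_simp
  ring

end PairExponent

section OverlapFactor

lemma cbin_ratio_le_of_small {m k : ℕ} (hm : 1 ≤ m) (hk : 2 * k ≤ m) {x : ℝ} (hx1 : x < 1) :
    cbin (m - k) / cbin m ≤ (Real.sqrt (1 - x))⁻¹ * (1 + |(k:ℝ) / m - x|) := by
  have hm' : (1:ℝ) ≤ m := by exact_mod_cast hm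
  have hk' : 2 * (k:ℝ) ≤ m := by exact_mod_cast hk
  have p := cbin_pos m
  have pj := cbin_pos (m - k)
  have h := cbin_sq_mul_mono (Nat.sub_le m k)
  rw [Nat.cast_sub (by omega)] at h
  have hx : 0 < 1 - x := by linarith
  set z := (k:ℝ) / m with hz
  have hz2 : z ≤ 1 / 2 := by rw [hz, div_le_iff₀ (by positivity)]; linarith
  have hkz : (k:ℝ) = z * m := by rw [hz]; field_simp
  rw [hkz] at h
  have h1 : (cbin (m - k) / cbin m) ^ 2 * (1 - z) ≤ 1 := by
    rw [div_pow, div_mul_eq_mul_div, div_le_one (by positivity)]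
    have : cbin (m - k) ^ 2 * (1 - z) * m ≤ cbin m ^ 2 * m := by linarith
    exact le_of_mul_le_mul_right this (by linarith)
  have h2 : 1 - x ≤ (1 - z) * (1 + |z - x|) ^ 2 := by
    have h3 := le_abs_self (z - x)
    have h4 := abs_nonneg (z - x)
    nlinarith [mul_nonneg h4 h4, mul_le_mul_of_nonneg_left hz2 h4,
      mul_nonneg (by linarith : 0 ≤ 1 - z) (mul_nonneg h4 h4)]
  rw [← pow_le_pow_iff_left₀ (by positivity) (by positivity) two_ne_zero, mul_pow, inv_pow,
    Real.sq_sqrt hx.le, inv_mul_eq_div, le_div_iff₀ hx]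
  have hr := sq_nonneg (cbin (m - k) / cbin m)
  calc (cbin (m - k) / cbin m) ^ 2 * (1 - x)
      ≤ (cbin (m - k) / cbin m) ^ 2 * ((1 - z) * (1 + |z - x|) ^ 2) := by gcongr
    _ = (cbin (m - k) / cbin m) ^ 2 * (1 - z) * (1 + |z - x|) ^ 2 := by ring
    _ ≤ 1 * (1 + |z - x|) ^ 2 := by gcongr
    _ = _ := one_mul _

lemma cbin_zero : cbin 0 = 1 := by simp [cbin, oddFac_zero]

lemma cbin_le_one (j : ℕ) : cbin j ≤ 1 := by
  induction j with
  | zero => rw [cbin_zero]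
  | succ j ih =>
    have h := cbin_succ j
    have := (cbin_pos j).le
    have h1 : cbin (j + 1) * (2 * j + 2) ≤ 1 * (2 * j + 2) := by rw [h]; nlinarith
    exact le_of_mul_le_mul_right h1 (by positivity)

lemma cbin_ratio_le {m : ℕ} (hm : 1 ≤ m) (j : ℕ) : cbin j / cbin m ≤ 2 * Real.sqrt m := by
  have p := cbin_pos m
  have h := cbin_sq_mul_mono hm
  have h1 : cbin 1 = 1 / 2 := by
    have := cbin_succ 0
    rw [cbin_zero] at this
    norm_num at this
    linarith
  rw [h1] at h
  rw [div_le_iff₀ p]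
  refine (cbin_le_one j).trans ?_
  rw [← pow_le_pow_iff_left₀ (by norm_num) (by positivity) two_ne_zero, mul_pow, mul_pow,
    Real.sq_sqrt (by positivity)]
  push_cast at h
  nlinarith

lemma exp_le_one_add_mul {z : ℝ} (h0 : 0 ≤ z) (h3 : z ≤ 3) : Real.exp z ≤ 1 + 21 * z := by
  have h1 := Real.add_one_le_exp (-z)
  have h2 : Real.exp z ≤ 21 := by
    have := Real.exp_one_lt_d9
    calc Real.exp z ≤ Real.exp 3 := Real.exp_le_exp.2 h3
      _ = Real.exp 1 ^ 3 := by rw [← Real.exp_nat_mul]; norm_num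
      _ ≤ 2.7182818286 ^ 3 := by gcongr
      _ ≤ 21 := by norm_num
  have h4 : Real.exp z * Real.exp (-z) = 1 := by rw [← Real.exp_add]; simp
  nlinarith [Real.exp_pos z]

/-- The overlap factor, with the bound on the number of matchings with a prescribed overlap. -/
noncomputable def ovl (a : ℝ) (m k : ℕ) : ℝ :=
  cbin (m - k) / cbin m
    * (if 2 * k ≤ m then Real.exp (-(1 / 2) + kap 2 (2 * ((m:ℝ) - k)) / 2) else 1)
    * Real.exp (-lamx a (k / m))

lemma ovl_le {a κ : ℝ} (ha : 2 ≤ a) {m k : ℕ} (hm : 1 ≤ m) (hk : k ≤ m) (hκ0 : 0 ≤ κ)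
    (hκ1 : κ ≤ 1) (hκ : 2 * k ≤ m → kap 2 (2 * ((m:ℝ) - k)) / 2 ≤ κ) :
    ovl a m k ≤ (Real.sqrt (1 - 1 / (a + 2)))⁻¹ * Real.exp (-(1 / 2) - lamx a (1 / (a + 2)))
      * (1 + 21 * κ + 2000 * |(k:ℝ) / m - 1 / (a + 2)|
        + 1000 * Real.sqrt m * ((k:ℝ) / m - 1 / (a + 2)) ^ 2) := by
  have hm' : (1:ℝ) ≤ m := by exact_mod_cast hm
  have hk' : (k:ℝ) ≤ m := by exact_mod_cast hk
  set x := 1 / (a + 2) with hx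
  set z := (k:ℝ) / m with hz
  have hz0 : 0 ≤ z := by positivity
  have hz1 : z ≤ 1 := by rw [hz, div_le_one (by positivity)]; exact hk'
  have hx0 : 0 < x := by rw [hx]; positivity
  have hx4 : x ≤ 1 / 4 := by
    rw [hx]; exact one_div_le_one_div_of_le (by norm_num) (by linarith)
  have hl := abs_lamx_sub_le (by linarith : 1 ≤ a) hz0 hz1 hx0.le (by linarith : x ≤ 1)
  have hl' := (abs_le.1 hl).1
  have hy1 : |z - x| ≤ 1 := by rw [abs_le]; constructor <;> linarith
  have hy0 := abs_nonneg (z - x)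
  set y := |z - x| with hy
  set E := Real.exp (-(1 / 2) - lamx a x) with hE
  have hE0 : 0 < E := Real.exp_pos _
  have hs0 : 0 < Real.sqrt (1 - x) := Real.sqrt_pos.2 (by linarith)
  have hsm := Real.sqrt_nonneg (m:ℝ)
  have hr0 : 0 ≤ cbin (m - k) / cbin m := (div_pos (cbin_pos _) (cbin_pos _)).le
  have hy2 : (z - x) ^ 2 = y ^ 2 := (sq_abs _).symm
  rw [hy2]
  unfold ovl
  rw [← hz]
  split_ifs with hc
  · have hq := hκ hc
    have h1 := cbin_ratio_le_of_small hm hc (by linarith : x < 1)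
    rw [← hz, ← hy] at h1
    have h2 : Real.exp (-(1 / 2) + kap 2 (2 * ((m:ℝ) - k)) / 2) * Real.exp (-lamx a z)
        ≤ E * (Real.exp (2 * y) * Real.exp κ) := by
      rw [hE, ← Real.exp_add, ← Real.exp_add, ← Real.exp_add]
      refine Real.exp_le_exp.2 ?_
      linarith
    have h3 : 1 + y ≤ Real.exp y := by linarith [Real.add_one_le_exp y]
    have h4 : Real.exp y * Real.exp (2 * y) ≤ 1 + 63 * y := by
      rw [← Real.exp_add]
      have := exp_le_one_add_mul (z := y + 2 * y) (by linarith) (by linarith)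
      linarith
    have h5 := exp_le_one_add_mul hκ0 (by linarith)
    calc _ = cbin (m - k) / cbin m * (Real.exp (-(1 / 2) + kap 2 (2 * ((m:ℝ) - k)) / 2)
          * Real.exp (-lamx a z)) := by ring
      _ ≤ ((Real.sqrt (1 - x))⁻¹ * (1 + y)) * (E * (Real.exp (2 * y) * Real.exp κ)) :=
          mul_le_mul h1 h2 (by positivity) (by positivity)
      _ ≤ ((Real.sqrt (1 - x))⁻¹ * Real.exp y) * (E * (Real.exp (2 * y) * Real.exp κ)) := by
          gcongr
      _ = (Real.sqrt (1 - x))⁻¹ * E * (Real.exp y * Real.exp (2 * y) * Real.exp κ) := by ring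
      _ ≤ (Real.sqrt (1 - x))⁻¹ * E * ((1 + 63 * y) * (1 + 21 * κ)) := by gcongr
      _ ≤ _ := by
          refine mul_le_mul_of_nonneg_left ?_ (by positivity)
          have : 0 ≤ 1000 * Real.sqrt m * y ^ 2 := by positivity
          nlinarith [mul_le_mul_of_nonneg_left hκ1 hy0]
  · have h1 := cbin_ratio_le hm (m - k)
    have hz2 : 1 / 2 ≤ z := by
      rw [hz, le_div_iff₀ (by positivity)]
      have : (m:ℝ) ≤ 2 * k := by exact_mod_cast (by omega : m ≤ 2 * k)
      linarith
    have hy4 : 1 / 4 ≤ y := by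
      have := le_abs_self (z - x)
      linarith
    have h2 : Real.exp (-lamx a z) ≤ E * 21 := by
      have h3 : Real.exp (-lamx a z) ≤ E * Real.exp (5 / 2) := by
        rw [hE, ← Real.exp_add]
        refine Real.exp_le_exp.2 ?_
        linarith
      have h4 : Real.exp (5 / 2) ≤ 21 := by
        have := Real.exp_one_lt_d9
        calc Real.exp (5 / 2) ≤ Real.exp 3 := Real.exp_le_exp.2 (by norm_num)
          _ = Real.exp 1 ^ 3 := by rw [← Real.exp_nat_mul]; norm_num
          _ ≤ 2.7182818286 ^ 3 := by gcongr
          _ ≤ 21 := by norm_num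
      exact h3.trans (by gcongr)
    have h5 : 1 ≤ (Real.sqrt (1 - x))⁻¹ := by
      rw [one_le_inv₀ hs0]
      exact (Real.sqrt_le_sqrt (by linarith)).trans_eq Real.sqrt_one
    rw [mul_one]
    calc _ ≤ (2 * Real.sqrt m) * (E * 21) := mul_le_mul h1 h2 (by positivity) (by positivity)
      _ = 1 * E * (42 * Real.sqrt m) := by ring
      _ ≤ (Real.sqrt (1 - x))⁻¹ * E * (1000 * Real.sqrt m * y ^ 2) := by
          gcongr ?_ * _ * ?_
          nlinarith [mul_le_mul_of_nonneg_left (by nlinarith : 1 / 16 ≤ y ^ 2) hsm]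
      _ ≤ _ := by
          refine mul_le_mul_of_nonneg_left ?_ (by positivity)
          nlinarith

end OverlapFactor

section OverlapSum

lemma kap_two_le {d : ℕ} (hd : 10000 ≤ d) {D : ℝ} (hD : (d:ℝ) ^ 9 ≤ D) :
    kap 2 D ≤ 1 / (d:ℝ) ^ 4 := by
  have hd' : (10000:ℝ) ≤ d := by exact_mod_cast hd
  have hD0 : 0 < D := lt_of_lt_of_le (by positivity) hD
  have h1 : (d:ℝ) ^ 8 ≤ D ^ (10 / 11 : ℝ) := by
    calc (d:ℝ) ^ 8 = (d:ℝ) ^ ((8:ℕ):ℝ) := (Real.rpow_natCast _ _).symm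
      _ ≤ (d:ℝ) ^ (((9:ℕ):ℝ) * (10 / 11 : ℝ)) :=
          Real.rpow_le_rpow_of_exponent_le (by linarith) (by norm_num)
      _ = ((d:ℝ) ^ 9) ^ (10 / 11 : ℝ) := by
          rw [Real.rpow_mul (by positivity), Real.rpow_natCast]
      _ ≤ _ := Real.rpow_le_rpow (by positivity) hD (by norm_num)
  have h2 := kap_mul 2 hD0
  have h3 := kap_nonneg 2 hD0.le
  have h4 := mul_le_mul_of_nonneg_left h1 h3
  rw [h2] at h4
  have h5 : (10000:ℝ) ^ 4 ≤ (d:ℝ) ^ 4 := by gcongr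
  rw [le_div_iff₀ (by positivity)]
  have h6 : kap 2 D * (d:ℝ) ^ 4 * (d:ℝ) ^ 4 ≤ 1 * (d:ℝ) ^ 4 := by nlinarith
  exact le_of_mul_le_mul_right h6 (by positivity)

lemma sum_mul_ovl_le {a m : ℕ} (ha : 9998 ≤ a) (hm : ((a:ℝ) + 2) ^ 10 ≤ 2 * m) {w : ℕ → ℝ}
    (hw : ∀ k, 0 ≤ w k) (h1 : ∑ k ∈ Finset.range (m + 1), w k ≤ 1)
    (h2 : ∑ k ∈ Finset.range (m + 1), w k * ((k:ℝ) / m - 1 / ((a:ℝ) + 2)) ^ 2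
      ≤ 3 / (m:ℝ)) :
    ∑ k ∈ Finset.range (m + 1), w k * ovl a m k
      ≤ (Real.sqrt (1 - 1 / ((a:ℝ) + 2)))⁻¹ * Real.exp (-(1 / 2) - lamx a (1 / ((a:ℝ) + 2)))
        * (1 + 14000 / ((a:ℝ) + 2) ^ 4) := by
  have ha' : (9998:ℝ) ≤ a := by exact_mod_cast ha
  have ha2 : (2:ℝ) ≤ a := by linarith
  have hd' : (10000:ℝ) ≤ (a:ℝ) + 2 := by linarith
  set d : ℝ := (a:ℝ) + 2 with hd
  have hd4 : (10000:ℝ) ^ 4 ≤ d ^ 4 := by gcongr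
  have hm9 : d ^ 9 ≤ m := by
    have : 0 ≤ d ^ 9 := by positivity
    nlinarith
  have hm1 : 1 ≤ m := by
    have : 0 < ((a:ℝ) + 2) ^ 10 := by positivity
    have : (0:ℝ) < m := by linarith
    exact_mod_cast this
  have hm1' : (1:ℝ) ≤ m := by exact_mod_cast hm1
  set C := (Real.sqrt (1 - 1 / d))⁻¹ * Real.exp (-(1 / 2) - lamx a (1 / d)) with hC
  have hC0 : 0 ≤ C := by positivity
  set κ := 1 / d ^ 4 with hκ
  have hκ0 : 0 ≤ κ := by positivity
  have hκ1 : κ ≤ 1 := by rw [hκ, div_le_one (by positivity)]; linarith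
  have hsm : 0 ≤ Real.sqrt (m:ℝ) := Real.sqrt_nonneg _
  have hss : Real.sqrt (m:ℝ) * Real.sqrt m = m := Real.mul_self_sqrt (by positivity)
  have hpt : ∀ k ∈ Finset.range (m + 1), w k * ovl a m k
      ≤ C * ((1 + 1021 * κ) * w k
        + (1000 * d ^ 4 + 1000 * Real.sqrt m) * (w k * ((k:ℝ) / m - 1 / d) ^ 2)) := by
    intro k hk
    have hkm : k ≤ m := Nat.lt_succ_iff.1 (Finset.mem_range.1 hk)
    have h := ovl_le ha2 hm1 hkm hκ0 hκ1 (fun h2k => by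
      have h2k' : 2 * (k:ℝ) ≤ m := by exact_mod_cast h2k
      have := kap_two_le (d := a + 2) (by omega) (D := 2 * ((m:ℝ) - k)) (by push_cast; linarith)
      have h0 := kap_nonneg 2 (by linarith : 0 ≤ 2 * ((m:ℝ) - k))
      push_cast at this
      linarith)
    rw [← hd, ← hC] at h
    set y := (k:ℝ) / m - 1 / d with hy
    have hyb : 2 * |y| ≤ κ + d ^ 4 * y ^ 2 := by
      have hk4 : κ * d ^ 4 = 1 := by rw [hκ]; field_simp
      have h5 : 0 ≤ (d ^ 4 * |y| - 1) ^ 2 := sq_nonneg _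
      have h6 : |y| ^ 2 = y ^ 2 := sq_abs y
      have h7 : (2 * |y|) * d ^ 4 ≤ (κ + d ^ 4 * y ^ 2) * d ^ 4 := by
        rw [← h6]; nlinarith
      exact le_of_mul_le_mul_right h7 (by positivity)
    calc w k * ovl a m k ≤ w k * (C * (1 + 21 * κ + 2000 * |y| + 1000 * Real.sqrt m * y ^ 2)) :=
          mul_le_mul_of_nonneg_left h (hw k)
      _ ≤ w k * (C * (1 + 21 * κ + 1000 * (κ + d ^ 4 * y ^ 2) + 1000 * Real.sqrt m * y ^ 2)) := by
          refine mul_le_mul_of_nonneg_left (mul_le_mul_of_nonneg_left ?_ hC0) (hw k)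
          linarith
      _ = _ := by ring
  refine (Finset.sum_le_sum hpt).trans ?_
  rw [← Finset.mul_sum, Finset.sum_add_distrib, ← Finset.mul_sum, ← Finset.mul_sum]
  refine mul_le_mul_of_nonneg_left ?_ hC0
  have e1 : d ^ 4 * (3 / m) ≤ 1 * κ := by
    rw [hκ, mul_div_assoc', one_mul, div_le_div_iff₀ (by positivity) (by positivity)]
    have : 0 ≤ d ^ 8 := by positivity
    nlinarith [mul_le_mul_of_nonneg_left hd' this]
  have e2 : Real.sqrt m * (3 / m) ≤ 1 * κ := by
    have h5 : 3 * d ^ 4 ≤ Real.sqrt m := by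
      refine Real.le_sqrt_of_sq_le ?_
      have : 0 ≤ d ^ 8 := by positivity
      nlinarith [mul_le_mul_of_nonneg_left hd' this]
    rw [hκ, mul_div_assoc', one_mul, div_le_div_iff₀ (by positivity) (by positivity)]
    nlinarith
  calc _ ≤ (1 + 1021 * κ) * 1 + (1000 * d ^ 4 + 1000 * Real.sqrt m) * (3 / m) := by gcongr
    _ = 1 + 1021 * κ + 1000 * (d ^ 4 * (3 / m)) + 1000 * (Real.sqrt m * (3 / m)) := by ring
    _ ≤ 1 + 14000 * κ := by linarith
    _ = _ := by rw [hκ]; ring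

lemma shift_sq_le {k m q c : ℝ} (hq : q ≠ 0) (hc0 : 0 ≤ c) (hc : c ≤ 1 / 4) (hm : 1 ≤ m) :
    (k / m - 1 / q) ^ 2 ≤ 2 / m ^ 2 * (k - (m / q + c)) ^ 2 + 1 / m := by
  have e : k / m - 1 / q = (k - (m / q + c)) / m + c / m := by field_simp; ring
  rw [e]
  set u := k - (m / q + c) with hu
  have h1 : (u / m + c / m) ^ 2 ≤ 2 * (u / m) ^ 2 + 2 * (c / m) ^ 2 := by
    nlinarith [sq_nonneg (u / m - c / m)]
  have h2 : 2 * (c / m) ^ 2 ≤ 1 / m := by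
    rw [div_pow, mul_div_assoc', div_le_div_iff₀ (by positivity) (by positivity)]
    have h3 : c ^ 2 ≤ 1 / 2 := by nlinarith
    have h4 : c ^ 2 * m ≤ 1 / 2 * m := by gcongr
    nlinarith
  calc _ ≤ _ := h1
    _ = 2 / m ^ 2 * u ^ 2 + 2 * (c / m) ^ 2 := by ring
    _ ≤ _ := by linarith

lemma sum_nb_mul_ovl_le {a m : ℕ} (ha : 9998 ≤ a) (hm : ((a:ℝ) + 2) ^ 10 ≤ 2 * m) :
    (1 - 1 / ((a:ℝ) + 1) ^ 2) ^ (((m * a : ℕ) : ℝ) + 1 / 2)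
      * ∑ k ∈ Finset.range (m + 1),
        nb (((m * a : ℕ) : ℝ) + 1 / 2) (1 / ((a:ℝ) + 1) ^ 2) k * ovl a m k
      ≤ (Real.sqrt (1 - 1 / ((a:ℝ) + 2)))⁻¹ * Real.exp (-(1 / 2) - lamx a (1 / ((a:ℝ) + 2)))
        * (1 + 14000 / ((a:ℝ) + 2) ^ 4) := by
  have ha2 : (9998:ℝ) ≤ a := by exact_mod_cast ha
  have hm1 : 1 ≤ m := by
    have : 0 < ((a:ℝ) + 2) ^ 10 := by positivity
    have : (0:ℝ) < m := by linarith
    exact_mod_cast this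
  have hm1' : (1:ℝ) ≤ m := by exact_mod_cast hm1
  set x : ℝ := ((m * a : ℕ) : ℝ) + 1 / 2 with hx
  set ρ : ℝ := 1 / ((a:ℝ) + 1) ^ 2 with hρ
  have hx0 : 0 ≤ x := by positivity
  have hρ0 : 0 ≤ ρ := by positivity
  have hρ1 : ρ < 1 := by
    rw [hρ, div_lt_one (by positivity)]; nlinarith
  have e1 : ρ / (1 - ρ) = 1 / (a * ((a:ℝ) + 2)) := by
    have h3 : ((a:ℝ) + 1) ^ 2 - 1 ≠ 0 := by nlinarith
    have h4 : (a:ℝ) ≠ 0 := by linarith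
    have h5 : (a:ℝ) + 2 ≠ 0 := by linarith
    have h6 : 1 - ρ = a * (a + 2) / ((a:ℝ) + 1) ^ 2 := by rw [hρ]; field_simp; ring
    rw [h6, hρ]; field_simp
  have e2 : x * ρ / (1 - ρ) = m / ((a:ℝ) + 2) + 1 / (2 * (a * ((a:ℝ) + 2))) := by
    rw [mul_div_assoc, e1, hx]; push_cast; field_simp
  have e3 : ρ * m / (1 - ρ) = m / (a * ((a:ℝ) + 2)) := by
    rw [mul_comm, mul_div_assoc, e1]; ring
  have b1 : (m:ℝ) / ((a:ℝ) + 2) ≤ m / 4 := by gcongr; linarith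
  have b2 : (m:ℝ) / (a * ((a:ℝ) + 2)) ≤ m / 4 := by gcongr; nlinarith
  have b3 : 1 / (2 * (a * ((a:ℝ) + 2))) ≤ 1 / 4 := by gcongr; nlinarith
  have b30 : 0 ≤ 1 / (2 * (a * ((a:ℝ) + 2))) := by positivity
  have hp : 0 < (1 - ρ) ^ x := Real.rpow_pos_of_pos (by linarith) _
  have s1 := sum_nb_le hx0 hρ0 hρ1 (Finset.range (m + 1))
  have s2 := sum_nb_var_le hx0 hρ0 hρ1 m (by rw [e2]; linarith)
  rw [e3, e2] at s2
  set c := 1 / (2 * (a * ((a:ℝ) + 2))) with hc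
  have hS0 : 0 ≤ ∑ k ∈ Finset.range (m + 1), nb x ρ k :=
    Finset.sum_nonneg fun k _ => nb_nonneg hx0 hρ0 k
  have t1 : (1 - ρ) ^ x * ∑ k ∈ Finset.range (m + 1), nb x ρ k ≤ 1 := by
    calc _ ≤ (1 - ρ) ^ x * ((1 - ρ) ^ x)⁻¹ := by gcongr
      _ = 1 := mul_inv_cancel₀ hp.ne'
  have t2 : (1 - ρ) ^ x * ∑ k ∈ Finset.range (m + 1),
      nb x ρ k * ((k:ℝ) - (m / ((a:ℝ) + 2) + c)) ^ 2 ≤ m := by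
    calc _ ≤ (1 - ρ) ^ x * ((m / ((a:ℝ) + 2) + c + m / (a * ((a:ℝ) + 2)))
            * ∑ k ∈ Finset.range (m + 1), nb x ρ k) := by gcongr
      _ ≤ (1 - ρ) ^ x * (m * ∑ k ∈ Finset.range (m + 1), nb x ρ k) := by
          gcongr; linarith
      _ = m * ((1 - ρ) ^ x * ∑ k ∈ Finset.range (m + 1), nb x ρ k) := by ring
      _ ≤ m * 1 := by gcongr
      _ = m := mul_one _
  have key := sum_mul_ovl_le ha hm (w := fun k => (1 - ρ) ^ x * nb x ρ k)
    (fun k => mul_nonneg hp.le (nb_nonneg hx0 hρ0 k)) (by rw [← Finset.mul_sum]; exact t1) (by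
      have hpt : ∀ k ∈ Finset.range (m + 1),
          (1 - ρ) ^ x * nb x ρ k * ((k:ℝ) / m - 1 / ((a:ℝ) + 2)) ^ 2
          ≤ 2 / (m:ℝ) ^ 2 * ((1 - ρ) ^ x * (nb x ρ k * ((k:ℝ) - (m / ((a:ℝ) + 2) + c)) ^ 2))
            + 1 / m * ((1 - ρ) ^ x * nb x ρ k) := by
        intro k _
        have hn := mul_nonneg hp.le (nb_nonneg hx0 hρ0 k)
        have hy : ((k:ℝ) / m - 1 / ((a:ℝ) + 2)) ^ 2
            ≤ 2 / (m:ℝ) ^ 2 * ((k:ℝ) - (m / ((a:ℝ) + 2) + c)) ^ 2 + 1 / m :=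
          shift_sq_le (by linarith : (a:ℝ) + 2 ≠ 0) b30 b3 hm1'
        calc _ ≤ (1 - ρ) ^ x * nb x ρ k
              * (2 / (m:ℝ) ^ 2 * ((k:ℝ) - (m / ((a:ℝ) + 2) + c)) ^ 2 + 1 / m) := by gcongr
          _ = _ := by ring
      refine (Finset.sum_le_sum hpt).trans ?_
      rw [Finset.sum_add_distrib, ← Finset.mul_sum, ← Finset.mul_sum, ← Finset.mul_sum,
        ← Finset.mul_sum]
      calc _ ≤ 2 / (m:ℝ) ^ 2 * m + 1 / m * 1 := by gcongr
        _ = 3 / m := by field_simp; norm_num)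
  refine le_trans (le_of_eq ?_) key
  rw [Finset.mul_sum]
  exact Finset.sum_congr rfl fun k _ => by ring

end OverlapSum

section PairCounts

set_option linter.unusedSectionVars false

variable {V : Type*} [Fintype V] [DecidableEq V] {a m : ℕ}

/-- The main term of the number of regular graphs containing two matchings with a prescribed
overlap. -/
noncomputable def pairMain (a m k : ℕ) : ℝ :=
  oddFac (m * a + k) / ((a.factorial : ℝ) ^ (2 * m) * ((a:ℝ) + 1) ^ (2 * k))
    * Real.exp (-lamx a (k / m))

lemma pairMain_pos (a m k : ℕ) : 0 < pairMain a m k := by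
  have := oddFac_pos (m * a + k)
  unfold pairMain
  positivity

/-- The main term of the number of regular graphs. -/
noncomputable def regMain (a m : ℕ) : ℝ :=
  oddFac (m * (a + 2)) / ((a + 2).factorial : ℝ) ^ (2 * m)
    * Real.exp (-((((a:ℝ) + 2) ^ 2 - 1) / 4))

lemma Regime.one_le_half_card (R : Regime V (a + 2)) (hV : Fintype.card V = 2 * m) : 1 ≤ m := by
  have h := R.card_large
  have hV' : (Fintype.card V : ℝ) = 2 * m := by exact_mod_cast hV
  rw [hV'] at h
  have : (0:ℝ) < m := by
    have : (0:ℝ) < 10 ^ 40 := by positivity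
    linarith
  exact_mod_cast this

lemma Regime.pair_large (R : Regime V (a + 2)) (hV : Fintype.card V = 2 * m) :
    ((a + 2 : ℕ) : ℝ) ^ 11 / 4 ≤ 2 * m * (a:ℝ) := by
  have h1 := R.pow_succ_le
  have h2 := R.large'
  have hV' : (Fintype.card V : ℝ) = 2 * m := by exact_mod_cast hV
  rw [hV'] at h1
  push_cast at h1 h2 ⊢
  have h3 : (m:ℝ) * (a + 2) ≤ m * (4 * a) := by
    refine mul_le_mul_of_nonneg_left ?_ (Nat.cast_nonneg m)
    linarith
  linarith

lemma extc_pair_bounds (R : Regime V (a + 2)) (hV : Fintype.card V = 2 * m)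
    {M M' : SimpleGraph V} (hM : M ∈ regs V 1) (hM' : M' ∈ regs V 1) {k : ℕ}
    (hk : ∑ v, dg (M ⊓ M') v = 2 * k) :
    pairMain a m k * (1 - qe (a + 2)) ≤ (extc (a + 2) (M ⊔ M') : ℝ) ∧
    (extc (a + 2) (M ⊔ M') : ℝ) ≤ pairMain a m k * Real.exp (qe (a + 2)) := by
  have hm := R.one_le_half_card hV
  have hm' : (1:ℝ) ≤ m := by exact_mod_cast hm
  have ha := R.large'
  push_cast at ha
  obtain ⟨h2, hD, hP, hE, hC⟩ := pair_stats (d := a + 2) (by omega) hV hM hM' hk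
  have hk0 : (0:ℝ) ≤ k := Nat.cast_nonneg k
  have hL := R.pair_large hV
  have hbig : ((a + 2 : ℕ) : ℝ) ^ 11 / 4 ≤ degSum (resid (a + 2) (M ⊔ M')) := by
    rw [hD]; push_cast; push_cast at hL; linarith
  have hgL : gL (resid (a + 2) (M ⊔ M')) (M ⊔ M') = lamx a (k / m) := by
    unfold gL lamx
    rw [hD, hP, hE]
    push_cast
    have h3 : (a:ℝ) * m + k ≠ 0 := by nlinarith
    have h4 : (a:ℝ) + k / m ≠ 0 := by have : 0 ≤ (k:ℝ) / m := by positivity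
                                      linarith
    have h5 : 2 * (m:ℝ) * (a + 2 - 2) + 2 * k ≠ 0 := by nlinarith
    congr 1
    · rw [div_eq_div_iff h5 h4]; field_simp; ring
    · rw [div_eq_div_iff h5 h4]; field_simp; ring
  have hle : ∀ v, dg (M ⊔ M') v ≤ a + 2 := fun v => (h2 v).trans (by omega)
  obtain ⟨hl, hu⟩ := extc_bounds hle R.large R.even hbig
  rw [hgL, hC, Nat.add_sub_cancel] at hl hu
  have e : ((a + 2 : ℕ) : ℝ) - 1 = a + 1 := by push_cast; ring
  rw [e, ← oddFac, ← mul_assoc] at hl hu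
  exact ⟨hl, hu⟩

lemma extc_matching_ge (R : Regime V (a + 2)) (hV : Fintype.card V = 2 * m)
    {M : SimpleGraph V} (hM : M ∈ regs V 1) :
    pairMain a m m * (1 - qe (a + 2)) ≤ (extc (a + 2) M : ℝ) := by
  have h := (extc_pair_bounds R hV hM hM (k := m) (by
    rw [inf_idem, Finset.sum_congr rfl fun v _ => mem_regs.1 hM v]
    simp [hV])).1
  rwa [sup_idem] at h

lemma card_regs_le (R : Regime V (a + 2)) (hV : Fintype.card V = 2 * m) :
    ((regs V (a + 2)).card : ℝ) ≤ regMain a m * Real.exp (qe (a + 2)) := by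
  have hm := R.one_le_half_card hV
  have hm' : (1:ℝ) ≤ m := by exact_mod_cast hm
  have ha := R.large'
  push_cast at ha
  have hr : resid (a + 2) (⊥ : SimpleGraph V) = fun _ => a + 2 := by
    funext v; unfold resid; rw [dg_bot]; rfl
  have hD : degSum (resid (a + 2) (⊥ : SimpleGraph V)) = 2 * m * ((a:ℝ) + 2) := by
    rw [hr]; unfold degSum; simp [hV]; ring
  have hP : degSq (resid (a + 2) (⊥ : SimpleGraph V)) = 2 * m * (((a:ℝ) + 2) * (a + 1)) := by
    
    rw [hr]; unfold degSq
    simp only [Finset.sum_const, Finset.card_univ, hV, nsmul_eq_mul]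
    push_cast
    ring
  have hE : edgeSum (resid (a + 2) (⊥ : SimpleGraph V)) ⊥ = 0 := by simp [edgeSum, nbSum]
  have hL := R.pair_large hV
  have hbig : ((a + 2 : ℕ) : ℝ) ^ 11 / 4 ≤ degSum (resid (a + 2) (⊥ : SimpleGraph V)) := by
    rw [hD]; linarith
  have hgL : gL (resid (a + 2) (⊥ : SimpleGraph V)) ⊥ = (((a:ℝ) + 2) ^ 2 - 1) / 4 := by
    unfold gL lam
    rw [hD, hP, hE]
    have h3 : (a:ℝ) + 2 ≠ 0 := by linarith
    field_simp
    ring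
  have hC : conf (resid (a + 2) (⊥ : SimpleGraph V))
      = oddFac (m * (a + 2)) / ((a + 2).factorial : ℝ) ^ (2 * m) := by
    rw [hr]; unfold conf oddFac
    simp only [Finset.sum_const, Finset.prod_const, Finset.card_univ, hV, smul_eq_mul]
    rw [mul_assoc]
  have hle : ∀ v, dg (⊥ : SimpleGraph V) v ≤ a + 2 := fun v => by rw [dg_bot]; omega
  have hu := (extc_bounds hle R.large R.even hbig).2
  rw [hgL, hC, ← mul_assoc] at hu
  have e : extc (a + 2) (⊥ : SimpleGraph V) = (regs V (a + 2)).card := by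
    simp [extc]
  rwa [e] at hu

lemma choose_mul_pairMain {k : ℕ} (hk : k ≤ m) :
    (m.choose k : ℝ) * (oddFac (m - k)
      * (if 2 * k ≤ m then Real.exp (-(1 / 2) + kap 2 (2 * ((m:ℝ) - k)) / 2) else 1)
      * pairMain a m k)
    = oddFac m * (oddFac (m * a) / (a.factorial : ℝ) ^ (2 * m))
      * (nb (((m * a : ℕ) : ℝ) + 1 / 2) (1 / ((a:ℝ) + 1) ^ 2) k * ovl a m k) := by
  have h1 := choose_mul_oddFac hk
  have h2 := oddFac_add (m * a) k
  unfold pairMain ovl nb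
  rw [h2]
  set J := (if 2 * k ≤ m then Real.exp (-(1 / 2) + kap 2 (2 * ((m:ℝ) - k)) / 2) else 1)
  set P := ∏ i ∈ Finset.range k, (((m * a : ℕ) : ℝ) + 1 / 2 + i)
  have e1 : (1 / ((a:ℝ) + 1) ^ 2) ^ k = 1 / ((a:ℝ) + 1) ^ (2 * k) := by
    rw [div_pow, one_pow, pow_mul]
  rw [e1]
  set E := Real.exp (-lamx a (k / m))
  have hf : (k.factorial : ℝ) ≠ 0 := by positivity
  have ht : ((a:ℝ) + 1) ^ (2 * k) ≠ 0 := by positivity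
  have hg : (a.factorial : ℝ) ^ (2 * m) ≠ 0 := by positivity
  calc _ = ((m.choose k : ℝ) * oddFac (m - k) * (2 ^ k * k.factorial))
        * (oddFac (m * a) / (a.factorial : ℝ) ^ (2 * m)) * (P * (1 / ((a:ℝ) + 1) ^ (2 * k))
          / k.factorial) * J * E := by field_simp
    _ = _ := by rw [h1]; ring

/-- The value of the sum over overlaps. -/
noncomputable def ovlTotal (a : ℝ) : ℝ :=
  (Real.sqrt (1 - 1 / (a + 2)))⁻¹ * Real.exp (-(1 / 2) - lamx a (1 / (a + 2)))
    * (1 + 14000 / (a + 2) ^ 4)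

lemma sum_extc_pair_le (R : Regime V (a + 2)) (hV : Fintype.card V = 2 * m)
    {M : SimpleGraph V} (hM : M ∈ regs V 1) :
    (∑ M' ∈ regs V 1, (extc (a + 2) (M ⊔ M') : ℝ))
        * (1 - 1 / ((a:ℝ) + 1) ^ 2) ^ (((m * a : ℕ) : ℝ) + 1 / 2)
      ≤ oddFac m * (oddFac (m * a) / (a.factorial : ℝ) ^ (2 * m)) * Real.exp (qe (a + 2))
        * ovlTotal a := by
  classical
  have hm := R.one_le_half_card hV
  have hmm : ((a:ℝ) + 2) ^ 10 ≤ 2 * m := by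
    have h := R.pow_le'
    have hV' : (Fintype.card V : ℝ) = 2 * m := by exact_mod_cast hV
    rw [hV'] at h
    push_cast at h
    exact h
  have hs := sum_matchings_le hV hM (fun M' => (extc (a + 2) (M ⊔ M') : ℝ))
    (fun k => pairMain a m k * Real.exp (qe (a + 2)))
    (fun k => oddFac (m - k)
      * (if 2 * k ≤ m then Real.exp (-(1 / 2) + kap 2 (2 * ((m:ℝ) - k)) / 2) else 1))
    (fun k _ => mul_nonneg (pairMain_pos a m k).le (Real.exp_pos _).le)
    (fun k _ M' hM' hk => (extc_pair_bounds R hV hM hM' hk).2)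
    (fun k hkm H hH hk => by
      obtain ⟨h1, h2⟩ := card_matching_inf_eq hV hkm hM hH hk
      split_ifs with hc
      · refine le_trans (le_of_eq ?_) (h2 (by omega))
        congr!
      · rw [mul_one]
        refine le_trans (le_of_eq ?_) h1
        congr!)
  have he : ∀ k ∈ Finset.range (m + 1), (m.choose k : ℝ) * (oddFac (m - k)
      * (if 2 * k ≤ m then Real.exp (-(1 / 2) + kap 2 (2 * ((m:ℝ) - k)) / 2) else 1)
      * (pairMain a m k * Real.exp (qe (a + 2))))
      = oddFac m * (oddFac (m * a) / (a.factorial : ℝ) ^ (2 * m)) * Real.exp (qe (a + 2))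
      * (nb (((m * a : ℕ) : ℝ) + 1 / 2) (1 / ((a:ℝ) + 1) ^ 2) k * ovl a m k) := by
    intro k hk
    have := choose_mul_pairMain (a := a) (Nat.lt_succ_iff.1 (Finset.mem_range.1 hk))
    linear_combination Real.exp (qe (a + 2)) * this
  rw [Finset.sum_congr rfl he, ← Finset.mul_sum] at hs
  have hn := sum_nb_mul_ovl_le (a := a) (by have := R.large; omega) hmm
  have hp : 0 ≤ (1 - 1 / ((a:ℝ) + 1) ^ 2) ^ (((m * a : ℕ) : ℝ) + 1 / 2) := by
    refine Real.rpow_nonneg ?_ _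
    rw [sub_nonneg, div_le_one (by positivity)]
    nlinarith [(Nat.cast_nonneg a : (0:ℝ) ≤ a)]
  have hq : 0 ≤ oddFac m * (oddFac (m * a) / (a.factorial : ℝ) ^ (2 * m))
      * Real.exp (qe (a + 2)) := by
    have := oddFac_pos m
    have := oddFac_pos (m * a)
    positivity
  have h1 := mul_le_mul_of_nonneg_right hs hp
  have h2 := mul_le_mul_of_nonneg_left hn hq
  refine h1.trans (le_trans (le_of_eq ?_) h2)
  ring

end PairCounts

section SecondMomentConstant

lemma exp_le_sqrt_one_sub {u : ℝ} (h0 : 0 ≤ u) (h1 : u ≤ 1 / 2) :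
    Real.exp (-(u / 2 + u ^ 2 / 4 + u ^ 3 / 6 + u ^ 4)) ≤ Real.sqrt (1 - u) := by
  have h := Real.abs_log_sub_add_sum_range_le (x := u) (by rw [abs_of_nonneg h0]; linarith) 3
  rw [abs_of_nonneg h0] at h
  norm_num [Finset.sum_range_succ] at h
  have h2 := (abs_le.1 h).1
  have h3 : u ^ 4 / (1 - u) ≤ 2 * u ^ 4 := by
    rw [div_le_iff₀ (by linarith)]
    nlinarith [pow_nonneg h0 4]
  have hp : 0 < 1 - u := by linarith
  refine Real.le_sqrt_of_sq_le ?_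
  rw [← Real.exp_nat_mul]
  calc _ ≤ Real.exp (Real.log (1 - u)) := by
        refine Real.exp_le_exp.2 ?_
        push_cast
        linarith
    _ = 1 - u := Real.exp_log hp

lemma exp_le_quadratic {z : ℝ} (h0 : 0 ≤ z) (h1 : z ≤ 1) : Real.exp z ≤ 1 + z + z ^ 2 := by
  have h := Real.abs_exp_sub_one_sub_id_le (x := z) (by rw [abs_of_nonneg h0]; exact h1)
  linarith [(abs_le.1 h).2]

lemma exp_exponent_le {a E : ℝ} (ha : 9998 ≤ a) (h0 : 0 ≤ E)
    (hE : E ≤ 1 / (6 * (a + 1) ^ 3) + 8 * 10 ^ 8 / (a + 2) ^ 4) :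
    Real.exp E ≤ 1 + 1 / (6 * (a + 1) ^ 3) + 10 ^ 9 / (a + 2) ^ 4 := by
  have hd : 10000 ≤ a + 2 := by linarith
  set d := a + 2 with hda
  have ht : a + 1 = d - 1 := by rw [hda]; ring
  rw [ht] at hE ⊢
  have h1 : 1 / (6 * (d - 1) ^ 3) ≤ 2 / d ^ 2 := by
    rw [div_le_div_iff₀ (by have : 0 < d - 1 := by linarith
                            positivity) (by positivity)]
    have e1 : d / 2 ≤ d - 1 := by linarith
    have e2 : (d / 2) ^ 3 ≤ (d - 1) ^ 3 := by gcongr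
    have e3 : 0 ≤ d ^ 2 := by positivity
    nlinarith
  have h2 : 8 * 10 ^ 8 / d ^ 4 ≤ 8 / d ^ 2 := by
    rw [div_le_div_iff₀ (by positivity) (by positivity)]
    have e3 : 0 ≤ d ^ 2 := by positivity
    have e4 : 10000 ^ 2 ≤ d ^ 2 := by gcongr
    nlinarith
  have h3 : E ≤ 10 / d ^ 2 := by
    have : 10 / d ^ 2 = 2 / d ^ 2 + 8 / d ^ 2 := by ring
    linarith
  have h4 : E ^ 2 ≤ 100 / d ^ 4 := by
    calc E ^ 2 ≤ (10 / d ^ 2) ^ 2 := by gcongr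
      _ = 100 / d ^ 4 := by rw [div_pow]; norm_num; ring
  have h5 : E ≤ 1 := by
    refine h3.trans ?_
    rw [div_le_one (by positivity)]
    nlinarith
  have h6 := exp_le_quadratic h0 h5
  have h7 : 8 * 10 ^ 8 / d ^ 4 + 100 / d ^ 4 ≤ 10 ^ 9 / d ^ 4 := by
    rw [← add_div]; gcongr; norm_num
  linarith

lemma ovlTotal_mul_exp_le {a s q : ℝ} (ha : 9998 ≤ a) (hs0 : 0 ≤ s) (hs : s ≤ 1 / (a + 2) ^ 4)
    (hq0 : 0 ≤ q) (hq1 : q ≤ 1 / 2) (hq : q ≤ 12 * 10 ^ 7 / (a + 2) ^ 4) :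
    Real.exp (s + 2 * lamx a 1 - ((a + 2) ^ 2 - 1) / 4 + 2 * q) * ovlTotal a
      ≤ Real.sqrt (1 - 1 / (a + 1) ^ 2) * (1 - q) ^ 2
        * (1 + 1 / (6 * (a + 1) ^ 3) + 10 ^ 9 / (a + 2) ^ 4) := by
  have ht : 0 < a + 1 := by linarith
  have hd : 0 < a + 2 := by linarith
  set u := 1 / (a + 1) with hu
  have hu0 : 0 ≤ u := by positivity
  have hu2 : u ≤ 1 / 2 := by rw [hu]; exact one_div_le_one_div_of_le (by norm_num) (by linarith)
  have hu3 : u ^ 3 / 6 = 1 / (6 * (a + 1) ^ 3) := by rw [hu]; field_simp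
  have hu4 : u ^ 4 ≤ 16 / (a + 2) ^ 4 := by
    have : u ≤ 2 / (a + 2) := by
      rw [hu, div_le_div_iff₀ ht hd]; linarith
    calc u ^ 4 ≤ (2 / (a + 2)) ^ 4 := by gcongr
      _ = 16 / (a + 2) ^ 4 := by rw [div_pow]; norm_num
  have hu40 : 0 ≤ u ^ 4 := by positivity
  have hd10 : 0 < 1 - 1 / (a + 2) := by
    rw [sub_pos, div_lt_one hd]; linarith
  have hprod : Real.sqrt (1 - 1 / (a + 2)) * Real.sqrt (1 - 1 / (a + 1) ^ 2)
      = Real.sqrt (1 - u) := by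
    rw [← Real.sqrt_mul hd10.le]
    congr 1
    rw [hu]; field_simp; ring
  have hsd : 0 < Real.sqrt (1 - 1 / (a + 2)) := Real.sqrt_pos.2 hd10
  have h1 := exp_le_sqrt_one_sub hu0 hu2
  have h2 : Real.exp (-(2 * q)) ≤ 1 - q := by
    have := Real.add_one_le_exp (2 * q)
    rw [Real.exp_neg, inv_le_comm₀ (Real.exp_pos _) (by linarith)]
    refine le_trans ?_ this
    rw [inv_le_iff_one_le_mul₀ (by linarith)]
    nlinarith
  have h2' : Real.exp (-(4 * q)) ≤ (1 - q) ^ 2 := by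
    calc Real.exp (-(4 * q)) = Real.exp (-(2 * q)) ^ 2 := by
          rw [← Real.exp_nat_mul]; congr 1; push_cast; ring
      _ ≤ _ := by gcongr
  set c := 14000 / (a + 2) ^ 4 with hc
  have hc0 : 0 ≤ c := by positivity
  have h3 : 1 + c ≤ Real.exp c := by linarith [Real.add_one_le_exp c]
  have h4 := exp_exponent_le (a := a) (E := s + 6 * q + c + (u ^ 3 / 6 + u ^ 4)) ha
    (by positivity) (by
      rw [hu3]
      have e : 8 * 10 ^ 8 / (a + 2) ^ 4 = 1 / (a + 2) ^ 4 + 6 * (12 * 10 ^ 7 / (a + 2) ^ 4)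
        + 14000 / (a + 2) ^ 4 + 16 / (a + 2) ^ 4 + (8 * 10 ^ 8 - 72 * 10 ^ 7 - 14017)
          / (a + 2) ^ 4 := by ring
      have e2 : 0 ≤ (8 * 10 ^ 8 - 72 * 10 ^ 7 - 14017) / (a + 2) ^ 4 := by
        norm_num; positivity
      rw [e]
      linarith)
  set K := 1 + 1 / (6 * (a + 1) ^ 3) + 10 ^ 9 / (a + 2) ^ 4 with hK
  have hl1 := lamx_one (by linarith : 1 ≤ a)
  have hlc := lamx_centre (by linarith : 1 ≤ a)
  have hexp : s + 2 * lamx a 1 - ((a + 2) ^ 2 - 1) / 4 + 2 * q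
      + (-(1 / 2) - lamx a (1 / (a + 2))) + c
      = -(u / 2 + u ^ 2 / 4 + u ^ 3 / 6 + u ^ 4) + -(4 * q)
        + (s + 6 * q + c + (u ^ 3 / 6 + u ^ 4)) := by
    rw [hl1, hlc, hu]; field_simp; ring
  have main : Real.exp (s + 2 * lamx a 1 - ((a + 2) ^ 2 - 1) / 4 + 2 * q)
      * Real.exp (-(1 / 2) - lamx a (1 / (a + 2))) * (1 + c)
      ≤ Real.sqrt (1 - u) * (1 - q) ^ 2 * K := by
    calc _ ≤ Real.exp (s + 2 * lamx a 1 - ((a + 2) ^ 2 - 1) / 4 + 2 * q)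
          * Real.exp (-(1 / 2) - lamx a (1 / (a + 2))) * Real.exp c := by gcongr
      _ = Real.exp (-(u / 2 + u ^ 2 / 4 + u ^ 3 / 6 + u ^ 4)) * Real.exp (-(4 * q))
          * Real.exp (s + 6 * q + c + (u ^ 3 / 6 + u ^ 4)) := by
          rw [← Real.exp_add, ← Real.exp_add, hexp, Real.exp_add, Real.exp_add]
      _ ≤ _ := by gcongr
  unfold ovlTotal
  rw [← hc]
  rw [← hprod] at main
  refine le_of_mul_le_mul_left ?_ hsd
  refine le_trans (le_of_eq ?_) (main.trans (le_of_eq (by ring)))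
  set S := Real.sqrt (1 - 1 / (a + 2))
  have hS : S * S⁻¹ = 1 := mul_inv_cancel₀ hsd.ne'
  linear_combination (Real.exp (s + 2 * lamx a 1 - ((a + 2) ^ 2 - 1) / 4 + 2 * q)
    * Real.exp (-(1 / 2) - lamx a (1 / (a + 2))) * (1 + c)) * hS

lemma regMain_mul_le {a m : ℕ} (ha : 1 ≤ a) (hm : 1 ≤ m) :
    regMain a m * (oddFac (m * a) / (a.factorial : ℝ) ^ (2 * m))
      ≤ (1 - 1 / ((a:ℝ) + 1) ^ 2) ^ (m * a) * pairMain a m m ^ 2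
        * Real.exp (1 / m + 2 * lamx a 1 - (((a:ℝ) + 2) ^ 2 - 1) / 4) := by
  have h := oddFac_ratio_le ha hm
  have hm' : (m:ℝ) ≠ 0 := by positivity
  have e1 : (a:ℝ) * (a + 2) / (a + 1) ^ 2 = 1 - 1 / ((a:ℝ) + 1) ^ 2 := by field_simp; ring
  rw [e1] at h
  have e2 : ((a + 2).factorial : ℝ) = ((a:ℝ) + 2) * ((a + 1) * a.factorial) := by
    rw [Nat.factorial_succ, Nat.factorial_succ]; push_cast; ring
  have e3 : Real.exp (1 / m + 2 * lamx a 1 - (((a:ℝ) + 2) ^ 2 - 1) / 4)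
      = Real.exp (1 / m) * Real.exp (lamx a 1) ^ 2
        * Real.exp (-((((a:ℝ) + 2) ^ 2 - 1) / 4)) := by
    rw [← Real.exp_nat_mul, ← Real.exp_add, ← Real.exp_add]; congr 1
  unfold regMain pairMain
  rw [div_self hm', e2, e3, show m * a + m = m * (a + 1) by ring, Real.exp_neg (lamx a 1)]
  have p0 := oddFac_pos (m * a)
  have p1 := oddFac_pos (m * (a + 1))
  have p2 := oddFac_pos (m * (a + 2))
  set O0 := oddFac (m * a)
  set O1 := oddFac (m * (a + 1))
  set O2 := oddFac (m * (a + 2))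
  set l := Real.exp (lamx a 1)
  have hl : 0 < l := Real.exp_pos _
  set E := Real.exp (-((((a:ℝ) + 2) ^ 2 - 1) / 4))
  have hE : 0 < E := Real.exp_pos _
  set f : ℝ := (a.factorial : ℝ) with hf
  have hf0 : 0 < f := by rw [hf]; positivity
  have hc : 0 ≤ (O1 / (f ^ (2 * m) * ((a:ℝ) + 1) ^ (2 * m))) ^ 2 * E := by positivity
  refine le_trans (le_of_eq ?_) ((mul_le_mul_of_nonneg_right h hc).trans (le_of_eq ?_))
  · rw [mul_pow, mul_pow, div_pow ((a:ℝ) + 1)]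
    field_simp
  · field_simp

end SecondMomentConstant

section SecondMoment

set_option linter.unusedSectionVars false

variable {V : Type*} [Fintype V] [DecidableEq V]

lemma Regime.qe_le {a : ℕ} (R : Regime V (a + 2)) :
    qe (a + 2) ≤ 12 * 10 ^ 7 / ((a:ℝ) + 2) ^ 4 := by
  have h := R.large'
  unfold qe
  push_cast at h ⊢
  rw [div_le_div_iff₀ (by positivity) (by positivity)]
  have h2 : (10000:ℝ) ^ 2 ≤ ((a:ℝ) + 2) ^ 2 := by gcongr
  have h4 : (0:ℝ) ≤ ((a:ℝ) + 2) ^ 4 := by positivity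
  nlinarith [mul_le_mul_of_nonneg_left h2 h4]

/-- The bookkeeping of the second moment. -/
lemma second_moment_aux {S1 S2 N o Of U A p q Z c K w X e : ℝ} (hN : 0 ≤ N) (ho : 0 ≤ o)
    (hU0 : 0 ≤ U)
    (hw : 0 < w) (hX : 0 < X) (he : 0 < e) (hq : q < 1) (hp : 0 ≤ p) (hS2 : 0 ≤ S2)
    (hK : 0 ≤ K) (hZ : 0 ≤ Z) (hoN : o ≤ N) (hA : A ≤ U * e) (hS1 : N * (p * (1 - q)) ≤ S1)
    (hpair : S2 * (X * w) ≤ N * (o * Of * e * Z)) (hmain : U * Of ≤ X * p ^ 2 * c)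
    (hconst : c * e ^ 2 * Z ≤ w * (1 - q) ^ 2 * K) :
    A * S2 ≤ K * S1 ^ 2 := by
  have h1 : 0 ≤ N * (p * (1 - q)) := by
    have : 0 ≤ 1 - q := by linarith
    positivity
  have h2 : (N * (p * (1 - q))) ^ 2 ≤ S1 ^ 2 := by gcongr
  have h3 : A * S2 * (X * w) ≤ K * S1 ^ 2 * (X * w) := by
    calc A * S2 * (X * w) ≤ U * e * S2 * (X * w) := by gcongr
      _ = U * e * (S2 * (X * w)) := by ring
      _ ≤ U * e * (N * (o * Of * e * Z)) := by gcongr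
      _ = N * o * e ^ 2 * Z * (U * Of) := by ring
      _ ≤ N * o * e ^ 2 * Z * (X * p ^ 2 * c) := by gcongr
      _ = N * o * X * p ^ 2 * (c * e ^ 2 * Z) := by ring
      _ ≤ N * o * X * p ^ 2 * (w * (1 - q) ^ 2 * K) := by gcongr
      _ ≤ N * N * X * p ^ 2 * (w * (1 - q) ^ 2 * K) := by gcongr
      _ = (N * (p * (1 - q))) ^ 2 * (K * (X * w)) := by ring
      _ ≤ S1 ^ 2 * (K * (X * w)) := by gcongr
      _ = _ := by ring
  exact le_of_mul_le_mul_right h3 (by positivity)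

/-- The second moment of the number of perfect matchings. -/
lemma sum_pms_sq_le {d : ℕ} (R : Regime V d) :
    ((regs V d).card : ℝ) * ∑ G ∈ regs V d, (pms G : ℝ) ^ 2
      ≤ (1 + 1 / (6 * ((d:ℝ) - 1) ^ 3) + 10 ^ 9 / (d:ℝ) ^ 4)
        * (∑ G ∈ regs V d, (pms G : ℝ)) ^ 2 := by
  obtain ⟨a, rfl⟩ : ∃ a, d = a + 2 := ⟨d - 2, by have := R.large; omega⟩
  obtain ⟨m, hm2⟩ := R.even
  have hV : Fintype.card V = 2 * m := by omega
  have hm := R.one_le_half_card hV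
  have hm0 : (0:ℝ) < m := by exact_mod_cast hm
  have ha := R.large'
  push_cast at ha
  have ha' : (9998:ℝ) ≤ a := by linarith
  have hq0 := qe_nonneg (a + 2)
  have hq1 := qe_small R.large
  have hs : 1 / (m:ℝ) ≤ 1 / ((a:ℝ) + 2) ^ 4 := by
    have h := R.pow_le'
    have hV' : (Fintype.card V : ℝ) = 2 * m := by exact_mod_cast hV
    rw [hV'] at h
    push_cast at h
    refine one_div_le_one_div_of_le (by positivity) ?_
    have h1 : (2:ℝ) ≤ ((a:ℝ) + 2) ^ 6 := by
      calc (2:ℝ) ≤ 10000 ^ 6 := by norm_num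
        _ ≤ _ := by gcongr
    have h2 : (0:ℝ) ≤ ((a:ℝ) + 2) ^ 4 := by positivity
    nlinarith [mul_le_mul_of_nonneg_left h1 h2]
  have e1 : ∑ G ∈ regs V (a + 2), (pms G : ℝ) = ∑ M ∈ regs V 1, (extc (a + 2) M : ℝ) := by
    exact_mod_cast sum_pms (V := V) (a + 2)
  have e2 : ∑ G ∈ regs V (a + 2), (pms G : ℝ) ^ 2
      = ∑ M ∈ regs V 1, ∑ M' ∈ regs V 1, (extc (a + 2) (M ⊔ M') : ℝ) := by
    exact_mod_cast sum_pms_sq (V := V) (a + 2)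
  rw [e1, e2]
  have e3 : ((a + 2 : ℕ) : ℝ) - 1 = a + 1 := by push_cast; ring
  rw [e3, show ((a + 2 : ℕ) : ℝ) = a + 2 by push_cast; ring]
  set ρ : ℝ := 1 / ((a:ℝ) + 1) ^ 2 with hρ
  have hρ1 : 0 < 1 - ρ := by
    rw [hρ, sub_pos, div_lt_one (by positivity)]; nlinarith
  have hpow : (1 - ρ) ^ (((m * a : ℕ) : ℝ) + 1 / 2) = (1 - ρ) ^ (m * a) * Real.sqrt (1 - ρ) := by
    rw [Real.rpow_add hρ1, Real.rpow_natCast, Real.sqrt_eq_rpow]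
  have hO := oddFac_pos m
  have hZ : 0 ≤ ovlTotal a := by unfold ovlTotal; positivity
  have hoN : oddFac m ≤ ((regs V 1).card : ℝ) := by unfold oddFac; exact card_matchings_ge hV
  have hA := card_regs_le R hV
  have hU : 0 ≤ regMain a m := by
    have := oddFac_pos (m * (a + 2))
    unfold regMain; positivity
  have hS1 : ((regs V 1).card : ℝ) * (pairMain a m m * (1 - qe (a + 2)))
      ≤ ∑ M ∈ regs V 1, (extc (a + 2) M : ℝ) := by
    rw [← nsmul_eq_mul]
    exact Finset.card_nsmul_le_sum _ _ _ fun M hM => extc_matching_ge R hV hM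
  have hpair : (∑ M ∈ regs V 1, ∑ M' ∈ regs V 1, (extc (a + 2) (M ⊔ M') : ℝ))
      * ((1 - ρ) ^ (m * a) * Real.sqrt (1 - ρ)) ≤ ((regs V 1).card : ℝ)
        * (oddFac m * (oddFac (m * a) / (a.factorial : ℝ) ^ (2 * m)) * Real.exp (qe (a + 2))
          * ovlTotal a) := by
    rw [← hpow, Finset.sum_mul, ← nsmul_eq_mul]
    exact Finset.sum_le_card_nsmul _ _ _ fun M hM => sum_extc_pair_le R hV hM
  have hmain := regMain_mul_le (by have := R.large; omega : 1 ≤ a) hm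
  rw [← hρ] at hmain
  have hconst := ovlTotal_mul_exp_le ha' (by positivity : 0 ≤ 1 / (m:ℝ)) hs hq0 (by linarith)
    R.qe_le
  rw [← hρ, Real.exp_add, mul_comm (2:ℝ) (qe _), Real.exp_mul, Real.rpow_two] at hconst
  have hX : 0 < (1 - ρ) ^ (m * a) := pow_pos hρ1 _
  have hS2 : 0 ≤ ∑ M ∈ regs V 1, ∑ M' ∈ regs V 1, (extc (a + 2) (M ⊔ M') : ℝ) :=
    Finset.sum_nonneg fun M _ => Finset.sum_nonneg fun M' _ => Nat.cast_nonneg _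
  have hK : 0 ≤ 1 + 1 / (6 * ((a:ℝ) + 1) ^ 3) + 10 ^ 9 / ((a:ℝ) + 2) ^ 4 := by positivity
  have hq : qe (a + 2) < 1 := by linarith
  exact second_moment_aux (Nat.cast_nonneg _) hO.le hU (Real.sqrt_pos.2 hρ1) hX (Real.exp_pos _)
    hq (pairMain_pos a m m).le hS2 hK hZ hoN hA hS1 hpair hmain hconst

end SecondMoment

section Deviation

/-- The second moment after removing the linear projection on `T`. -/
lemma sum_residual_sq_le {ι : Type*} {s : Finset ι} {Y T : ι → ℝ} {l c α τ η σ : ℝ}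
    (hs : s.Nonempty) (hB : 0 < ∑ i ∈ s, Y i) (hc : 0 ≤ c)
    (h1 : (s.card : ℝ) * ∑ i ∈ s, Y i ^ 2 ≤ (1 + α) * (∑ i ∈ s, Y i) ^ 2)
    (h2 : ∑ i ∈ s, Y i * T i ≤ τ * ∑ i ∈ s, Y i)
    (h3 : (l - η) * s.card ≤ ∑ i ∈ s, T i)
    (h4 : ∑ i ∈ s, (T i - l) ^ 2 ≤ σ * s.card) :
    ∑ i ∈ s, (Y i * (s.card / ∑ j ∈ s, Y j) - 1 + c * (T i - l)) ^ 2
      ≤ (α + 2 * c * (τ - l + η) + c ^ 2 * σ) * s.card := by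
  have hN : 0 < (s.card : ℝ) := by exact_mod_cast hs.card_pos
  set N : ℝ := (s.card : ℝ) with hNe
  set B := ∑ i ∈ s, Y i with hBe
  have h1N : ∑ _i ∈ s, (1:ℝ) = N := by simp [hNe]
  have key : ∑ i ∈ s, (Y i * (N / B) - 1 + c * (T i - l)) ^ 2
      = (N / B) ^ 2 * ∑ i ∈ s, Y i ^ 2 - 2 * (N / B) * B + N
        + 2 * c * ((N / B) * ∑ i ∈ s, Y i * T i - l * (N / B) * B - ∑ i ∈ s, T i + l * N)
        + c ^ 2 * ∑ i ∈ s, (T i - l) ^ 2 := by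
    rw [hBe, ← h1N]
    simp only [Finset.mul_sum, ← Finset.sum_add_distrib, ← Finset.sum_sub_distrib]
    exact Finset.sum_congr rfl fun i _ => by ring
  have e : N / B * B = N := div_mul_cancel₀ _ hB.ne'
  have b1 : (N / B) ^ 2 * ∑ i ∈ s, Y i ^ 2 ≤ (1 + α) * N := by
    have : (N / B) ^ 2 * ∑ i ∈ s, Y i ^ 2 = N / B ^ 2 * (N * ∑ i ∈ s, Y i ^ 2) := by ring
    rw [this]
    calc _ ≤ N / B ^ 2 * ((1 + α) * B ^ 2) := by gcongr
      _ = _ := by field_simp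
  have b2 : (N / B) * ∑ i ∈ s, Y i * T i ≤ τ * N := by
    calc _ ≤ (N / B) * (τ * B) := by gcongr
      _ = _ := by field_simp
  have b3 : (N / B) * ∑ i ∈ s, Y i * T i - l * (N / B) * B - ∑ i ∈ s, T i + l * N
      ≤ (τ - l + η) * N := by
    have : l * (N / B) * B = l * N := by rw [mul_assoc, e]
    rw [this]; linarith
  have b4 := mul_le_mul_of_nonneg_left b3 (by positivity : 0 ≤ 2 * c)
  have b5 := mul_le_mul_of_nonneg_left h4 (sq_nonneg c)
  rw [key, mul_assoc 2 (N / B) B, e]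
  linarith

/-- A union bound of Chebyshev type. -/
lemma card_filter_le_of_moments {ι : Type*} {s : Finset ι} {f g : ι → ℝ} {ε A B : ℝ}
    (hε : 0 < ε) (p : ι → Prop) [DecidablePred p] (hp : ∀ i ∈ s, p i → ε ≤ |f i|)
    (hA : ∑ i ∈ s, (f i + g i) ^ 2 ≤ A) (hB : ∑ i ∈ s, g i ^ 4 ≤ B) :
    ((s.filter p).card : ℝ) ≤ 4 / ε ^ 2 * A + 16 / ε ^ 4 * B := by
  have h1 : ∀ i ∈ s.filter p, (1:ℝ) ≤ 4 / ε ^ 2 * (f i + g i) ^ 2 + 16 / ε ^ 4 * g i ^ 4 := by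
    intro i hi
    obtain ⟨his, hpi⟩ := Finset.mem_filter.1 hi
    have h := hp i his hpi
    have n1 : 0 ≤ 4 / ε ^ 2 * (f i + g i) ^ 2 := by positivity
    have n2 : 0 ≤ 16 / ε ^ 4 * g i ^ 4 := by positivity
    by_cases hg : ε / 2 ≤ |g i|
    · have : 1 ≤ 16 / ε ^ 4 * g i ^ 4 := by
        have e : g i ^ 4 = |g i| ^ 4 := by rw [← abs_pow, abs_of_nonneg (by positivity)]
        rw [e]
        calc (1:ℝ) = 16 / ε ^ 4 * (ε / 2) ^ 4 := by field_simp; norm_num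
          _ ≤ _ := by gcongr
      linarith
    · have hfg : ε / 2 ≤ |f i + g i| := by
        have := abs_sub_abs_le_abs_sub (f i) (-g i)
        rw [abs_neg, sub_neg_eq_add] at this
        linarith
      have : 1 ≤ 4 / ε ^ 2 * (f i + g i) ^ 2 := by
        rw [← sq_abs (f i + g i)]
        calc (1:ℝ) = 4 / ε ^ 2 * (ε / 2) ^ 2 := by field_simp; norm_num
          _ ≤ _ := by gcongr
      linarith
  calc ((s.filter p).card : ℝ) = ∑ i ∈ s.filter p, (1:ℝ) := by simp
    _ ≤ ∑ i ∈ s.filter p, (4 / ε ^ 2 * (f i + g i) ^ 2 + 16 / ε ^ 4 * g i ^ 4) :=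
        Finset.sum_le_sum h1
    _ ≤ ∑ i ∈ s, (4 / ε ^ 2 * (f i + g i) ^ 2 + 16 / ε ^ 4 * g i ^ 4) :=
        Finset.sum_le_sum_of_subset_of_nonneg (Finset.filter_subset _ _) fun i _ _ => by positivity
    _ = 4 / ε ^ 2 * ∑ i ∈ s, (f i + g i) ^ 2 + 16 / ε ^ 4 * ∑ i ∈ s, g i ^ 4 := by
        rw [Finset.sum_add_distrib, ← Finset.mul_sum, ← Finset.mul_sum]
    _ ≤ _ := by gcongr

set_option linter.unusedSectionVars false

variable {V : Type*} [Fintype V] [DecidableEq V]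

lemma triMean_def (d : ℕ) : triMean d = ((d:ℝ) - 1) ^ 3 / 6 := rfl

lemma sum_pms_pos {d : ℕ} (R : Regime V d) : 0 < ∑ G ∈ regs V d, (pms G : ℝ) := by
  obtain ⟨a, rfl⟩ : ∃ a, d = a + 2 := ⟨d - 2, by have := R.large; omega⟩
  obtain ⟨m, hm2⟩ := R.even
  have hV : Fintype.card V = 2 * m := by omega
  have e1 : ∑ G ∈ regs V (a + 2), (pms G : ℝ) = ∑ M ∈ regs V 1, (extc (a + 2) M : ℝ) := by
    exact_mod_cast sum_pms (V := V) (a + 2)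
  have hne : (regs V 1).Nonempty := by
    have h := card_matchings_ge hV
    have h2 := oddFac_pos m
    unfold oddFac at h2
    have : (0:ℝ) < (regs V 1).card := by linarith
    exact Finset.card_pos.1 (by exact_mod_cast this)
  rw [e1]
  refine Finset.sum_pos (fun M hM => ?_) hne
  refine lt_of_lt_of_le (mul_pos (pairMain_pos a m m) ?_) (extc_matching_ge R hV hM)
  have := qe_small R.large
  linarith

/-- The moment constants, in terms of the degree. -/
lemma residual_const_le {d e : ℝ} (hd : 10000 ≤ d) (he : e * d ^ 6 = 10 ^ 17) :
    (1 / (6 * (d - 1) ^ 3) + 10 ^ 9 / d ^ 4)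
      + 2 * (1 / (d - 1) ^ 3) * ((1 + 4 * e) * (((d - 1) ^ 3 - 1) / 6) - (d - 1) ^ 3 / 6
        + 24 * e * ((d - 1) ^ 3 / 6))
      + (1 / (d - 1) ^ 3) ^ 2 * ((d - 1) ^ 3 / 6 + 10 ^ 18) ≤ 10 ^ 12 / d ^ 4 := by
  have ht : 0 < d - 1 := by linarith
  have hd2 : (10000:ℝ) ^ 2 ≤ d ^ 2 := by gcongr
  have h1 : e = 10 ^ 17 / d ^ 6 := by rw [← he]; field_simp
  have h2 : e ≤ 10 ^ 9 / d ^ 4 := by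
    rw [h1, div_le_div_iff₀ (by positivity) (by positivity)]
    nlinarith [mul_le_mul_of_nonneg_left hd2 (by positivity : 0 ≤ d ^ 4)]
  have he0 : 0 ≤ e := by rw [h1]; positivity
  have h3 : 10 ^ 18 * (1 / (d - 1) ^ 3) ^ 2 ≤ 64 * 10 ^ 10 / d ^ 4 := by
    have e1 : d / 2 ≤ d - 1 := by linarith
    have e2 : (d / 2) ^ 6 ≤ (d - 1) ^ 6 := by gcongr
    have e3 : 10 ^ 18 * (1 / (d - 1) ^ 3) ^ 2 = 10 ^ 18 / (d - 1) ^ 6 := by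
      rw [div_pow, ← pow_mul]; ring
    rw [e3, div_le_div_iff₀ (by positivity) (by positivity)]
    nlinarith [mul_le_mul_of_nonneg_left hd2 (by positivity : 0 ≤ d ^ 4)]
  set r := 1 / (d - 1) ^ 3 with hr
  have hr0 : 0 ≤ r := by positivity
  have hrt : r * (d - 1) ^ 3 = 1 := by rw [hr]; field_simp
  have hr6 : 1 / (6 * (d - 1) ^ 3) = r / 6 := by rw [hr]; field_simp
  rw [hr6]
  set t := (d - 1) ^ 3
  have main : r / 6 + 10 ^ 9 / d ^ 4 + 2 * r * ((1 + 4 * e) * ((t - 1) / 6) - t / 6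
      + 24 * e * (t / 6)) + r ^ 2 * (t / 6 + 10 ^ 18)
      = 10 ^ 9 / d ^ 4 + 28 / 3 * e - 4 / 3 * e * r + 10 ^ 18 * r ^ 2 := by
    linear_combination (28 / 3 * e + r / 6) * hrt
  rw [main]
  have : 0 ≤ 4 / 3 * e * r := by positivity
  have e5 : 10 ^ 12 / d ^ 4 = 10 ^ 9 / d ^ 4 + 28 / 3 * (10 ^ 9 / d ^ 4) + 64 * 10 ^ 10 / d ^ 4
      + (10 ^ 12 - 10 ^ 9 - 28 / 3 * 10 ^ 9 - 64 * 10 ^ 10) / d ^ 4 := by ring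
  have e6 : 0 ≤ (10 ^ 12 - 10 ^ 9 - 28 / 3 * 10 ^ 9 - 64 * 10 ^ 10) / d ^ 4 := by
    norm_num; positivity
  rw [e5]
  linarith

/-- The residual second moment with the constants of the regular graph model. -/
lemma sum_residual_sq_le_of_large {ι : Type*} {s : Finset ι} {Y T : ι → ℝ} {d e l c : ℝ}
    (hd : 10000 ≤ d) (he : e * d ^ 6 = 10 ^ 17) (hl : l = (d - 1) ^ 3 / 6)
    (hcd : c = 1 / (d - 1) ^ 3)
    (hs : s.Nonempty) (hB : 0 < ∑ i ∈ s, Y i)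
    (h1 : (s.card : ℝ) * ∑ i ∈ s, Y i ^ 2
      ≤ (1 + 1 / (6 * (d - 1) ^ 3) + 10 ^ 9 / d ^ 4) * (∑ i ∈ s, Y i) ^ 2)
    (h2 : ∑ i ∈ s, Y i * T i ≤ (1 + 4 * e) * (((d - 1) ^ 3 - 1) / 6) * ∑ i ∈ s, Y i)
    (h3 : (l - 24 * e * l) * s.card ≤ ∑ i ∈ s, T i)
    (h4 : ∑ i ∈ s, (T i - l) ^ 2 ≤ (l + 10 ^ 18) * s.card) :
    ∑ i ∈ s, (Y i * (s.card / ∑ j ∈ s, Y j) - 1 + c * (T i - l)) ^ 2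
      ≤ 10 ^ 12 / d ^ 4 * s.card := by
  have ht : 0 < d - 1 := by linarith
  have hc : 0 ≤ c := by rw [hcd]; positivity
  rw [add_assoc] at h1
  have h := sum_residual_sq_le hs hB hc h1 h2 h3 h4
  refine h.trans (mul_le_mul_of_nonneg_right ?_ (Nat.cast_nonneg _))
  rw [hcd, hl]
  exact residual_const_le hd he

lemma deviation_const_le {d : ℝ} (hd : 10000 ≤ d) :
    4 / (d ^ (-(1.1:ℝ))) ^ 2 * (10 ^ 12 / d ^ 4)
      + 16 / (d ^ (-(1.1:ℝ))) ^ 4 * ((1 / (d - 1) ^ 3) ^ 4 * (10 ^ 19 * d ^ 6))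
      ≤ 10 ^ 24 * d ^ (-(1.1:ℝ)) := by
  have hd0 : 0 < d := by linarith
  set ε := d ^ (-(1.1:ℝ)) with hε
  have hε0 : 0 < ε := Real.rpow_pos_of_pos hd0 _
  have h1 : 1 ≤ d ^ 4 * ε ^ 3 := by
    rw [hε, ← Real.rpow_natCast, ← Real.rpow_natCast, ← Real.rpow_mul hd0.le, ← Real.rpow_add hd0]
    exact Real.one_le_rpow (by linarith) (by norm_num)
  have h2 : 1 ≤ d ^ 6 * ε ^ 5 := by
    rw [hε, ← Real.rpow_natCast, ← Real.rpow_natCast, ← Real.rpow_mul hd0.le, ← Real.rpow_add hd0]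
    exact Real.one_le_rpow (by linarith) (by norm_num)
  have h3 : (1 / (d - 1) ^ 3) ^ 4 * (10 ^ 19 * d ^ 6) ≤ 4096 * 10 ^ 19 / d ^ 6 := by
    have ht : 0 < d - 1 := by linarith
    have e1 : d / 2 ≤ d - 1 := by linarith
    have e2 : (d / 2) ^ 12 ≤ (d - 1) ^ 12 := by gcongr
    have e3 : (1 / (d - 1) ^ 3) ^ 4 * (10 ^ 19 * d ^ 6) = 10 ^ 19 * d ^ 6 / (d - 1) ^ 12 := by
      rw [div_pow, ← pow_mul]; ring
    rw [e3, div_le_div_iff₀ (by positivity) (by positivity)]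
    nlinarith
  have h4 : 4 / ε ^ 2 * (10 ^ 12 / d ^ 4) ≤ 4 * 10 ^ 12 * ε := by
    rw [div_mul_div_comm, div_le_iff₀ (by positivity)]
    have : 4 * 10 ^ 12 * ε * (ε ^ 2 * d ^ 4) = 4 * 10 ^ 12 * (d ^ 4 * ε ^ 3) := by ring
    rw [this]
    linarith
  have h5 : 16 / ε ^ 4 * ((1 / (d - 1) ^ 3) ^ 4 * (10 ^ 19 * d ^ 6))
      ≤ 16 * (4096 * 10 ^ 19) * ε := by
    calc _ ≤ 16 / ε ^ 4 * (4096 * 10 ^ 19 / d ^ 6) := by gcongr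
      _ ≤ _ := by
        rw [div_mul_div_comm, div_le_iff₀ (by positivity)]
        have : 16 * (4096 * 10 ^ 19) * ε * (ε ^ 4 * d ^ 6)
          = 16 * (4096 * 10 ^ 19) * (d ^ 6 * ε ^ 5) := by ring
        rw [this]
        linarith
  linarith

open scoped Classical in
/-- The concentration of the number of perfect matchings, as a count. -/
lemma card_deviation_le {d : ℕ} (R : Regime V d) {E : ℝ}
    (hE : E = (∑ G ∈ regs V d, (pms G : ℝ)) / (regs V d).card) :
    (((regs V d).filter fun G => (d:ℝ) ^ (-(1.1:ℝ)) * E ≤ |(pms G : ℝ) - E|).card : ℝ)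
      ≤ 10 ^ 24 * (d:ℝ) ^ (-(1.1:ℝ)) * (regs V d).card := by
  have hB := sum_pms_pos R
  have hd := R.large'
  have hne : (regs V d).Nonempty := by
    by_contra h
    rw [Finset.not_nonempty_iff_eq_empty] at h
    rw [h, Finset.sum_empty] at hB
    exact lt_irrefl _ hB
  have hN : 0 < ((regs V d).card : ℝ) := by exact_mod_cast hne.card_pos
  have hE0 : 0 < E := hE ▸ div_pos hB hN
  have ht : 0 < (d:ℝ) - 1 := by linarith
  have hnear := (abs_le.1 (sum_triCount_near R)).1
  have h3 : (triMean d - 24 * ee d * triMean d) * (regs V d).card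
      ≤ ∑ G ∈ regs V d, (triCount G : ℝ) := by
    rw [sub_mul]; linarith
  have hA := sum_residual_sq_le_of_large (c := 1 / ((d:ℝ) - 1) ^ 3) hd (ee_mul_pow d R.large)
    (triMean_def d) rfl hne hB (sum_pms_sq_le R) (sum_pms_mul_triCount_le R) h3
    (sum_triCount_sq_le R)
  have h4 : ∑ G ∈ regs V d, (1 / ((d:ℝ) - 1) ^ 3 * ((triCount G : ℝ) - triMean d)) ^ 4
      ≤ (1 / ((d:ℝ) - 1) ^ 3) ^ 4 * (10 ^ 19 * (d:ℝ) ^ 6) * (regs V d).card := by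
    simp only [mul_pow (1 / ((d:ℝ) - 1) ^ 3)]
    rw [← Finset.mul_sum, mul_assoc]
    exact mul_le_mul_of_nonneg_left (sum_triCount_fourth_le R) (by positivity)
  have hε : 0 < (d:ℝ) ^ (-(1.1:ℝ)) := Real.rpow_pos_of_pos (by linarith) _
  refine (card_filter_le_of_moments hε _ (fun G _ hG => ?_) hA h4).trans ?_
  · have e : (pms G : ℝ) * ((regs V d).card / ∑ G ∈ regs V d, (pms G : ℝ)) - 1
        = ((pms G : ℝ) - E) / E := by
      rw [sub_div, div_self hE0.ne', hE]
      field_simp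
    rw [e, abs_div, abs_of_pos hE0, le_div_iff₀ hE0]
    exact hG
  · have := mul_le_mul_of_nonneg_right (deviation_const_le hd) hN.le
    refine le_trans (le_of_eq ?_) this
    ring

end Deviation

section Translation

lemma isRegularGraph_iff {n d : ℕ} (G : SimpleGraph (Fin n)) :
    IsRegularGraph G d ↔ G ∈ regs (Fin n) d := by
  classical
  rw [mem_regs]
  refine forall_congr' fun v => ?_
  have : gDeg G v = dg G v := by
    unfold gDeg dg
    exact Nat.subtype_card _ (by simp)
  rw [this]

lemma card_isRegularGraph (n d : ℕ) :
    Nat.card {H : SimpleGraph (Fin n) // IsRegularGraph H d} = (regs (Fin n) d).card :=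
  Nat.subtype_card _ fun G => (isRegularGraph_iff G).symm

lemma pmCount_eq {n : ℕ} (G : SimpleGraph (Fin n)) : pmCount G = pms G := by
  classical
  unfold pmCount pms
  refine Nat.subtype_card _ fun M => ?_
  rw [Finset.mem_filter, isRegularGraph_iff, and_comm]

open scoped Classical in
lemma mu_apply (n d : ℕ) (G : SimpleGraph (Fin n)) :
    mu n d G = if G ∈ regs (Fin n) d then ((regs (Fin n) d).card : ℝ)⁻¹ else 0 := by
  unfold mu
  rw [card_isRegularGraph]
  simp only [isRegularGraph_iff]

lemma expec_mu (n d : ℕ) (f : SimpleGraph (Fin n) → ℝ) :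
    expec (mu n d) f = (∑ G ∈ regs (Fin n) d, f G) / (regs (Fin n) d).card := by
  classical
  unfold expec
  rw [tsum_eq_sum (s := regs (Fin n) d)]
  · rw [Finset.sum_div]
    refine Finset.sum_congr rfl fun G hG => ?_
    rw [mu_apply, if_pos hG, inv_mul_eq_div]
  · intro G hG
    rw [mu_apply, if_neg hG, zero_mul]

open scoped Classical in
lemma probOf_mu (n d : ℕ) (p : SimpleGraph (Fin n) → Prop) :
    probOf (mu n d) {G | p G}
      = (((regs (Fin n) d).filter p).card : ℝ) / (regs (Fin n) d).card := by
  unfold probOf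
  rw [tsum_subtype, tsum_eq_sum (s := (regs (Fin n) d).filter p)]
  · rw [Finset.sum_congr rfl (g := fun _ => ((regs (Fin n) d).card : ℝ)⁻¹), Finset.sum_const,
      nsmul_eq_mul, div_eq_mul_inv]
    intro G hG
    obtain ⟨h1, h2⟩ := Finset.mem_filter.1 hG
    rw [Set.indicator_of_mem (by exact h2), mu_apply, if_pos h1]
  · intro G hG
    by_cases h : p G
    · rw [Set.indicator_of_mem (by exact h), mu_apply, if_neg]
      exact fun h1 => hG (Finset.mem_filter.2 ⟨h1, h⟩)
    · exact Set.indicator_of_notMem (by exact h) _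

lemma probOf_mu_le_one (n d : ℕ) (p : SimpleGraph (Fin n) → Prop) :
    probOf (mu n d) {G | p G} ≤ 1 := by
  classical
  rw [probOf_mu]
  refine div_le_one_of_le₀ ?_ (Nat.cast_nonneg _)
  exact_mod_cast Finset.card_filter_le _ _

lemma regime_of_le {m d : ℕ} (hd : 10000 ≤ d)
    (hdm : (d : ℝ) ≤ ((2 * m : ℕ) : ℝ) ^ ((1:ℝ) / 10)) : Regime (Fin (2 * m)) d where
  large := hd
  even := by simp
  pow_le := by
    rw [Fintype.card_fin]
    have h : (d:ℝ) ^ 10 ≤ (((2 * m : ℕ) : ℝ) ^ ((1:ℝ) / 10)) ^ 10 := by gcongr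
    rw [← Real.rpow_natCast (_ ^ ((1:ℝ) / 10)), ← Real.rpow_mul (Nat.cast_nonneg _)] at h
    norm_num only [Nat.cast_ofNat, Real.rpow_one] at h
    exact_mod_cast h

lemma one_le_mul_rpow {d : ℕ} (h3 : 3 ≤ d) (hd : d < 10000) :
    1 ≤ 10 ^ 24 * (d:ℝ) ^ (-(1.1:ℝ)) := by
  have h0 : (0:ℝ) < d := by exact_mod_cast (by omega : 0 < d)
  have h1 : (1:ℝ) ≤ d := by exact_mod_cast (by omega : 1 ≤ d)
  have h2 : (d:ℝ) ≤ 10000 := by exact_mod_cast hd.le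
  have h4 : (d:ℝ) ^ (1.1:ℝ) ≤ 10 ^ 24 := by
    calc (d:ℝ) ^ (1.1:ℝ) ≤ (d:ℝ) ^ (2:ℝ) := Real.rpow_le_rpow_of_exponent_le h1 (by norm_num)
      _ = (d:ℝ) ^ 2 := Real.rpow_two _
      _ ≤ 10000 ^ 2 := by gcongr
      _ ≤ 10 ^ 24 := by norm_num
  rw [Real.rpow_neg h0.le, ← div_eq_mul_inv, le_div_iff₀ (Real.rpow_pos_of_pos h0 _), one_mul]
  exact h4

lemma probOf_pmCount_deviation_le {m d : ℕ} (h3 : 3 ≤ d)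
    (hdm : (d : ℝ) ≤ ((2 * m : ℕ) : ℝ) ^ ((1:ℝ) / 10)) :
    probOf (mu (2 * m) d)
        {G | (d : ℝ) ^ (-(1.1 : ℝ)) * expec (mu (2 * m) d) (fun H => (pmCount H : ℝ)) ≤
          |(pmCount G : ℝ) - expec (mu (2 * m) d) (fun H => (pmCount H : ℝ))|} ≤
      10 ^ 24 * (d : ℝ) ^ (-(1.1 : ℝ)) := by
  classical
  rcases lt_or_ge d 10000 with hd | hd
  · exact (probOf_mu_le_one _ _ _).trans (one_le_mul_rpow h3 hd)
  · have h := card_deviation_le (regime_of_le hd hdm) (expec_mu (2 * m) d fun H => (pms H : ℝ))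
    rw [probOf_mu]
    simp only [pmCount_eq]
    refine div_le_of_le_mul₀ (Nat.cast_nonneg _) (by positivity) ?_
    convert h

end Translation

/-- There is `C₀ > 0` such that for every even `n = 2m` and every
`3 ≤ d ≤ n^{1/10}`, the number `Y` of perfect matchings of `G ~ μ_{d,n}` satisfies
`P(|Y - E[Y]| ≥ d^{-1.1} E[Y]) ≤ C₀ d^{-1.1}`. -/
theorem statement_12 :
    ∃ C₀ : ℝ, 0 < C₀ ∧
      ∀ m d : ℕ, 3 ≤ d → (d : ℝ) ≤ ((2*m : ℕ) : ℝ) ^ ((1:ℝ)/10) →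
        probOf (mu (2*m) d)
          {G | (d : ℝ) ^ (-(1.1 : ℝ)) *
                expec (mu (2*m) d) (fun H => (pmCount H : ℝ)) ≤
              |(pmCount G : ℝ) - expec (mu (2*m) d) (fun H => (pmCount H : ℝ))|} ≤
        C₀ * (d : ℝ) ^ (-(1.1 : ℝ)) := by
  refine ⟨10 ^ 24, by norm_num, fun m d h3 hdm => ?_⟩
  exact probOf_pmCount_deviation_le h3 hdm
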